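/- The cd-index of a near-Gorenstein* poset has non-negative integer coefficients: if (Π,∂Π) is a near-Gorenstein* poset of rank n, then every coefficient of the cd-monomials in Ψ_Π(c,d) = Φ_Π(c,d) + Ψ_{∂Π}(c,d) is a non-negative integer. -/

import Mathlib

open scoped Classical

noncomputable section

/-- The ring of polynomials in two non-commuting variables `a`, `b` (with rational
coefficients), in which `ab`-indices and `cd`-indices live. -/
abbrev NC := FreeAlgebra ℚ (Fin 2)

/-- The variable `a`. -/
def va : NC := FreeAlgebra.ι ℚ 0
/-- The variable `b`. -/
def vb : NC := FreeAlgebra.ι ℚ 1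
/-- `c = a + b`. -/
def vc : NC := va + vb
/-- `d = ab + ba`. -/
def vd : NC := va * vb + vb * va

/-- A `cd`-monomial, encoded as a list of booleans (`false` = `c`, `true` = `d`),
viewed inside `NC` via `c = a+b`, `d = ab+ba`. -/
def cdMonomial : List Bool → NC
  | [] => 1
  | s :: w => (if s then vd else vc) * cdMonomial w

/-- Degree of a `cd`-monomial (`c` has degree 1, `d` has degree 2). -/
def cdDeg (w : List Bool) : ℕ := (w.map fun s => if s then 2 else 1).sum

/-- Evaluation of an integer combination of `cd`-monomials in `NC`. -/
def cdEval (f : List Bool →₀ ℤ) : NC := f.sum fun w z => (z : ℚ) • cdMonomial w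

/-- The weight of a chain, computed from the (strictly increasing) list of absolute ranks
of its elements; `N` is the absolute rank of the (possibly formal) maximal element `1̂`.
For a list `[r₀, r₁, …, r_k]` this is
`(a-b)^(r₁-r₀-1) · b · (a-b)^(r₂-r₁-1) · b ⋯ b · (a-b)^(N-1-r_k)`. -/
def wtRanks (N : ℕ) : List ℕ → NC
  | [] => 1
  | [r] => (va - vb) ^ (N - 1 - r)
  | r :: s :: l => (va - vb) ^ (s - r - 1) * vb * wtRanks N (s :: l)


/-- A finite type has a finite `WithTop`. -/
instance {α : Type*} [Fintype α] : Fintype (WithTop α) := inferInstanceAs (Fintype (Option α))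

/-- A lexicographic sum of finite types is finite. -/
instance {α β : Type*} [Fintype α] [Fintype β] : Fintype (α ⊕ₗ β) :=
  inferInstanceAs (Fintype (α ⊕ β))

section Posets

variable {P : Type*} [Fintype P] [PartialOrder P]

/-- `y` is a chain of the subposet `S ⊆ P` whose minimal element is `m`, containing `m`
(chains of a poset always contain the minimal element `0̂ = m`). -/
def chainIn (S : Set P) (m : P) (y : Finset P) : Prop :=
  m ∈ y ∧ ↑y ⊆ S ∧ IsChain (· < ·) (↑y : Set P)

/-- The `ab`-index `Ψ` of the subposet `S ⊆ P` with minimal element `m`, of rank `n`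
(so the adjoined maximal element `1̂` has absolute rank `rk m + n + 1`); ranks of
elements are computed by the ambient rank function `rk`. -/
def absIndexOn (S : Set P) (m : P) (rk : P → ℕ) (n : ℕ) : NC :=
  ∑ y : Finset P,
    if chainIn S m y then wtRanks (rk m + n + 1) ((y.image rk).sort (· ≤ ·)) else 0

/-- The simplicial boundary operator relative to a chain `x`: a chain `y ⊇ x` is sent to
the signed sum of the chains `y ∖ {σ}` for `σ ∈ y ∖ x`, the sign of `σ` being determined
by its position in `y`.  Together with the grading by cardinality, this is the cellular
(chain) complex of the order complex computing (relative) simplicial homology. -/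
def bnd (x : Finset P) : (Finset P →₀ ℝ) →ₗ[ℝ] (Finset P →₀ ℝ) :=
  Finsupp.lsum ℝ fun y => LinearMap.id.smulRight
    (∑ σ ∈ y \ x, ((-1 : ℝ) ^ (y.filter fun τ => τ < σ).card) • Finsupp.single (y.erase σ) (1 : ℝ))

/-- The degree-`k` term of the cellular complex of (the order complex of) the subposet
`S` with minimal element `m`, relative to the chain `x`: the span of all chains `y ⊇ x`
in `S` with `k` elements. -/
def cellSpace (S : Set P) (m : P) (x : Finset P) (k : ℕ) : Submodule ℝ (Finset P →₀ ℝ) :=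
  Submodule.span ℝ
    {f | ∃ y : Finset P, chainIn S m y ∧ x ⊆ y ∧ y.card = k ∧ f = Finsupp.single y 1}

/-- The homological Gorenstein condition for the subposet `S ⊆ P` with minimal element
`m`, of rank `n`: the order complex is a real homology sphere, i.e. for every chain `x`
the cellular complex of the interval `[x, 1̂)` of the order complex is exact except at the
top (chains of `n+1` elements), where the homology is 1-dimensional. -/
def GorensteinOn (S : Set P) (m : P) (n : ℕ) : Prop :=
  ∀ x : Finset P, chainIn S m x → ∀ k : ℕ,
    Module.finrank ℝ ↥(LinearMap.ker (bnd x) ⊓ cellSpace S m x k) =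
      Module.finrank ℝ ↥(Submodule.map (bnd x) (cellSpace S m x (k + 1))) +
        (if k = n + 1 then 1 else 0)

/-- `S ⊆ P` is a graded (sub)poset of rank `n` with minimal element `m`: covers in `S`
increase the ambient rank `rk` by one, and all maximal elements of `S` have rank
`rk m + n`. -/
def IsGradedOn (S : Set P) (m : P) (rk : P → ℕ) (n : ℕ) : Prop :=
  m ∈ S ∧ (∀ x ∈ S, m ≤ x) ∧
    (∀ a ∈ S, ∀ b ∈ S, a < b → (¬ ∃ c ∈ S, a < c ∧ c < b) → rk b = rk a + 1) ∧
    (∀ a ∈ S, (∀ b ∈ S, ¬ a < b) → rk a = rk m + n)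

/-- `S ⊆ P` (with minimal element `m` and ambient rank function `rk`) is a Gorenstein*
poset of rank `n`. -/
def IsGorensteinStarOn (S : Set P) (m : P) (rk : P → ℕ) (n : ℕ) : Prop :=
  IsGradedOn S m rk n ∧ GorensteinOn S m n

/-- The pair `(S, B)` (with minimal element `m` and ambient rank function `rk`) is a
near-Gorenstein* poset of rank `n` with boundary `B`: `B` is an order ideal of `S` of
rank `n-1` which is Gorenstein* of rank `n-1`, and the order complex of `S` is a real
homology ball with boundary the order complex of `B`: for every chain `x` of `S`, the
cellular complex of `[x, 1̂)` is exact, except that when `x` is not a chain of `B` the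
homology at the top is 1-dimensional. -/
def IsNearGorensteinStarOn (S B : Set P) (m : P) (rk : P → ℕ) (n : ℕ) : Prop :=
  IsGradedOn S m rk n ∧ B ⊆ S ∧ (∀ σ ∈ B, ∀ τ ∈ S, τ ≤ σ → τ ∈ B) ∧
    IsGradedOn B m rk (n - 1) ∧ GorensteinOn B m (n - 1) ∧
    ∀ x : Finset P, chainIn S m x → ∀ k : ℕ,
      Module.finrank ℝ ↥(LinearMap.ker (bnd x) ⊓ cellSpace S m x k) =
        Module.finrank ℝ ↥(Submodule.map (bnd x) (cellSpace S m x (k + 1))) +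
          (if k = n + 1 ∧ ¬(↑x ⊆ B) then 1 else 0)

end Posets

end

noncomputable section

universe u

section

/-- Incidence numbers `ε x y` of a finite graded poset behaving like a regular cell complex whose
closed cells have acyclic relative cochain complexes. -/
structure CellIncidence (P : Type u) [Fintype P] [PartialOrder P] where
  ρ : P → ℕ
  ρ_mono : StrictMono ρ
  ε : P → P → ℝ
  ε_lt : ∀ x y, ε x y ≠ 0 → x < y
  ε_rank : ∀ x y, ε x y ≠ 0 → ρ y = ρ x + 1
  ε_sq : ∀ x w, ∑ z, ε x z * ε z w = 0
  interval_exact : ∀ p z, p < z → ∀ (j : ℕ) (s : P → ℝ),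
    (∀ x, ¬ (p ≤ x ∧ x ≤ z ∧ ρ x = j) → s x = 0) →
    (∀ y, y ≤ z → ∑ x, ε x y * s x = 0) →
    ∃ t : P → ℝ, (∀ x, ¬ (p ≤ x ∧ x ≤ z ∧ ρ x + 1 = j) → t x = 0) ∧
      ∀ y, y ≤ z → ∑ x, ε x y * t x = s y

/-- A cellular sheaf of finite dimensional real vector spaces on a poset. -/
structure CellSheaf (P : Type u) [PartialOrder P] where
  W : P → Type u
  [acg : ∀ x, AddCommGroup (W x)]
  [mod : ∀ x, Module ℝ (W x)]
  [fin : ∀ x, FiniteDimensional ℝ (W x)]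
  φ : ∀ x y, W x →ₗ[ℝ] W y
  φ_id : ∀ x w, φ x x w = w
  φ_comp : ∀ x y z, x ≤ y → y ≤ z → ∀ w, φ y z (φ x y w) = φ x z w

attribute [instance] CellSheaf.acg CellSheaf.mod CellSheaf.fin

/-- Restriction of a family to the indices satisfying a predicate. -/
def mask {P : Type*} {V : P → Type*} [∀ x, AddCommGroup (V x)] [∀ x, Module ℝ (V x)]
    (A : P → Prop) : (∀ x, V x) →ₗ[ℝ] (∀ x, V x) where
  toFun s x := if A x then s x else 0
  map_add' s t := by ext x; by_cases h : A x <;> simp [h]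
  map_smul' r s := by ext x; by_cases h : A x <;> simp [h]

theorem mask_apply {P : Type*} {V : P → Type*} [∀ x, AddCommGroup (V x)] [∀ x, Module ℝ (V x)]
    (A : P → Prop) (s : ∀ x, V x) (x : P) : mask A s x = if A x then s x else 0 := rfl

variable {P : Type u} [Fintype P] [PartialOrder P]

namespace CellIncidence

variable (I : CellIncidence P)

theorem interval_exact_vec {E : Type*} [AddCommGroup E] [Module ℝ E] [FiniteDimensional ℝ E]
    (p z : P) (hpz : p < z) (j : ℕ) (s : P → E)
    (hs : ∀ x, ¬ (p ≤ x ∧ x ≤ z ∧ I.ρ x = j) → s x = 0)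
    (hd : ∀ y, y ≤ z → ∑ x, I.ε x y • s x = 0) :
    ∃ t : P → E, (∀ x, ¬ (p ≤ x ∧ x ≤ z ∧ I.ρ x + 1 = j) → t x = 0) ∧
      ∀ y, y ≤ z → ∑ x, I.ε x y • t x = s y := by
  let b := Module.finBasis ℝ E
  have key : ∀ i, ∃ t : P → ℝ, (∀ x, ¬ (p ≤ x ∧ x ≤ z ∧ I.ρ x + 1 = j) → t x = 0) ∧
      ∀ y, y ≤ z → ∑ x, I.ε x y * t x = b.repr (s y) i := by
    intro i
    apply I.interval_exact p z hpz j
    · intro x hx; simp [hs x hx]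
    · intro y hy
      have := congrArg (fun v => b.repr v i) (hd y hy)
      simpa [map_sum, Finsupp.finsetSum_apply] using this
  choose t ht1 ht2 using key
  refine ⟨fun x => ∑ i, t i x • b i, ?_, ?_⟩
  · intro x hx
    simp [ht1 _ x hx]
  · intro y hy
    rw [← b.sum_repr (s y)]
    simp_rw [← ht2 _ y hy, Finset.smul_sum, Finset.sum_smul, smul_smul]
    exact Finset.sum_comm

end CellIncidence

namespace CellSheaf

variable (F : CellSheaf P) (I : CellIncidence P)

/-- The cellular coboundary. -/
def cob : (∀ x, F.W x) →ₗ[ℝ] (∀ x, F.W x) :=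
  LinearMap.pi fun y => ∑ x, I.ε x y • (F.φ x y ∘ₗ LinearMap.proj x)

theorem cob_apply (s : ∀ x, F.W x) (y : P) : F.cob I s y = ∑ x, I.ε x y • F.φ x y (s x) := by
  simp [cob]

/-- The cellular boundary on the dual spaces. -/
def bdy : (∀ x, (F.W x →ₗ[ℝ] ℝ)) →ₗ[ℝ] (∀ x, (F.W x →ₗ[ℝ] ℝ)) :=
  LinearMap.pi fun x => ∑ z, I.ε x z • ((F.φ x z).dualMap ∘ₗ LinearMap.proj z)

theorem bdy_apply (c : ∀ x, (F.W x →ₗ[ℝ] ℝ)) (x : P) (w : F.W x) :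
    F.bdy I c x w = ∑ z, I.ε x z * c z (F.φ x z w) := by
  simp [bdy]

theorem bdy_bdy (c : ∀ x, (F.W x →ₗ[ℝ] ℝ)) : F.bdy I (F.bdy I c) = 0 := by
  ext y w
  rw [bdy_apply]
  have h1 : ∀ z, I.ε y z * F.bdy I c z (F.φ y z w)
      = ∑ x, (I.ε y z * I.ε z x) * c x (F.φ y x w) := by
    intro z
    rw [bdy_apply, Finset.mul_sum]
    refine Finset.sum_congr rfl fun x _ => ?_
    by_cases h : I.ε y z = 0
    · simp [h]
    by_cases h' : I.ε z x = 0
    · simp [h']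
    rw [F.φ_comp y z x (I.ε_lt _ _ h).le (I.ε_lt _ _ h').le, mul_assoc]
  simp_rw [h1]
  rw [Finset.sum_comm]
  simp_rw [← Finset.sum_mul, I.ε_sq]
  simp

theorem sum_cob_eq_sum_bdy (c : ∀ x, (F.W x →ₗ[ℝ] ℝ)) (s : ∀ x, F.W x) :
    ∑ z, c z (F.cob I s z) = ∑ x, F.bdy I c x (s x) := by
  simp_rw [cob_apply, bdy_apply, map_sum, map_smul, smul_eq_mul]
  exact Finset.sum_comm

/-- Exactness in degree `r` of the cellular cochain complex on the elements above `p`. -/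
def UpExact (p : P) (r : ℕ) : Prop :=
  ∀ s : ∀ x, F.W x, (∀ x, ¬ (p ≤ x ∧ I.ρ x = r) → s x = 0) → F.cob I s = 0 →
    ∃ t : ∀ x, F.W x, (∀ x, ¬ (p ≤ x ∧ I.ρ x + 1 = r) → t x = 0) ∧ F.cob I t = s

/-- Exactness in degree `r` of the dual cellular chain complex on the elements above `p`. -/
def DownExact (p : P) (r : ℕ) : Prop :=
  ∀ c : ∀ x, (F.W x →ₗ[ℝ] ℝ), (∀ x, ¬ (p ≤ x ∧ I.ρ x = r) → c x = 0) →
    (∀ x, p ≤ x → F.bdy I c x = 0) →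
    ∃ e : ∀ x, (F.W x →ₗ[ℝ] ℝ), (∀ x, ¬ (p ≤ x ∧ I.ρ x = r + 1) → e x = 0) ∧
      ∀ x, p ≤ x → F.bdy I e x = c x

/-- Cohen-Macaulayness in degrees below `n`. -/
def CM (n : ℕ) : Prop := ∀ p, ∀ r < n, F.UpExact I p r

variable {F I}

theorem cob_single (x : P) (w : F.W x) (y : P) :
    F.cob I (Pi.single x w) y = I.ε x y • F.φ x y w := by
  rw [cob_apply, Finset.sum_eq_single x]
  · simp
  · intro z _ hz; simp [Pi.single_eq_of_ne hz]
  · simp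

theorem UpExact.downExact {p : P} {r : ℕ} (h : F.UpExact I p r) : F.DownExact I p r := by
  intro c hc hb
  let f : (∀ x, F.W x) →ₗ[ℝ] (∀ x, F.W x) := F.cob I ∘ₗ mask (fun x => p ≤ x ∧ I.ρ x = r)
  let C : Module.Dual ℝ (∀ x, F.W x) := ∑ z, c z ∘ₗ LinearMap.proj z
  have hC : ∀ s, C s = ∑ z, c z (s z) := fun s => by simp [C]
  have hmem : C ∈ (LinearMap.ker f).dualAnnihilator := by
    rw [Submodule.mem_dualAnnihilator]
    intro s hs
    obtain ⟨t, ht, hts⟩ := h (mask (fun x => p ≤ x ∧ I.ρ x = r) s)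
      (fun x hx => by simp [mask_apply, hx]) (LinearMap.mem_ker.1 hs)
    have h1 : C s = ∑ z, c z (F.cob I t z) := by
      rw [hC, hts]
      refine Finset.sum_congr rfl fun z _ => ?_
      by_cases hz : p ≤ z ∧ I.ρ z = r
      · simp [mask_apply, hz]
      · simp [hc z hz]
    rw [h1, sum_cob_eq_sum_bdy]
    refine Finset.sum_eq_zero fun x _ => ?_
    by_cases hx : p ≤ x
    · simp [hb x hx]
    · simp [ht x (fun h => hx h.1)]
  rw [← LinearMap.range_dualMap_eq_dualAnnihilator_ker] at hmem
  obtain ⟨τ, hτ⟩ := hmem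
  refine ⟨mask (fun z => p ≤ z ∧ I.ρ z = r + 1) fun z => τ ∘ₗ LinearMap.single ℝ F.W z,
    fun x hx => by simp [mask_apply, hx], fun x hx => ?_⟩
  ext w
  rw [bdy_apply]
  by_cases hr : I.ρ x = r
  · have h1 : c x w = C (Pi.single x w) := by
      rw [hC, Finset.sum_eq_single x]
      · simp
      · intro z _ hz; simp [Pi.single_eq_of_ne hz]
      · simp
    have h2 : mask (fun x => p ≤ x ∧ I.ρ x = r) (Pi.single x w) = (Pi.single x w : ∀ x, F.W x) := by
      ext z
      by_cases hz : z = x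
      · subst hz; simp [mask_apply, hx, hr]
      · simp [mask_apply, Pi.single_eq_of_ne hz]
    have h3 : F.cob I (Pi.single x w) = ∑ z, I.ε x z • (Pi.single z (F.φ x z w) : ∀ x, F.W x) := by
      ext y
      rw [cob_single, Finset.sum_apply, Finset.sum_eq_single y]
      · simp
      · intro z _ hz; simp [Pi.single_eq_of_ne (Ne.symm hz)]
      · simp
    rw [h1, ← hτ]
    simp only [LinearMap.dualMap_apply, f, LinearMap.comp_apply, h2, h3, map_sum, map_smul]
    refine Finset.sum_congr rfl fun z _ => ?_
    by_cases hz : I.ε x z = 0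
    · simp [hz]
    have := I.ε_lt _ _ hz
    have h4 := I.ε_rank _ _ hz
    simp [mask_apply, hx.trans this.le, h4, hr]
  · rw [hc x (fun h => hr h.2)]
    refine Finset.sum_eq_zero fun z _ => ?_
    by_cases hz : I.ε x z = 0
    · simp [hz]
    have h4 := I.ε_rank _ _ hz
    simp [mask_apply, h4, hr]

end CellSheaf

end

section

variable {P : Type u} [Fintype P] [PartialOrder P]

theorem finrank_inf_ker_add_finrank_map {E E' : Type*} [AddCommGroup E] [Module ℝ E]
    [FiniteDimensional ℝ E] [AddCommGroup E'] [Module ℝ E'] (S : Submodule ℝ E) (f : E →ₗ[ℝ] E') :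
    Module.finrank ℝ ↥(S ⊓ LinearMap.ker f) + Module.finrank ℝ ↥(S.map f)
      = Module.finrank ℝ S := by
  have h1 := LinearMap.finrank_range_add_finrank_ker (f.domRestrict S)
  have h2 : LinearMap.range (f.domRestrict S) = S.map f := by
    ext; simp
  have h3 : (LinearMap.ker (f.domRestrict S)).map S.subtype = S ⊓ LinearMap.ker f := by
    ext c
    simp only [Submodule.mem_map, LinearMap.mem_ker, Submodule.mem_inf]
    constructor
    · rintro ⟨c, hc, rfl⟩; exact ⟨c.2, hc⟩
    · intro hc; exact ⟨⟨c, hc.1⟩, hc.2, rfl⟩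
  have h4 := Submodule.finrank_map_subtype_eq S (LinearMap.ker (f.domRestrict S))
  rw [h3] at h4
  rw [h2, ← h4] at h1
  omega

namespace CellSheaf

variable (F : CellSheaf P) (I : CellIncidence P)

/-- The cycles of degree `r` of the dual chain complex above `x`. -/
def cyc (r : ℕ) (x : P) : Submodule ℝ (∀ z, (F.W z →ₗ[ℝ] ℝ)) where
  carrier := {c | (∀ z, ¬ (x ≤ z ∧ I.ρ z = r) → c z = 0) ∧ ∀ y, x ≤ y → F.bdy I c y = 0}
  add_mem' := by
    rintro c c' ⟨h1, h2⟩ ⟨h1', h2'⟩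
    exact ⟨fun z hz => by simp [h1 z hz, h1' z hz], fun y hy => by simp [h2 y hy, h2' y hy]⟩
  zero_mem' := ⟨fun z _ => rfl, fun y _ => by simp⟩
  smul_mem' := by
    rintro a c ⟨h1, h2⟩
    exact ⟨fun z hz => by simp [h1 z hz], fun y hy => by simp [h2 y hy]⟩

/-- The dual chains of degree `r` above `x`. -/
def dualChains (r : ℕ) (x : P) : Submodule ℝ (∀ z, (F.W z →ₗ[ℝ] ℝ)) where
  carrier := {c | ∀ z, ¬ (x ≤ z ∧ I.ρ z = r) → c z = 0}
  add_mem' := by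
    intro c c' h1 h1' z hz
    simp [h1 z hz, h1' z hz]
  zero_mem' := fun z _ => rfl
  smul_mem' := by
    intro a c h1 z hz
    simp [h1 z hz]

variable {F I}

theorem mem_cyc {r : ℕ} {x : P} {c : ∀ z, (F.W z →ₗ[ℝ] ℝ)} :
    c ∈ F.cyc I r x ↔ (∀ z, ¬ (x ≤ z ∧ I.ρ z = r) → c z = 0) ∧ ∀ y, x ≤ y → F.bdy I c y = 0 :=
  Iff.rfl

theorem finrank_dualChains (r : ℕ) (x : P) :
    Module.finrank ℝ (F.dualChains I r x)
      = ∑ z, if x ≤ z ∧ I.ρ z = r then Module.finrank ℝ (F.W z) else 0 := by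
  let e : F.dualChains I r x ≃ₗ[ℝ]
      (∀ z : {z : P // x ≤ z ∧ I.ρ z = r}, (F.W z.1 →ₗ[ℝ] ℝ)) :=
    { toFun := fun c z => c.1 z.1
      map_add' := fun c c' => rfl
      map_smul' := fun a c => rfl
      invFun := fun c => ⟨fun z => if h : x ≤ z ∧ I.ρ z = r then c ⟨z, h⟩ else 0,
        fun z hz => by simp only [dif_neg hz]⟩
      left_inv := fun c => by
        ext z : 2
        by_cases h : x ≤ z ∧ I.ρ z = r
        · simp [h]
        · simp only [dif_neg h]; exact (c.2 z h).symm
      right_inv := fun c => by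
        ext z : 1
        exact dif_pos z.2 }
  rw [e.finrank_eq, Module.finrank_pi_fintype, ← Finset.sum_filter]
  simp_rw [Subspace.dual_finrank_eq]
  rw [← Finset.sum_subtype (p := fun z => x ≤ z ∧ I.ρ z = r)
    (Finset.univ.filter fun z => x ≤ z ∧ I.ρ z = r) (fun z => by simp)
    (fun z => Module.finrank ℝ (F.W z))]

theorem bdy_mask (c : ∀ z, (F.W z →ₗ[ℝ] ℝ)) (x y : P) (h : x ≤ y) :
    F.bdy I (mask (fun z => x ≤ z) c) y = F.bdy I c y := by
  ext w
  rw [bdy_apply, bdy_apply]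
  refine Finset.sum_congr rfl fun z _ => ?_
  by_cases hz : I.ε y z = 0
  · simp [hz]
  simp [mask_apply, h.trans (I.ε_lt _ _ hz).le]

theorem bdy_eq_zero_of_rank {r : ℕ} (c : ∀ z, (F.W z →ₗ[ℝ] ℝ))
    (hc : ∀ z, I.ρ z ≠ r → c z = 0) {y : P} (hy : I.ρ y + 1 ≠ r) : F.bdy I c y = 0 := by
  ext w
  rw [bdy_apply]
  refine Finset.sum_eq_zero fun z _ => ?_
  by_cases hz : I.ε y z = 0
  · simp [hz]
  rw [hc z (by rw [I.ε_rank _ _ hz]; exact hy)]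
  simp

theorem bdy_mem_cyc {r : ℕ} {x : P} {c : ∀ z, (F.W z →ₗ[ℝ] ℝ)}
    (hc : ∀ z, ¬ (x ≤ z ∧ I.ρ z = r + 1) → c z = 0) :
    mask (fun z => x ≤ z) (F.bdy I c) ∈ F.cyc I r x := by
  refine ⟨fun z hz => ?_, fun y hy => ?_⟩
  · by_cases hx : x ≤ z
    · have : F.bdy I c z = 0 := bdy_eq_zero_of_rank (r := r + 1) c
        (fun z hz => hc z fun h => hz h.2) (fun h => hz ⟨hx, by omega⟩)
      simp [mask_apply, this]
    · simp [mask_apply, hx]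
  · rw [bdy_mask _ _ _ hy, bdy_bdy]; rfl

theorem finrank_cyc_succ {r : ℕ} {x : P} (h : F.DownExact I x r) :
    Module.finrank ℝ (F.cyc I (r + 1) x) + Module.finrank ℝ (F.cyc I r x)
      = ∑ z, if x ≤ z ∧ I.ρ z = r + 1 then Module.finrank ℝ (F.W z) else 0 := by
  rw [← finrank_dualChains]
  have h1 : F.dualChains I (r + 1) x ⊓ LinearMap.ker (mask (fun z => x ≤ z) ∘ₗ F.bdy I)
      = F.cyc I (r + 1) x := by
    ext c
    refine ⟨fun hc => ⟨hc.1, fun y hy => ?_⟩, fun hc => ⟨hc.1, ?_⟩⟩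
    · have := congrFun (LinearMap.mem_ker.1 hc.2) y
      simpa [mask_apply, hy] using this
    · rw [SetLike.mem_coe, LinearMap.mem_ker]
      ext z : 1
      by_cases hz : x ≤ z
      · simp [mask_apply, hz, hc.2 z hz]
      · simp [mask_apply, hz]
  have h2 : (F.dualChains I (r + 1) x).map (mask (fun z => x ≤ z) ∘ₗ F.bdy I)
      = F.cyc I r x := by
    apply le_antisymm
    · rintro _ ⟨c, hc, rfl⟩
      exact bdy_mem_cyc hc
    · intro c hc
      obtain ⟨e, he1, he2⟩ := h c hc.1 hc.2
      refine ⟨e, he1, ?_⟩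
      ext z : 1
      by_cases hz : x ≤ z
      · simp [mask_apply, hz, he2]
      · simp [mask_apply, hz, hc.1 z fun h => hz h.1]
  rw [← finrank_inf_ker_add_finrank_map (F.dualChains I (r + 1) x)
    (mask (fun z => x ≤ z) ∘ₗ F.bdy I), h1, h2]

theorem finrank_cyc_zero (x : P) :
    Module.finrank ℝ (F.cyc I 0 x)
      = ∑ z, if x ≤ z ∧ I.ρ z = 0 then Module.finrank ℝ (F.W z) else 0 := by
  rw [← finrank_dualChains]
  have : F.cyc I 0 x = F.dualChains I 0 x := by
    ext c
    exact ⟨fun h => h.1, fun h => ⟨h, fun y _ => bdy_eq_zero_of_rank (r := 0) c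
      (fun z hz => h z fun h' => hz h'.2) (by omega)⟩⟩
  rw [this]

end CellSheaf

/-- The alternating sum of a weight function over the elements of rank at most `m` above `x`. -/
def CellIncidence.dualWeight (I : CellIncidence P) (w : P → ℤ) (m : ℕ) (x : P) : ℤ :=
  ∑ z, if x ≤ z ∧ I.ρ z ≤ m then (-1) ^ (m + I.ρ z) * w z else 0

namespace CellSheaf
variable {F : CellSheaf P} {I : CellIncidence P}

theorem finrank_cyc {m : ℕ} {x : P} (h : ∀ r < m, F.DownExact I x r) :
    (Module.finrank ℝ (F.cyc I m x) : ℤ)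
      = I.dualWeight (fun z => (Module.finrank ℝ (F.W z) : ℤ)) m x := by
  induction m with
  | zero =>
    rw [finrank_cyc_zero, CellIncidence.dualWeight]
    push_cast
    refine Finset.sum_congr rfl fun z _ => ?_
    by_cases hz : I.ρ z = 0 <;> simp [hz]
  | succ m ih =>
    have h1 := finrank_cyc_succ (h m (by omega))
    have h2 := ih fun r hr => h r (by omega)
    have h3 : (Module.finrank ℝ (F.cyc I (m + 1) x) : ℤ)
        = (∑ z, if x ≤ z ∧ I.ρ z = m + 1 then (Module.finrank ℝ (F.W z) : ℤ) else 0)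
          - Module.finrank ℝ (F.cyc I m x) := by
      rw [eq_sub_iff_add_eq]
      exact_mod_cast h1
    rw [h3, h2, CellIncidence.dualWeight, CellIncidence.dualWeight, ← Finset.sum_sub_distrib]
    refine Finset.sum_congr rfl fun z _ => ?_
    by_cases hx : x ≤ z
    · rcases lt_trichotomy (I.ρ z) (m + 1) with hz | hz | hz
      · have e1 : I.ρ z ≤ m := by omega
        have e2 : I.ρ z ≤ m + 1 := by omega
        have e3 : I.ρ z ≠ m + 1 := by omega
        simp only [hx, e1, e2, e3, true_and, if_true, if_false]
        rw [show m + 1 + I.ρ z = (m + I.ρ z) + 1 by ring, pow_succ]; ring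
      · have : (-1 : ℤ) ^ (m + 1 + (m + 1)) = 1 := by rw [← two_mul, pow_mul]; simp
        simp [hx, hz, this]
      · have e1 : ¬ I.ρ z ≤ m := by omega
        have e2 : ¬ I.ρ z ≤ m + 1 := by omega
        have e3 : I.ρ z ≠ m + 1 := by omega
        simp [e1, e2, e3]
    · simp [hx]

variable (F I) in
/-- The coboundary of the sheaf of masked dual chains. -/
def mcob (κ : P → ∀ z, (F.W z →ₗ[ℝ] ℝ)) (y : P) : ∀ z, (F.W z →ₗ[ℝ] ℝ) :=
  ∑ x, I.ε x y • mask (fun z => y ≤ z) (κ x)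

theorem mcob_apply (κ : P → ∀ z, (F.W z →ₗ[ℝ] ℝ)) (y z : P) :
    F.mcob I κ y z = if y ≤ z then ∑ x, I.ε x y • κ x z else 0 := by
  by_cases h : y ≤ z <;> simp [mcob, mask_apply, h]

theorem mcob_mcob (κ : P → ∀ z, (F.W z →ₗ[ℝ] ℝ)) : F.mcob I (F.mcob I κ) = 0 := by
  ext y z : 2
  rw [mcob_apply]
  by_cases h : y ≤ z
  · simp only [h, if_true]
    have h1 : ∀ u, I.ε u y • F.mcob I κ u z = ∑ x, (I.ε x u * I.ε u y) • κ x z := by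
      intro u
      by_cases hu : I.ε u y = 0
      · simp [hu]
      rw [mcob_apply, if_pos ((I.ε_lt _ _ hu).le.trans h), Finset.smul_sum]
      simp_rw [smul_smul, mul_comm]
    simp_rw [h1]
    rw [Finset.sum_comm]
    simp_rw [← Finset.sum_smul, I.ε_sq]
    simp
  · simp [h]

theorem mcob_sub (κ κ' : P → ∀ z, (F.W z →ₗ[ℝ] ℝ)) :
    F.mcob I (κ - κ') = F.mcob I κ - F.mcob I κ' := by
  ext y : 1
  simp [mcob, smul_sub, Finset.sum_sub_distrib]

theorem mask_mem_cyc {r : ℕ} {x y : P} (hxy : x ≤ y) {c : ∀ z, (F.W z →ₗ[ℝ] ℝ)}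
    (hc : c ∈ F.cyc I r x) : mask (fun z => y ≤ z) c ∈ F.cyc I r y := by
  refine ⟨fun z hz => ?_, fun u hu => ?_⟩
  · by_cases h : y ≤ z
    · simp [mask_apply, hc.1 z fun h' => hz ⟨h, h'.2⟩]
    · simp [mask_apply, h]
  · rw [bdy_mask _ _ _ hu, hc.2 u (hxy.trans hu)]

theorem mcob_mem_cyc {r : ℕ} {κ : P → ∀ z, (F.W z →ₗ[ℝ] ℝ)}
    (hκ : ∀ x, κ x ∈ F.cyc I r x) (y : P) : F.mcob I κ y ∈ F.cyc I r y := by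
  refine Submodule.sum_mem _ fun x _ => ?_
  by_cases h : I.ε x y = 0
  · simp [h]
  · exact Submodule.smul_mem _ _ (mask_mem_cyc (I.ε_lt _ _ h).le (hκ x))

theorem bdy_mcob (κ : P → ∀ z, (F.W z →ₗ[ℝ] ℝ)) {y u : P} (h : y ≤ u) :
    F.bdy I (F.mcob I κ y) u = ∑ x, I.ε x y • F.bdy I (κ x) u := by
  simp only [mcob, map_sum, map_smul, Finset.sum_apply, Pi.smul_apply, bdy_mask _ _ _ h]

theorem exists_mcob_eq {m : ℕ} (hF : ∀ p, ∀ r < m, F.DownExact I p r) (r : ℕ) (hr : r ≤ m) :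
    ∀ j < r, ∀ (p : P) (κ : P → ∀ z, (F.W z →ₗ[ℝ] ℝ)), (∀ x, κ x ∈ F.cyc I r x) →
      (∀ x, ¬ (p ≤ x ∧ I.ρ x = j) → κ x = 0) → F.mcob I κ = 0 →
      ∃ e : P → ∀ z, (F.W z →ₗ[ℝ] ℝ), (∀ x, e x ∈ F.cyc I r x) ∧
        (∀ x, ¬ (p ≤ x ∧ I.ρ x + 1 = j) → e x = 0) ∧ F.mcob I e = κ := by
  induction r with
  | zero => intro j hj; omega
  | succ r ih =>
    intro j hj p κ hκ hsupp hd
    have hz : ∀ z, ∃ t : P → (F.W z →ₗ[ℝ] ℝ),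
        (∀ x, ¬ (p ≤ x ∧ x ≤ z ∧ I.ρ x + 1 = j ∧ I.ρ z = r + 1) → t x = 0) ∧
          ∀ y, y ≤ z → ∑ x, I.ε x y • t x = κ y z := by
      intro z
      by_cases hz : p ≤ z ∧ I.ρ z = r + 1
      · by_cases hpz : p = z
        · refine ⟨0, fun _ _ => rfl, fun y hy => ?_⟩
          by_cases hy' : p ≤ y ∧ I.ρ y = j
          · have : y = z := le_antisymm hy (hpz ▸ hy'.1)
            subst this
            omega
          · simp [hsupp y hy']
        · obtain ⟨t, ht1, ht2⟩ := I.interval_exact_vec p z (lt_of_le_of_ne hz.1 hpz) j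
            (fun x => κ x z) (fun x hx => by
              by_cases hx' : p ≤ x ∧ I.ρ x = j
              · exact (hκ x).1 z fun h => hx ⟨hx'.1, h.1, hx'.2⟩
              · simp [hsupp x hx'])
            (fun y hy => by
              have := congrFun (congrFun hd y) z
              rw [mcob_apply, if_pos hy] at this
              exact this)
          exact ⟨t, fun x hx => ht1 x fun h => hx ⟨h.1, h.2.1, h.2.2, hz.2⟩, ht2⟩
      · refine ⟨0, fun _ _ => rfl, fun y hy => ?_⟩
        by_cases hy' : p ≤ y
        · rw [(hκ y).1 z fun h => hz ⟨hy'.trans hy, h.2⟩]; simp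
        · simp [hsupp y fun h => hy' h.1]
    choose t ht1 ht2 using hz
    let e0 : P → ∀ z, (F.W z →ₗ[ℝ] ℝ) := fun x z => t z x
    have he0 : F.mcob I e0 = κ := by
      ext y z : 2
      rw [mcob_apply]
      by_cases hyz : y ≤ z
      · rw [if_pos hyz]; exact ht2 z y hyz
      · rw [if_neg hyz, (hκ y).1 z fun h => hyz h.1]
    have he0c : ∀ x z, ¬ (x ≤ z ∧ I.ρ z = r + 1) → e0 x z = 0 :=
      fun x z h => ht1 z x fun h' => h ⟨h'.2.1, h'.2.2.2⟩
    have he0s : ∀ x, ¬ (p ≤ x ∧ I.ρ x + 1 = j) → e0 x = 0 := fun x h => by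
      ext z : 1; exact ht1 z x fun h' => h ⟨h'.1, h'.2.2.1⟩
    rcases j with - | j
    · have h0 : e0 = 0 := by
        ext x : 1; exact he0s x fun h => by omega
      exact ⟨e0, fun x => by rw [h0]; exact Submodule.zero_mem _, he0s, he0⟩
    let κ' : P → ∀ z, (F.W z →ₗ[ℝ] ℝ) := fun x => mask (fun z => x ≤ z) (F.bdy I (e0 x))
    have hκ' : ∀ x, κ' x ∈ F.cyc I r x := fun x => bdy_mem_cyc (he0c x)
    have hκ's : ∀ x, ¬ (p ≤ x ∧ I.ρ x = j) → κ' x = 0 := fun x h => by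
      simp only [κ']
      rw [he0s x fun h' => h ⟨h'.1, by omega⟩]; simp
    have hdκ' : F.mcob I κ' = 0 := by
      ext y u : 2
      rw [mcob_apply]
      by_cases hyu : y ≤ u
      · rw [if_pos hyu]
        have h1 : ∀ x, I.ε x y • κ' x u = I.ε x y • F.bdy I (e0 x) u := by
          intro x
          by_cases hx : I.ε x y = 0
          · simp [hx]
          · simp [κ', mask_apply, (I.ε_lt _ _ hx).le.trans hyu]
        simp_rw [h1]
        rw [← bdy_mcob e0 hyu, he0]
        exact (hκ y).2 u hyu
      · rw [if_neg hyu]; rfl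
    obtain ⟨k, hk, hks, hkd⟩ := ih (by omega) j (by omega) p κ' hκ' hκ's hdκ'
    have hlift : ∀ x, ∃ e : ∀ z, (F.W z →ₗ[ℝ] ℝ),
        (∀ z, ¬ (x ≤ z ∧ I.ρ z = r + 1) → e z = 0) ∧ (∀ u, x ≤ u → F.bdy I e u = k x u) ∧
        (¬ (p ≤ x ∧ I.ρ x + 1 = j) → e = 0) := by
      intro x
      by_cases hx : p ≤ x ∧ I.ρ x + 1 = j
      · obtain ⟨e, h1, h2⟩ := hF x r (by omega) (k x) (hk x).1 (hk x).2
        exact ⟨e, h1, h2, fun h => absurd hx h⟩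
      · exact ⟨0, fun _ _ => rfl, fun u _ => by rw [hks x hx]; simp, fun _ => rfl⟩
    choose k' hk'1 hk'2 hk'3 using hlift
    refine ⟨e0 - F.mcob I k', fun x => ⟨fun z hz => ?_, fun u hu => ?_⟩, fun x hx => ?_, ?_⟩
    · have h1 : F.mcob I k' x z = 0 := by
        rw [mcob_apply]
        by_cases hxz : x ≤ z
        · rw [if_pos hxz]
          refine Finset.sum_eq_zero fun y _ => ?_
          rw [hk'1 y z fun h => hz ⟨hxz, h.2⟩]; simp
        · simp [hxz]
      simp [h1, he0c x z hz]
    · have h1 := congrFun (congrFun hkd x) u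
      rw [mcob_apply, if_pos hu] at h1
      have h2 : κ' x u = F.bdy I (e0 x) u := by simp [κ', mask_apply, hu]
      have h3 : ∀ y, I.ε y x • F.bdy I (k' y) u = I.ε y x • k y u := by
        intro y
        by_cases hy : I.ε y x = 0
        · simp [hy]
        · rw [hk'2 y u ((I.ε_lt _ _ hy).le.trans hu)]
      rw [Pi.sub_apply, map_sub, Pi.sub_apply, bdy_mcob k' hu]
      simp_rw [h3]
      rw [h1, h2, sub_self]
    · have h1 : F.mcob I k' x = 0 := by
        refine Finset.sum_eq_zero fun y _ => ?_
        by_cases hy : I.ε y x = 0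
        · simp [hy]
        rw [hk'3 y fun h => hx ⟨h.1.trans (I.ε_lt _ _ hy).le, by
          rw [I.ε_rank _ _ hy]; omega⟩]
        simp
      simp [h1, he0s x hx]
    · rw [mcob_sub, mcob_mcob, he0, sub_zero]

end CellSheaf

end

section

theorem exists_posDef_form (E : Type*) [AddCommGroup E] [Module ℝ E] [FiniteDimensional ℝ E] :
    ∃ S : E →ₗ[ℝ] E →ₗ[ℝ] ℝ, (∀ v, 0 ≤ S v v) ∧ ∀ v, S v v = 0 → v = 0 := by
  let b := Module.finBasis ℝ E
  let S : E →ₗ[ℝ] E →ₗ[ℝ] ℝ := ∑ i, (b.coord i).smulRight (b.coord i)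
  have hS : ∀ v, S v v = ∑ i, b.repr v i * b.repr v i := by
    intro v; simp [S]
  refine ⟨S, fun v => ?_, fun v hv => ?_⟩
  · rw [hS]; exact Finset.sum_nonneg fun i _ => mul_self_nonneg _
  · rw [hS, Finset.sum_eq_zero_iff_of_nonneg fun i _ => mul_self_nonneg _] at hv
    apply b.repr.injective
    ext i
    simpa using hv i (Finset.mem_univ i)

theorem exists_common_nondegenerate {ι Z : Type*} [Fintype ι] [Fintype Z] (V : ι → Type*)
    [∀ i, AddCommGroup (V i)] [∀ i, Module ℝ (V i)] [∀ i, FiniteDimensional ℝ (V i)]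
    (β : ∀ i, Z → V i →ₗ[ℝ] V i →ₗ[ℝ] ℝ)
    (h : ∀ i, ∃ c : Z → ℝ, ∀ v, (∑ z, c z • β i z) v = 0 → v = 0) :
    ∃ c : Z → ℝ, ∀ i v, (∑ z, c z • β i z) v = 0 → v = 0 := by
  let b := fun i => Module.finBasis ℝ (V i)
  let M : ∀ i, Matrix (Fin (Module.finrank ℝ (V i))) (Fin (Module.finrank ℝ (V i)))
      (MvPolynomial Z ℝ) := fun i => Matrix.of fun k l =>
    ∑ z, MvPolynomial.X z * MvPolynomial.C (β i z (b i l) (b i k))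
  have hM : ∀ i (c : Z → ℝ) (x : Fin (Module.finrank ℝ (V i)) → ℝ) k,
      ((M i).map (MvPolynomial.eval c)).mulVec x k
        = (∑ z, c z • β i z) (∑ l, x l • b i l) (b i k) := by
    intro i c x k
    simp only [Matrix.mulVec, dotProduct, Matrix.map_apply, M, Matrix.of_apply, map_sum, map_mul,
      MvPolynomial.eval_X, MvPolynomial.eval_C, map_smul, LinearMap.sum_apply,
      LinearMap.smul_apply, smul_eq_mul, Finset.sum_mul, Finset.mul_sum]
    exact Finset.sum_congr rfl fun l _ => Finset.sum_congr rfl fun z _ => by ring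
  have hiff : ∀ i (c : Z → ℝ), (MvPolynomial.eval c (M i).det ≠ 0 ↔
      ∀ v, (∑ z, c z • β i z) v = 0 → v = 0) := by
    intro i c
    rw [RingHom.map_det, RingHom.mapMatrix_apply]
    constructor
    · intro hdet v hv
      have h1 : ((M i).map (MvPolynomial.eval c)).mulVec ((b i).repr v) = 0 := by
        ext k
        rw [hM, (b i).sum_repr, hv]
        rfl
      have h2 := Matrix.eq_zero_of_mulVec_eq_zero hdet h1
      apply (b i).repr.injective
      ext k
      simpa using congrFun h2 k
    · intro hv hdet
      obtain ⟨x, hx, hx'⟩ := Matrix.exists_mulVec_eq_zero_iff.2 hdet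
      apply hx
      have h1 : ∑ l, x l • b i l = 0 := by
        apply hv
        apply (b i).ext
        intro k
        rw [← hM, hx']
        rfl
      ext k
      have := congrArg (fun v => (b i).repr v k) h1
      simpa [map_sum, Finsupp.single_apply] using this
  have hne : ∏ i, (M i).det ≠ 0 := by
    rw [Finset.prod_ne_zero_iff]
    intro i _ h0
    obtain ⟨c, hc⟩ := h i
    have := (hiff i c).2 hc
    rw [h0] at this
    exact this (map_zero _)
  obtain ⟨c, hc⟩ : ∃ c, MvPolynomial.eval c (∏ i, (M i).det) ≠ 0 := by
    by_contra hcon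
    push Not at hcon
    exact hne (MvPolynomial.funext fun c => by rw [hcon c, map_zero])
  rw [map_prod, Finset.prod_ne_zero_iff] at hc
  exact ⟨c, fun i => (hiff i c).1 (hc i (Finset.mem_univ i))⟩

/-- The image of a submodule in a quotient module. -/
def Subquotient {V : Type*} [AddCommGroup V] [Module ℝ V] (S R : Submodule ℝ V) : Type _ :=
  S ⧸ R.comap S.subtype

namespace Subquotient
variable {V V' V'' : Type*} [AddCommGroup V] [Module ℝ V] [AddCommGroup V'] [Module ℝ V']
  [AddCommGroup V''] [Module ℝ V''] (S R : Submodule ℝ V)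
  (S' R' : Submodule ℝ V')

instance : AddCommGroup (Subquotient S R) :=
  inferInstanceAs (AddCommGroup (S ⧸ R.comap S.subtype))
instance : Module ℝ (Subquotient S R) := inferInstanceAs (Module ℝ (S ⧸ R.comap S.subtype))
instance [FiniteDimensional ℝ V] : FiniteDimensional ℝ (Subquotient S R) :=
  inferInstanceAs (FiniteDimensional ℝ (S ⧸ R.comap S.subtype))

/-- The class of an element in a subquotient. -/
def mk : S →ₗ[ℝ] Subquotient S R := (R.comap S.subtype).mkQ

theorem mk_surjective : Function.Surjective (mk S R) := Submodule.mkQ_surjective _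

variable {S R S' R'}

theorem mk_eq_zero_iff {c : S} : mk S R c = 0 ↔ c.1 ∈ R :=
  Submodule.Quotient.mk_eq_zero (R.comap S.subtype)

/-- The map induced on subquotients. -/
def map (f : V →ₗ[ℝ] V') (hS : ∀ c ∈ S, f c ∈ S') (hR : ∀ c ∈ R, f c ∈ R') :
    Subquotient S R →ₗ[ℝ] Subquotient S' R' :=
  Submodule.mapQ _ _ (f.restrict hS) fun c hc => hR c.1 hc

theorem map_mk (f : V →ₗ[ℝ] V') (hS : ∀ c ∈ S, f c ∈ S') (hR : ∀ c ∈ R, f c ∈ R') (c : S) :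
    map f hS hR (mk S R c) = mk S' R' ⟨f c.1, hS c.1 c.2⟩ := rfl

theorem finrank_add [FiniteDimensional ℝ V] (h : R ≤ S) :
    Module.finrank ℝ (Subquotient S R) + Module.finrank ℝ R = Module.finrank ℝ S := by
  have h1 := (R.comap S.subtype).finrank_quotient_add_finrank
  rwa [(Submodule.comapSubtypeEquivOfLe h).finrank_eq] at h1

end Subquotient

variable {P : Type u} [Fintype P] [PartialOrder P]

namespace CellSheaf
variable {F : CellSheaf P} {I : CellIncidence P}

theorem UpExact.eq_zero {x : P} (h : F.UpExact I x (I.ρ x)) {w : F.W x}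
    (hw : ∀ z, I.ε x z ≠ 0 → F.φ x z w = 0) : w = 0 := by
  obtain ⟨t, ht, htd⟩ := h (Pi.single x w)
    (fun z hz => Pi.single_eq_of_ne (fun h => hz (by subst h; exact ⟨le_rfl, rfl⟩)) _)
    (by
      ext y
      rw [cob_single]
      by_cases hy : I.ε x y = 0
      · simp [hy]
      · simp [hw y hy])
  have : t = 0 := by
    ext z
    refine ht z fun hz => ?_
    have := I.ρ_mono.monotone hz.1
    omega
  rw [this, map_zero] at htd
  have := congrFun htd x
  simpa using this.symm

theorem exists_embedding {m : ℕ} (hF : F.CM I (m + 1)) :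
    ∃ ι : ∀ x, F.W x →ₗ[ℝ] (∀ z, (F.W z →ₗ[ℝ] ℝ)),
      (∀ x w, ι x w ∈ F.cyc I m x) ∧
      (∀ x y, x ≤ y → ∀ w, mask (fun z => y ≤ z) (ι x w) = ι y (F.φ x y w)) ∧
      ∀ x, I.ρ x ≤ m → ∀ w, ι x w = 0 → w = 0 := by
  have hS : ∀ z, ∃ S : F.W z →ₗ[ℝ] F.W z →ₗ[ℝ] ℝ, (∀ v, 0 ≤ S v v) ∧ ∀ v, S v v = 0 → v = 0 :=
    fun z => exists_posDef_form _
  choose S hS0 hS1 using hS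
  let β : ∀ u : P, P → F.W u →ₗ[ℝ] F.W u →ₗ[ℝ] ℝ := fun u z =>
    I.ε u z • (S z).compl₁₂ (F.φ u z) (F.φ u z)
  obtain ⟨c, hc⟩ := exists_common_nondegenerate (ι := {u : P // I.ρ u = m}) (fun u => F.W u.1)
    (fun u => β u.1) (by
      rintro ⟨u, hu⟩
      refine ⟨I.ε u, fun v hv => UpExact.eq_zero (hF u _ (by omega)) fun z hz => ?_⟩
      have h1 := LinearMap.congr_fun hv v
      simp only [β, LinearMap.sum_apply, LinearMap.smul_apply, LinearMap.compl₁₂_apply,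
        smul_eq_mul, LinearMap.zero_apply, ← mul_assoc] at h1
      rw [Finset.sum_eq_zero_iff_of_nonneg
        fun z _ => mul_nonneg (mul_self_nonneg _) (hS0 _ _)] at h1
      apply hS1
      have h2 := h1 z (Finset.mem_univ z)
      simpa [hz] using h2)
  let b : ∀ u, F.W u →ₗ[ℝ] (F.W u →ₗ[ℝ] ℝ) := fun u => ∑ z, c z • β u z
  have hb : ∀ u v w, b u v w = ∑ z, c z * (I.ε u z * S z (F.φ u z v) (F.φ u z w)) := by
    intro u v w; simp [b, β]
  let ι : ∀ x, F.W x →ₗ[ℝ] (∀ z, (F.W z →ₗ[ℝ] ℝ)) := fun x =>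
    mask (fun u => x ≤ u ∧ I.ρ u = m) ∘ₗ LinearMap.pi fun u => b u ∘ₗ F.φ x u
  have hι : ∀ x w u, ι x w u = if x ≤ u ∧ I.ρ u = m then b u (F.φ x u w) else 0 :=
    fun x w u => by by_cases h : x ≤ u ∧ I.ρ u = m <;> simp [ι, mask_apply, h]
  have hnat : ∀ x y, x ≤ y → ∀ w, mask (fun z => y ≤ z) (ι x w) = ι y (F.φ x y w) := by
    intro x y hxy w
    ext u : 1
    rw [mask_apply, hι, hι]
    by_cases hyu : y ≤ u
    · simp only [hyu, hxy.trans hyu, true_and, if_true, F.φ_comp x y u hxy hyu]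
    · simp [hyu]
  refine ⟨ι, fun x w => ⟨fun u hu => if_neg hu, fun y hy => ?_⟩, hnat, ?_⟩
  · by_cases hr : I.ρ y + 1 = m
    · ext w'
      rw [bdy_apply]
      have h1 : ∀ u, I.ε y u * ι x w u (F.φ y u w')
          = ∑ z, (I.ε y u * I.ε u z) * (c z * S z (F.φ x z w) (F.φ y z w')) := by
        intro u
        by_cases hu : I.ε y u = 0
        · simp [hu]
        have hyu := (I.ε_lt _ _ hu).le
        rw [hι, if_pos ⟨hy.trans hyu, by rw [I.ε_rank _ _ hu, hr]⟩, hb, Finset.mul_sum]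
        refine Finset.sum_congr rfl fun z _ => ?_
        by_cases hz : I.ε u z = 0
        · simp [hz]
        have huz := (I.ε_lt _ _ hz).le
        rw [F.φ_comp x u z (hy.trans hyu) huz, F.φ_comp y u z hyu huz]
        ring
      simp_rw [h1]
      rw [Finset.sum_comm]
      simp_rw [← Finset.sum_mul, I.ε_sq]
      simp
    · exact bdy_eq_zero_of_rank (r := m) _ (fun z hz => if_neg fun h => hz h.2) hr
  · suffices H : ∀ k x, I.ρ x + k = m → ∀ w, ι x w = 0 → w = 0 from
      fun x hx => H (m - I.ρ x) x (by omega)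
    intro k
    induction k with
    | zero =>
      intro x hx w hw
      apply hc ⟨x, by simpa using hx⟩
      have h1 := congrFun hw x
      rw [hι, if_pos ⟨le_rfl, by simpa using hx⟩, F.φ_id] at h1
      exact h1
    | succ k ih =>
      intro x hx w hw
      refine UpExact.eq_zero (hF x _ (by omega)) fun z hz => ?_
      apply ih z (by rw [I.ε_rank _ _ hz]; omega)
      rw [← hnat x z (I.ε_lt _ _ hz).le, hw, map_zero]

/-- The sheaf of masked dual cycles modulo the image of an embedding of the sheaf. -/
def cokernel (I : CellIncidence P) (m : ℕ) (ι : ∀ x, F.W x →ₗ[ℝ] (∀ z, F.W z →ₗ[ℝ] ℝ))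
    (hnat : ∀ x y, x ≤ y → ∀ w, mask (fun z => y ≤ z) (ι x w) = ι y (F.φ x y w)) :
    CellSheaf P where
  W x := Subquotient (F.cyc I m x) (LinearMap.range (ι x))
  φ x y := if h : x ≤ y then
      Subquotient.map (mask fun z => y ≤ z) (fun c hc => mask_mem_cyc h hc) (by
        rintro _ ⟨w, rfl⟩
        exact ⟨F.φ x y w, (hnat x y h w).symm⟩)
    else 0
  φ_id x w := by
    rw [dif_pos le_rfl]
    obtain ⟨c, rfl⟩ := Subquotient.mk_surjective _ _ w
    rw [Subquotient.map_mk]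
    congr 1
    ext z : 2
    by_cases hz : x ≤ z
    · simp [mask_apply, hz]
    · simp [mask_apply, hz, c.2.1 z fun h => hz h.1]
  φ_comp x y z hxy hyz w := by
    rw [dif_pos hxy, dif_pos hyz, dif_pos (hxy.trans hyz)]
    obtain ⟨c, rfl⟩ := Subquotient.mk_surjective _ _ w
    rw [Subquotient.map_mk, Subquotient.map_mk, Subquotient.map_mk]
    congr 1
    ext u : 2
    by_cases hu : z ≤ u
    · simp [mask_apply, hu, hyz.trans hu]
    · simp [mask_apply, hu]

section Cokernel

variable {m : ℕ} {ι : ∀ x, F.W x →ₗ[ℝ] (∀ z, F.W z →ₗ[ℝ] ℝ)}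
  (hnat : ∀ x y, x ≤ y → ∀ w, mask (fun z => y ≤ z) (ι x w) = ι y (F.φ x y w))

/-- The class in the cokernel sheaf of a masked dual cycle. -/
def cokernelMk (x : P) : F.cyc I m x →ₗ[ℝ] (cokernel I m ι hnat).W x := Subquotient.mk _ _

theorem cokernelMk_surjective (x : P) :
    Function.Surjective (cokernelMk (I := I) (m := m) hnat x) := Subquotient.mk_surjective _ _

theorem cokernelMk_eq_zero_iff {x : P} {c : F.cyc I m x} :
    cokernelMk hnat x c = 0 ↔ ∃ w, ι x w = c.1 := Subquotient.mk_eq_zero_iff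

theorem cokernel_φ_mk {x y : P} (h : x ≤ y) (c : F.cyc I m x) :
    (cokernel I m ι hnat).φ x y (cokernelMk hnat x c)
      = cokernelMk hnat y ⟨mask (fun z => y ≤ z) c.1, mask_mem_cyc h c.2⟩ := by
  simp only [cokernel, dif_pos h]
  rfl

theorem cokernel_cob_mk (κ : ∀ x, F.cyc I m x) (y : P) :
    (cokernel I m ι hnat).cob I (fun x => cokernelMk hnat x (κ x)) y
      = cokernelMk hnat y ⟨F.mcob I (fun x => (κ x).1) y,
          mcob_mem_cyc (fun x => (κ x).2) y⟩ := by
  rw [cob_apply]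
  have h1 : ∀ x, I.ε x y • (cokernel I m ι hnat).φ x y (cokernelMk hnat x (κ x))
      = cokernelMk hnat y (I.ε x y • (if h : x ≤ y then
          ⟨mask (fun z => y ≤ z) (κ x).1, mask_mem_cyc h (κ x).2⟩ else 0)) := by
    intro x
    by_cases hx : I.ε x y = 0
    · rw [hx, zero_smul, zero_smul, map_zero]
    · have h := (I.ε_lt _ _ hx).le
      rw [cokernel_φ_mk hnat h, dif_pos h, map_smul]
  simp_rw [h1]
  rw [← map_sum]
  congr 1
  ext z : 2
  simp only [mcob, AddSubmonoidClass.coe_finsetSum, Finset.sum_apply]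
  refine Finset.sum_congr rfl fun x _ => ?_
  by_cases hx : I.ε x y = 0
  · simp [hx]
  · simp [(I.ε_lt _ _ hx).le]

end Cokernel

theorem exists_cokernel {m : ℕ} (hF : F.CM I (m + 1)) :
    ∃ Q : CellSheaf P, (∀ p j, j + 1 < m → Q.UpExact I p j) ∧
      ∀ x, I.ρ x ≤ m → (Module.finrank ℝ (Q.W x) : ℤ)
        = I.dualWeight (fun z => (Module.finrank ℝ (F.W z) : ℤ)) m x
          - Module.finrank ℝ (F.W x) := by
  obtain ⟨ι, hcyc, hnat, hinj⟩ := exists_embedding hF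
  have hdown : ∀ p, ∀ r < m, F.DownExact I p r := fun p r hr =>
    (hF p r (by omega)).downExact
  refine ⟨cokernel I m ι hnat, fun p j hj s hs hds => ?_, fun x hx => ?_⟩
  · have hlift : ∀ x, ∃ κ : F.cyc I m x, cokernelMk hnat x κ = s x ∧
          (¬ (p ≤ x ∧ I.ρ x = j) → κ = 0) := by
      intro x
      by_cases hx : p ≤ x ∧ I.ρ x = j
      · obtain ⟨κ, hκ⟩ := cokernelMk_surjective hnat x (s x)
        exact ⟨κ, hκ, fun h => absurd hx h⟩
      · exact ⟨0, by rw [hs x hx, map_zero], fun _ => rfl⟩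
    choose κ hκ hκs using hlift
    have hlift2 : ∀ y, ∃ w : F.W y, ι y w = F.mcob I (fun x => (κ x).1) y ∧
        (¬ (p ≤ y ∧ I.ρ y = j + 1) → w = 0) := by
      intro y
      by_cases hy : p ≤ y ∧ I.ρ y = j + 1
      · have h1 := cokernel_cob_mk hnat κ y
        rw [show (fun x => cokernelMk hnat x (κ x)) = s from funext hκ, hds] at h1
        obtain ⟨w, hw⟩ := (cokernelMk_eq_zero_iff hnat).1 h1.symm
        exact ⟨w, hw, fun h => absurd hy h⟩
      · refine ⟨0, ?_, fun _ => rfl⟩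
        rw [map_zero]
        symm
        refine Finset.sum_eq_zero fun x _ => ?_
        by_cases hx : I.ε x y = 0
        · simp [hx]
        have h0 : (κ x).1 = 0 := congrArg Subtype.val (hκs x fun h => hy ⟨h.1.trans (I.ε_lt _ _ hx).le, by rw [I.ε_rank _ _ hx]; omega⟩)
        simp [h0]
    choose w hw hws using hlift2
    have hmι : ∀ v : ∀ x, F.W x, F.mcob I (fun x => ι x (v x)) = fun y => ι y (F.cob I v y) := by
      intro v
      ext y : 1
      rw [cob_apply, map_sum]
      refine Finset.sum_congr rfl fun x _ => ?_
      by_cases hx : I.ε x y = 0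
      · simp [hx]
      · rw [hnat x y (I.ε_lt _ _ hx).le, map_smul]
    have hdw : F.cob I w = 0 := by
      ext y
      by_cases hy : I.ρ y = j + 2
      · apply hinj y (by omega)
        have h1 := congrFun (hmι w) y
        rw [show (fun x => ι x (w x)) = F.mcob I (fun x => (κ x).1) from funext hw,
          mcob_mcob] at h1
        exact h1.symm
      · rw [cob_apply]
        refine Finset.sum_eq_zero fun x _ => ?_
        by_cases hx : I.ε x y = 0
        · simp [hx]
        rw [hws x fun h => hy (by rw [I.ε_rank _ _ hx]; omega)]
        simp
    obtain ⟨w', hw's, hw'⟩ := hF p (j + 1) (by omega) w hws hdw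
    obtain ⟨e, he1, he2, he3⟩ := exists_mcob_eq hdown m le_rfl j (by omega) p
      ((fun x => (κ x).1) - fun x => ι x (w' x))
      (fun x => Submodule.sub_mem _ (κ x).2 (hcyc x _))
      (fun x hx => by
        simp [hκs x hx, hw's x fun h => hx ⟨h.1, by omega⟩])
      (by
        rw [mcob_sub, hmι, hw']
        ext y : 1
        simp [hw])
    refine ⟨fun x => cokernelMk hnat x ⟨e x, he1 x⟩,
      fun x hx => (cokernelMk_eq_zero_iff hnat).2 ⟨0, by simp [he2 x hx]⟩, ?_⟩
    ext y
    rw [cokernel_cob_mk hnat (fun x => ⟨e x, he1 x⟩) y, ← hκ y, ← sub_eq_zero, ← map_sub]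
    refine (cokernelMk_eq_zero_iff hnat).2 ⟨- w' y, ?_⟩
    simp [he3]
  · have h1 : Module.finrank ℝ (LinearMap.range (ι x)) = Module.finrank ℝ (F.W x) := by
      apply LinearMap.finrank_range_of_inj
      exact (injective_iff_map_eq_zero _).2 fun w hw => hinj x hx w hw
    have h2 := Subquotient.finrank_add (S := F.cyc I m x) (R := LinearMap.range (ι x)) (by
      rintro _ ⟨w, rfl⟩; exact hcyc x w)
    have h3 := finrank_cyc (x := x) fun r hr => hdown x r hr
    rw [← h3, ← h1, eq_sub_iff_add_eq]
    exact_mod_cast h2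

end CellSheaf

end

section

variable {P : Type u} [Fintype P] [PartialOrder P]

namespace CellIncidence

variable (I : CellIncidence P)

theorem dualWeight_succ (w : P → ℤ) (m : ℕ) (x : P) :
    I.dualWeight w (m + 1) x
      = (∑ z, if x ≤ z ∧ I.ρ z = m + 1 then w z else 0) - I.dualWeight w m x := by
  rw [dualWeight, dualWeight, ← Finset.sum_sub_distrib]
  refine Finset.sum_congr rfl fun z _ => ?_
  by_cases hx : x ≤ z
  · rcases lt_trichotomy (I.ρ z) (m + 1) with hz | hz | hz
    · have e1 : I.ρ z ≤ m := by omega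
      have e2 : I.ρ z ≤ m + 1 := by omega
      have e3 : I.ρ z ≠ m + 1 := by omega
      simp only [hx, e1, e2, e3, true_and, if_true, if_false]
      rw [show m + 1 + I.ρ z = (m + I.ρ z) + 1 by ring, pow_succ]; ring
    · have : (-1 : ℤ) ^ (m + 1 + (m + 1)) = 1 := by rw [← two_mul, pow_mul]; simp
      simp [hx, hz, this]
    · have e1 : ¬ I.ρ z ≤ m := by omega
      have e2 : ¬ I.ρ z ≤ m + 1 := by omega
      have e3 : I.ρ z ≠ m + 1 := by omega
      simp [e1, e2, e3]
  · simp [hx]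

theorem dualWeight_self (w : P → ℤ) (x : P) : I.dualWeight w (I.ρ x) x = w x := by
  rw [dualWeight, Finset.sum_eq_single x]
  · have : (-1 : ℤ) ^ (I.ρ x + I.ρ x) = 1 := by rw [← two_mul, pow_mul]; simp
    simp [this]
  · intro z _ hz
    rw [if_neg]
    rintro ⟨h1, h2⟩
    have := I.ρ_mono (lt_of_le_of_ne h1 hz.symm)
    omega
  · simp

theorem dualWeight_congr {w w' : P → ℤ} {m : ℕ} (h : ∀ x, I.ρ x ≤ m → w x = w' x) (x : P) :
    I.dualWeight w m x = I.dualWeight w' m x := by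
  refine Finset.sum_congr rfl fun z _ => ?_
  by_cases hz : x ≤ z ∧ I.ρ z ≤ m
  · simp only [hz, and_self, if_true, h z hz.2]
  · simp only [hz, if_false]

/-- Every nontrivial closed interval has as many elements of even rank as of odd rank. -/
def IsEulerian : Prop :=
  ∀ x z, x < z → ∑ y, (if x ≤ y ∧ y ≤ z then (-1 : ℤ) ^ I.ρ y else 0) = 0

variable {I}

theorem IsEulerian.sum_Ico (hE : I.IsEulerian) {x z : P} (hxz : x < z) :
    ∑ y, (if x ≤ y ∧ y < z then (-1 : ℤ) ^ I.ρ y else 0) = - (-1) ^ I.ρ z := by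
  have h := hE x z hxz
  have h1 : ∑ y, ((if x ≤ y ∧ y ≤ z then (-1 : ℤ) ^ I.ρ y else 0)
      - if x ≤ y ∧ y < z then (-1 : ℤ) ^ I.ρ y else 0) = (-1) ^ I.ρ z := by
    rw [Finset.sum_eq_single z]
    · simp [hxz.le]
    · intro y _ hy
      by_cases h1 : y ≤ z
      · simp [h1, lt_of_le_of_ne h1 hy]
      · have : ¬ y < z := fun h => h1 h.le
        simp [h1, this]
    · simp
  rw [Finset.sum_sub_distrib] at h1
  linarith

theorem IsEulerian.dualWeight_dualWeight (hE : I.IsEulerian) (w : P → ℤ) {m : ℕ} {x : P}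
    (hx : I.ρ x ≤ m) :
    I.dualWeight (fun z => I.dualWeight w (m + 1) z - w z) m x
      = I.dualWeight w (m + 1) x - w x := by
  have hsq : ∀ k : ℕ, (-1 : ℤ) ^ k * (-1) ^ k = 1 := fun k => by
    rw [← mul_pow]; simp
  have h1 : ∀ u, ∑ z, (if (x ≤ z ∧ I.ρ z ≤ m) ∧ (z ≤ u ∧ I.ρ u ≤ m + 1) then
      (-1 : ℤ) ^ (m + I.ρ z) * ((-1) ^ (m + 1 + I.ρ u) * w u) else 0)
      = (if u = x then - w u else 0) + if x ≤ u ∧ I.ρ u = m + 1 then w u else 0 := by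
    intro u
    by_cases hu : I.ρ u ≤ m + 1
    swap
    · have h2 : u ≠ x := by rintro rfl; omega
      have h3 : I.ρ u ≠ m + 1 := by omega
      simp [hu, h2, h3]
    by_cases hxu : x ≤ u
    swap
    · have h2 : u ≠ x := by rintro rfl; exact hxu le_rfl
      rw [if_neg h2, if_neg (fun h => hxu h.1)]
      refine Finset.sum_eq_zero fun z _ => if_neg fun h => hxu (h.1.1.trans h.2.1)
    rcases eq_or_lt_of_le hxu with rfl | hlt
    · have h3 : I.ρ x ≠ m + 1 := by omega
      rw [Finset.sum_eq_single x]
      · simp only [le_refl, hx, hu, and_self, if_true, h3, and_false, if_false, pow_add, pow_one]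
        linear_combination (-w x) * hsq m + (-w x * ((-1)^m * (-1)^m)) * hsq (I.ρ x)
      · intro z _ hz
        rw [if_neg]
        rintro ⟨⟨h1, _⟩, h2, _⟩
        exact hz (le_antisymm h2 h1)
      · simp
    · have h2 : u ≠ x := hlt.ne'
      rw [if_neg h2, zero_add]
      by_cases hum : I.ρ u = m + 1
      · have h4 := hE.sum_Ico hlt
        rw [if_pos ⟨hxu, hum⟩]
        have h5 : ∀ z, (if (x ≤ z ∧ I.ρ z ≤ m) ∧ (z ≤ u ∧ I.ρ u ≤ m + 1) then
            (-1 : ℤ) ^ (m + I.ρ z) * ((-1) ^ (m + 1 + I.ρ u) * w u) else 0)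
            = (if x ≤ z ∧ z < u then (-1 : ℤ) ^ I.ρ z else 0) * ((-1) ^ m * w u) := by
          intro z
          by_cases hz : x ≤ z ∧ z < u
          · have h6 := I.ρ_mono hz.2
            have h7 : I.ρ z ≤ m := by omega
            rw [if_pos ⟨⟨hz.1, h7⟩, hz.2.le, hu⟩, if_pos hz, hum]
            linear_combination ((-1) ^ m * (-1) ^ I.ρ z * w u) * hsq (m + 1)
          · rw [if_neg hz, if_neg, zero_mul]
            rintro ⟨⟨h6, h7⟩, h8, _⟩
            refine hz ⟨h6, lt_of_le_of_ne h8 ?_⟩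
            rintro rfl
            omega
        simp_rw [h5]
        rw [← Finset.sum_mul, h4, hum, pow_succ]
        linear_combination (w u) * hsq m
      · have h4 := hE x u hlt
        rw [if_neg fun h => hum h.2]
        have h5 : ∀ z, (if (x ≤ z ∧ I.ρ z ≤ m) ∧ (z ≤ u ∧ I.ρ u ≤ m + 1) then
            (-1 : ℤ) ^ (m + I.ρ z) * ((-1) ^ (m + 1 + I.ρ u) * w u) else 0)
            = (if x ≤ z ∧ z ≤ u then (-1 : ℤ) ^ I.ρ z else 0)
              * ((-1) ^ m * ((-1) ^ (m + 1 + I.ρ u) * w u)) := by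
          intro z
          by_cases hz : x ≤ z ∧ z ≤ u
          · have h6 := I.ρ_mono.monotone hz.2
            rw [if_pos ⟨⟨hz.1, by omega⟩, hz.2, hu⟩, if_pos hz, pow_add]
            ring
          · rw [if_neg hz, if_neg, zero_mul]
            rintro ⟨⟨h6, h7⟩, h8, _⟩
            exact hz ⟨h6, h8⟩
        simp_rw [h5]
        rw [← Finset.sum_mul, h4, zero_mul]
  have h2 : I.dualWeight (fun z => I.dualWeight w (m + 1) z - w z) m x
      = (∑ u, ∑ z, (if (x ≤ z ∧ I.ρ z ≤ m) ∧ (z ≤ u ∧ I.ρ u ≤ m + 1) then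
        (-1 : ℤ) ^ (m + I.ρ z) * ((-1) ^ (m + 1 + I.ρ u) * w u) else 0))
        - I.dualWeight w m x := by
    rw [Finset.sum_comm]
    simp only [dualWeight]
    rw [← Finset.sum_sub_distrib]
    refine Finset.sum_congr rfl fun z _ => ?_
    by_cases hz : x ≤ z ∧ I.ρ z ≤ m
    · simp only [hz, and_self, if_true, true_and]
      rw [mul_sub, Finset.mul_sum]
      congr 1
      refine Finset.sum_congr rfl fun u _ => ?_
      by_cases hu : z ≤ u ∧ I.ρ u ≤ m + 1
      · rw [if_pos hu, if_pos hu]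
      · rw [if_neg hu, if_neg hu, mul_zero]
    · simp [hz]
  rw [h2, dualWeight_succ]
  simp_rw [h1]
  rw [Finset.sum_add_distrib, Finset.sum_ite_eq' Finset.univ x]
  simp
  ring

variable (I) {R : Type*} [Ring R] (ψ : P → R) (e : R)

/-- The weighted sum of `ψ x * e ^ (m - ρ x)` over the elements of rank at most `m`. -/
def rankSum (w : P → ℤ) (m : ℕ) : R :=
  ∑ x, if I.ρ x ≤ m then w x • (ψ x * e ^ (m - I.ρ x)) else 0

/-- The weighted sum of `ψ x * e ^ (m - 1 - ρ x)` measuring the failure of self-duality of a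
weight function. -/
def defectSum (w : P → ℤ) (m : ℕ) : R :=
  ∑ x, if I.ρ x + 1 ≤ m then (I.dualWeight w m x - w x) • (ψ x * e ^ (m - 1 - I.ρ x)) else 0

variable {I ψ e}

theorem rankSum_congr {w w' : P → ℤ} {m : ℕ} (h : ∀ x, I.ρ x ≤ m → w x = w' x) :
    I.rankSum ψ e w m = I.rankSum ψ e w' m := by
  refine Finset.sum_congr rfl fun x _ => ?_
  by_cases hx : I.ρ x ≤ m
  · simp only [hx, if_true, h x hx]
  · simp only [hx, if_false]

theorem defectSum_congr {w w' : P → ℤ} {m : ℕ} (h : ∀ x, I.ρ x ≤ m → w x = w' x) :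
    I.defectSum ψ e w m = I.defectSum ψ e w' m := by
  refine Finset.sum_congr rfl fun x _ => ?_
  by_cases hx : I.ρ x + 1 ≤ m
  · simp only [hx, if_true, h x (by omega), I.dualWeight_congr h]
  · simp only [hx, if_false]

theorem defectSum_zero (w : P → ℤ) : I.defectSum ψ e w 0 = 0 := by
  simp [defectSum]

theorem defectSum_succ_eq_rankSum (w : P → ℤ) (m : ℕ) :
    I.defectSum ψ e w (m + 1) = I.rankSum ψ e (fun x => I.dualWeight w (m + 1) x - w x) m := by
  simp [defectSum, rankSum]

theorem IsEulerian.defectSum_defect (hE : I.IsEulerian) (w : P → ℤ) (m : ℕ) :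
    I.defectSum ψ e (fun x => I.dualWeight w (m + 1) x - w x) m = 0 := by
  refine Finset.sum_eq_zero fun x _ => ?_
  by_cases hx : I.ρ x + 1 ≤ m
  · rw [if_pos hx, hE.dualWeight_dualWeight w (by omega), sub_self, zero_smul]
  · rw [if_neg hx]

section Recursion

variable [OrderBot P] (hbot : I.ρ ⊥ = 0) {a b : R} {θ : P → R}
  (hψ : ∀ x, ψ x = if x = ⊥ then 1 else θ x * b)
  (hθ : ∀ z, z ≠ ⊥ → θ z = ∑ x, if x < z then ψ x * (a - b) ^ (I.ρ z - 1 - I.ρ x) else 0)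

include hbot hψ hθ in
theorem rankSum_sub_defectSum_succ (w : P → ℤ) (m : ℕ) :
    I.rankSum ψ (a - b) w (m + 1) - I.defectSum ψ (a - b) w (m + 1) * b
      = (I.rankSum ψ (a - b) w m - I.defectSum ψ (a - b) w m * b) * (a + b)
        + I.defectSum ψ (a - b) w m * (a * b + b * a) := by
  set X : R := ∑ z, if I.ρ z = m + 1 then w z • θ z else 0 with hX
  have hA : I.rankSum ψ (a - b) w (m + 1) = I.rankSum ψ (a - b) w m * (a - b) + X * b := by
    rw [rankSum, rankSum, hX, Finset.sum_mul, Finset.sum_mul, ← Finset.sum_add_distrib]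
    refine Finset.sum_congr rfl fun x _ => ?_
    rcases lt_trichotomy (I.ρ x) (m + 1) with hx | hx | hx
    · rw [if_pos hx.le, if_pos (by omega), if_neg hx.ne, zero_mul, add_zero, smul_mul_assoc,
        mul_assoc, ← pow_succ, show m - I.ρ x + 1 = m + 1 - I.ρ x by omega]
    · rw [if_pos hx.le, if_neg (by omega), if_pos hx, zero_mul, zero_add, hx, hψ, if_neg]
      · simp [mul_assoc]
      · rintro rfl
        omega
    · rw [if_neg (by omega), if_neg (by omega), if_neg (by omega)]
      simp
  have hG : I.defectSum ψ (a - b) w (m + 1) = X - I.rankSum ψ (a - b) w m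
      - (I.rankSum ψ (a - b) w m + I.defectSum ψ (a - b) w m * (a - b)) := by
    have h1 : ∑ x, (if I.ρ x ≤ m then (∑ z, if x ≤ z ∧ I.ρ z = m + 1 then w z else 0) •
        (ψ x * (a - b) ^ (m - I.ρ x)) else 0) = X := by
      have h2 : ∀ z, (if I.ρ z = m + 1 then w z • θ z else 0)
          = ∑ x, if x < z ∧ I.ρ z = m + 1 then w z • (ψ x * (a - b) ^ (m - I.ρ x)) else 0 := by
        intro z
        by_cases hz : I.ρ z = m + 1
        · rw [if_pos hz, hθ z (by rintro rfl; omega), Finset.smul_sum]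
          refine Finset.sum_congr rfl fun x _ => ?_
          by_cases hx : x < z <;> simp [hx, hz]
        · simp [hz]
      rw [hX]
      simp_rw [h2]
      rw [Finset.sum_comm]
      refine Finset.sum_congr rfl fun x _ => ?_
      by_cases hx : I.ρ x ≤ m
      · rw [if_pos hx, Finset.sum_smul]
        refine Finset.sum_congr rfl fun z _ => ?_
        by_cases hz : I.ρ z = m + 1
        · have : x ≠ z := by rintro rfl; omega
          by_cases hxz : x ≤ z
          · simp [hz, hxz, lt_of_le_of_ne hxz this]
          · have h' : ¬ x < z := fun h => hxz h.le
            simp [hxz, h']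
        · simp [hz]
      · rw [if_neg hx]
        symm
        refine Finset.sum_eq_zero fun z _ => if_neg ?_
        rintro ⟨h, h'⟩
        have := I.ρ_mono h
        omega
    have h3 : I.rankSum ψ (a - b) w m + I.defectSum ψ (a - b) w m * (a - b)
        = ∑ x, if I.ρ x ≤ m then I.dualWeight w m x • (ψ x * (a - b) ^ (m - I.ρ x)) else 0 := by
      rw [rankSum, defectSum, Finset.sum_mul, ← Finset.sum_add_distrib]
      refine Finset.sum_congr rfl fun x _ => ?_
      rcases lt_trichotomy (I.ρ x) m with hx | hx | hx
      · rw [if_pos hx.le, if_pos hx.le, if_pos (by omega), smul_mul_assoc, mul_assoc, ← pow_succ,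
          show m - 1 - I.ρ x + 1 = m - I.ρ x by omega, ← add_smul]
        congr 1
        ring
      · subst hx
        rw [if_pos le_rfl, if_pos le_rfl, if_neg (by omega), dualWeight_self, zero_mul, add_zero]
      · rw [if_neg (by omega), if_neg (by omega), if_neg (by omega)]
        simp
    rw [h3, ← h1, rankSum, ← Finset.sum_sub_distrib, ← Finset.sum_sub_distrib, defectSum]
    refine Finset.sum_congr rfl fun x _ => ?_
    by_cases hx : I.ρ x ≤ m
    · rw [if_pos (by omega), if_pos hx, if_pos hx, if_pos hx, dualWeight_succ, ← sub_smul,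
        ← sub_smul]
      simp only [Nat.add_sub_cancel]
      congr 1
      ring
    · rw [if_neg (by omega), if_neg hx, if_neg hx, if_neg hx]
      simp
  rw [hA, hG]
  noncomm_ring

end Recursion
end CellIncidence

end

section

/-- The cone of nonnegative integer combinations of `cd`-monomials of degree `n`. -/
def cdCone (n : ℕ) : AddSubmonoid NC :=
  AddSubmonoid.closure {x | ∃ l, cdDeg l = n ∧ x = cdMonomial l}

theorem cdMonomial_append (l l' : List Bool) :
    cdMonomial (l ++ l') = cdMonomial l * cdMonomial l' := by
  induction l with
  | nil => simp [cdMonomial]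
  | cons s l ih => simp [cdMonomial, ih, mul_assoc]

theorem cdDeg_append (l l' : List Bool) : cdDeg (l ++ l') = cdDeg l + cdDeg l' := by
  simp [cdDeg]

theorem mul_cdMonomial_mem_cdCone {n : ℕ} {x : NC} (hx : x ∈ cdCone n) (l : List Bool) :
    x * cdMonomial l ∈ cdCone (n + cdDeg l) := by
  induction hx using AddSubmonoid.closure_induction with
  | mem x hx =>
    obtain ⟨l', h, rfl⟩ := hx
    refine AddSubmonoid.subset_closure ⟨l' ++ l, ?_, (cdMonomial_append _ _).symm⟩
    rw [cdDeg_append, h]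
  | zero => rw [zero_mul]; exact zero_mem _
  | add x y _ _ hx hy => rw [add_mul]; exact add_mem hx hy

theorem mul_vc_mem_cdCone {n : ℕ} {x : NC} (hx : x ∈ cdCone n) : x * vc ∈ cdCone (n + 1) := by
  simpa [cdMonomial, cdDeg] using mul_cdMonomial_mem_cdCone hx [false]

theorem mul_vd_mem_cdCone {n : ℕ} {x : NC} (hx : x ∈ cdCone n) : x * vd ∈ cdCone (n + 2) := by
  simpa [cdMonomial, cdDeg] using mul_cdMonomial_mem_cdCone hx [true]

theorem exists_cdEval_of_mem_cdCone {n : ℕ} {x : NC} (hx : x ∈ cdCone n) :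
    ∃ f : List Bool →₀ ℤ, (∀ w, 0 ≤ f w) ∧ (∀ w ∈ f.support, cdDeg w = n) ∧ cdEval f = x := by
  induction hx using AddSubmonoid.closure_induction with
  | mem x hx =>
    obtain ⟨l, h, rfl⟩ := hx
    refine ⟨Finsupp.single l 1, fun w => ?_, fun w hw => ?_, ?_⟩
    · rw [Finsupp.single_apply]; split_ifs <;> simp
    · rw [Finset.mem_singleton.1 (Finsupp.support_single_subset hw), h]
    · rw [cdEval, Finsupp.sum_single_index] <;> simp
  | zero => exact ⟨0, by simp, by simp, by simp [cdEval]⟩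
  | add x y _ _ hx hy =>
    obtain ⟨f, f1, f2, rfl⟩ := hx
    obtain ⟨g, g1, g2, rfl⟩ := hy
    refine ⟨f + g, fun w => add_nonneg (f1 w) (g1 w), fun w hw => ?_, ?_⟩
    · rcases Finset.mem_union.1 (Finsupp.support_add hw) with h | h
      · exact f2 w h
      · exact g2 w h
    · rw [cdEval, Finsupp.sum_add_index']
      · rfl
      · simp
      · intro w a b; rw [Int.cast_add, add_smul]

namespace CellSheaf

variable {P : Type u} [Fintype P] [PartialOrder P] [OrderBot P] {I : CellIncidence P}

theorem rankSum_sub_defectSum_mem_cdCone (hbot : I.ρ ⊥ = 0) (hE : I.IsEulerian) {ψ θ : P → NC}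
    (hψ : ∀ x, ψ x = if x = ⊥ then 1 else θ x * vb)
    (hθ : ∀ z, z ≠ ⊥ →
      θ z = ∑ x, if x < z then ψ x * (va - vb) ^ (I.ρ z - 1 - I.ρ x) else 0)
    (n : ℕ) : ∀ F : CellSheaf P, F.CM I n →
      I.rankSum ψ (va - vb) (fun x => (Module.finrank ℝ (F.W x) : ℤ)) n
        - I.defectSum ψ (va - vb) (fun x => (Module.finrank ℝ (F.W x) : ℤ)) n * vb ∈ cdCone n := by
  have rec' := fun (w : P → ℤ) (m : ℕ) =>
    CellIncidence.rankSum_sub_defectSum_succ (I := I) hbot hψ hθ w m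
  induction n using Nat.strong_induction_on with
  | _ n ih =>
    intro F hF
    have h0 : I.rankSum ψ (va - vb) (fun x => (Module.finrank ℝ (F.W x) : ℤ)) 0 ∈ cdCone 0 := by
      have : I.rankSum ψ (va - vb) (fun x => (Module.finrank ℝ (F.W x) : ℤ)) 0
          = Module.finrank ℝ (F.W ⊥) • (1 : NC) := by
        rw [CellIncidence.rankSum, Finset.sum_eq_single (⊥ : P)]
        · simp [hbot, hψ ⊥]
        · intro x _ hx
          rw [if_neg]
          have := I.ρ_mono (bot_lt_iff_ne_bot.2 hx)
          omega
        · simp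
      rw [this]
      have h1 : (1 : NC) ∈ cdCone 0 := AddSubmonoid.subset_closure ⟨[], rfl, rfl⟩
      exact nsmul_mem h1 _
    match n with
    | 0 => rwa [CellIncidence.defectSum_zero, zero_mul, sub_zero]
    | 1 =>
      rw [show (1 : ℕ) = 0 + 1 from rfl, rec', CellIncidence.defectSum_zero, zero_mul, zero_mul,
        sub_zero, add_zero]
      exact mul_vc_mem_cdCone h0
    | n + 2 =>
      rw [show n + 2 = (n + 1) + 1 from rfl, rec']
      refine add_mem (mul_vc_mem_cdCone (ih (n + 1) (by omega) F fun p r hr => hF p r (by omega)))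
        ?_
      obtain ⟨Q, hQ, hQd⟩ := exists_cokernel (m := n + 1) (F := F) hF
      refine mul_vd_mem_cdCone (n := n) ?_
      have h := ih n (by omega) Q fun p r hr => hQ p r (by omega)
      rw [CellIncidence.rankSum_congr (fun x hx => hQd x (by omega)),
        CellIncidence.defectSum_congr (fun x hx => hQd x (by omega)), hE.defectSum_defect,
        zero_mul, sub_zero, ← CellIncidence.defectSum_succ_eq_rankSum] at h
      exact h

end CellSheaf

end

section

theorem sort_insert_max {s : Finset ℕ} {r : ℕ} (h : ∀ t ∈ s, t < r) :
    (insert r s).sort (· ≤ ·) = s.sort (· ≤ ·) ++ [r] := by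
  have hr : r ∉ s := fun hr => lt_irrefl _ (h r hr)
  refine List.Perm.eq_of_pairwise (le := (· ≤ ·)) (fun a b _ _ h1 h2 => le_antisymm h1 h2)
    (Finset.pairwise_sort _ _) ?_ ?_
  · rw [List.pairwise_append]
    refine ⟨Finset.pairwise_sort _ _, List.pairwise_singleton _ _, fun a ha b hb => ?_⟩
    rw [List.mem_singleton.1 hb]
    exact (h a ((Finset.mem_sort _).1 ha)).le
  · rw [← Multiset.coe_eq_coe, Finset.sort_eq, ← Multiset.coe_add, Finset.sort_eq,
      Finset.insert_val_of_notMem hr, add_comm]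
    rfl

theorem wtRanks_append (N r : ℕ) : ∀ l : List ℕ, l ≠ [] →
    wtRanks N (l ++ [r]) = wtRanks r l * vb * (va - vb) ^ (N - 1 - r)
  | [], h => absurd rfl h
  | [t], _ => by simp [wtRanks, Nat.sub_right_comm]
  | t :: u :: l, _ => by
    have ih := wtRanks_append N r (u :: l) (by simp)
    simp only [List.cons_append] at ih
    simp only [List.cons_append, wtRanks, ih]
    simp only [mul_assoc]

section ChainSums

variable {P : Type u} [Fintype P] [PartialOrder P] [OrderBot P] (rk : P → ℕ)

/-- The sum of the weights of the chains of `S`, with a maximal element of rank `N` adjoined. -/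
def chainGen (S : Set P) (N : ℕ) : NC :=
  ∑ y : Finset P, if chainIn S ⊥ y then wtRanks N ((y.image rk).sort (· ≤ ·)) else 0

/-- The sum of the weights of the chains with greatest element `x`, each with a final `b` in
place of the terminal power of `a - b`. -/
def chainTo (x : P) : NC := if x = ⊥ then 1 else chainGen rk (Set.Iio x) (rk x) * vb

variable {rk}

omit [Fintype P] in
theorem chainIn.exists_isGreatest {S : Set P} {y : Finset P} (h : chainIn S ⊥ y) :
    ∃ x, IsGreatest (y : Set P) x := by
  obtain ⟨x, hx, hmax⟩ := y.exists_maximal ⟨⊥, h.1⟩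
  refine ⟨x, hx, fun t ht => ?_⟩
  by_cases htx : t = x
  · exact htx.le
  · rcases h.2.2 ht hx htx with h' | h'
    · exact h'.le
    · exact hmax ht h'.le

theorem chainGen_eq (hrk : StrictMono rk) {L : Set P} (hL : IsLowerSet L) (hb : ⊥ ∈ L) (N : ℕ) :
    chainGen rk L N = ∑ x, if x ∈ L then chainTo rk x * (va - vb) ^ (N - 1 - rk x) else 0 := by
  have h1 : ∀ y : Finset P,
      (if chainIn L ⊥ y then wtRanks N ((y.image rk).sort (· ≤ ·)) else 0)
        = ∑ x, if IsGreatest (y : Set P) x ∧ chainIn L ⊥ y then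
            wtRanks N ((y.image rk).sort (· ≤ ·)) else 0 := by
    intro y
    by_cases hy : chainIn L ⊥ y
    · obtain ⟨x, hx⟩ := hy.exists_isGreatest
      rw [Finset.sum_eq_single x]
      · simp [hy, hx]
      · intro x' _ hx'
        rw [if_neg]
        exact fun h => hx' (h.1.unique hx)
      · simp
    · simp [hy]
  rw [chainGen, Finset.sum_congr rfl fun y _ => h1 y, Finset.sum_comm]
  refine Finset.sum_congr rfl fun x _ => ?_
  by_cases hxL : x ∈ L
  swap
  · rw [if_neg hxL]
    refine Finset.sum_eq_zero fun y _ => if_neg ?_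
    exact fun h => hxL (h.2.2.1 h.1.1)
  rw [if_pos hxL]
  by_cases hx : x = ⊥
  · subst hx
    rw [Finset.sum_eq_single {⊥}]
    · rw [if_pos]
      · simp [chainTo, wtRanks]
      · simp [chainIn, hb]
    · intro y _ hy
      rw [if_neg]
      rintro ⟨h, h'⟩
      refine hy (Finset.eq_singleton_iff_unique_mem.2 ⟨h'.1, fun t ht => ?_⟩)
      exact le_bot_iff.1 (h.2 ht)
    · simp
  · rw [chainTo, if_neg hx, chainGen, Finset.sum_mul, Finset.sum_mul, ← Finset.sum_filter]
    have h2 : ∀ y : Finset P, (if chainIn (Set.Iio x) ⊥ y then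
        wtRanks (rk x) ((y.image rk).sort (· ≤ ·)) else 0) * vb * (va - vb) ^ (N - 1 - rk x)
        = if chainIn (Set.Iio x) ⊥ y then
            wtRanks N (((insert x y).image rk).sort (· ≤ ·)) else 0 := by
      intro y
      by_cases hy : chainIn (Set.Iio x) ⊥ y
      · rw [if_pos hy, if_pos hy, Finset.image_insert, sort_insert_max, wtRanks_append]
        · intro h0
          have : rk ⊥ ∈ (y.image rk).sort (· ≤ ·) :=
            (Finset.mem_sort _).2 (Finset.mem_image_of_mem _ hy.1)
          rw [h0] at this
          simp at this
        · intro t ht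
          obtain ⟨u, hu, rfl⟩ := Finset.mem_image.1 ht
          exact hrk (hy.2.1 hu)
      · simp [hy]
    rw [Finset.sum_congr rfl fun y _ => h2 y, ← Finset.sum_filter]
    have hins : ∀ y : Finset P, chainIn (Set.Iio x) ⊥ y → x ∉ y := fun y hy hxy =>
      lt_irrefl x (hy.2.1 hxy)
    refine Finset.sum_nbij' (fun y => y.erase x) (fun y => insert x y) ?_ ?_ ?_ ?_ ?_
    · simp only [Finset.mem_filter, Finset.mem_univ, true_and]
      rintro y ⟨hg, h1, h2, h3⟩
      refine ⟨Finset.mem_erase.2 ⟨Ne.symm hx, h1⟩, fun t ht => ?_, h3.mono (by simp)⟩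
      have := Finset.mem_erase.1 (Finset.mem_coe.1 ht)
      exact lt_of_le_of_ne (hg.2 this.2) this.1
    · simp only [Finset.mem_filter, Finset.mem_univ, true_and]
      rintro y ⟨h1, h2, h3⟩
      refine ⟨⟨by simp, fun t ht => ?_⟩, Finset.mem_insert_of_mem h1, fun t ht => ?_, ?_⟩
      · rcases Finset.mem_insert.1 (Finset.mem_coe.1 ht) with rfl | h
        exacts [le_rfl, (h2 h).le]
      · rcases Finset.mem_insert.1 (Finset.mem_coe.1 ht) with rfl | h
        exacts [hxL, hL (h2 h).le hxL]
      · rw [Finset.coe_insert]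
        exact h3.insert fun t ht _ => Or.inr (h2 ht)
    · simp only [Finset.mem_filter, Finset.mem_univ, true_and]
      rintro y ⟨hg, -⟩
      exact Finset.insert_erase hg.1
    · simp only [Finset.mem_filter, Finset.mem_univ, true_and]
      intro y hy
      exact Finset.erase_insert (hins y hy)
    · simp only [Finset.mem_filter, Finset.mem_univ, true_and]
      rintro y ⟨hg, -⟩
      rw [Finset.insert_erase hg.1]

end ChainSums

end

section

theorem exists_of_finrank_eq_one {V : Type*} [AddCommGroup V] [Module ℝ V] {K : Submodule ℝ V}
    (h : Module.finrank ℝ K = 1) :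
    ∃ v ∈ K, v ≠ 0 ∧ ∀ w ∈ K, ∃ t : ℝ, w = t • v := by
  obtain ⟨⟨v, hv⟩, hne, hall⟩ := finrank_eq_one_iff'.1 h
  refine ⟨v, hv, fun h0 => hne (Subtype.ext h0), fun w hw => ?_⟩
  obtain ⟨t, ht⟩ := hall ⟨w, hw⟩
  exact ⟨t, (congrArg Subtype.val ht).symm⟩

namespace OrderComplex

variable {P : Type u} [PartialOrder P]

/-- The sign with which `σ` enters the chain `y`. -/
def sgn (y : Finset P) (σ : P) : ℝ := (-1) ^ (y.filter fun τ => τ < σ).card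

theorem sgn_insert {y : Finset P} {σ τ : P} (hσ : σ ∉ y) :
    sgn (insert σ y) τ = (if σ < τ then -1 else 1) * sgn y τ := by
  rw [sgn, sgn, Finset.filter_insert]
  split_ifs with h
  · rw [Finset.card_insert_of_notMem (by simp [hσ]), pow_succ]; ring
  · rw [one_mul]

theorem sgn_insert_self (y : Finset P) (σ : P) : sgn (insert σ y) σ = sgn y σ := by
  rw [sgn, sgn, Finset.filter_insert, if_neg (lt_irrefl _)]

theorem sgn_of_forall_lt {y : Finset P} {σ : P} (h : ∀ τ ∈ y, τ < σ) :
    sgn y σ = (-1) ^ y.card := by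
  rw [sgn, Finset.filter_true_of_mem h]

variable [Fintype P]

/-- The simplicial boundary operator on functions on finite sets. -/
def bd : (Finset P → ℝ) →ₗ[ℝ] (Finset P → ℝ) where
  toFun c y := ∑ σ, if σ ∈ y then 0 else sgn y σ * c (insert σ y)
  map_add' c c' := by
    ext y
    simp only [Pi.add_apply, ← Finset.sum_add_distrib]
    refine Finset.sum_congr rfl fun σ _ => ?_
    split_ifs <;> ring
  map_smul' r c := by
    ext y
    simp only [Pi.smul_apply, smul_eq_mul, RingHom.id_apply, Finset.mul_sum]
    refine Finset.sum_congr rfl fun σ _ => ?_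
    split_ifs <;> ring

theorem bd_apply (c : Finset P → ℝ) (y : Finset P) :
    bd c y = ∑ σ, if σ ∈ y then 0 else sgn y σ * c (insert σ y) := rfl

theorem bd_bd {c : Finset P → ℝ} (hc : ∀ y, c y ≠ 0 → IsChain (· < ·) (y : Set P)) :
    bd (bd c) = 0 := by
  ext y
  set f : P → P → ℝ := fun σ τ => if σ ∈ y ∨ τ ∈ y ∨ τ = σ then 0 else
    sgn y σ * (sgn (insert σ y) τ * c (insert τ (insert σ y))) with hf
  have h1 : bd (bd c) y = ∑ σ, ∑ τ, f σ τ := by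
    rw [bd_apply]
    refine Finset.sum_congr rfl fun σ _ => ?_
    by_cases hσ : σ ∈ y
    · simp [hf, hσ]
    · rw [if_neg hσ, bd_apply, Finset.mul_sum]
      refine Finset.sum_congr rfl fun τ _ => ?_
      by_cases hτ : τ = σ
      · simp [hf, hτ]
      by_cases hτy : τ ∈ y
      · simp [hf, hτy]
      · rw [if_neg (by simp [hτ, hτy])]
        simp only [hf]
        rw [if_neg (by simp [hτ, hτy, hσ])]
  have h2 : ∀ σ τ, f τ σ = - f σ τ := by
    intro σ τ
    simp only [hf]
    by_cases h : σ ∈ y ∨ τ ∈ y ∨ τ = σ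
    · rw [if_pos h, if_pos (by tauto), neg_zero]
    · rw [if_neg h, if_neg (by tauto), Finset.insert_comm]
      push Not at h
      by_cases h0 : c (insert τ (insert σ y)) = 0
      · simp [h0]
      have hch := hc _ h0 (show σ ∈ _ by simp) (show τ ∈ _ by simp) (Ne.symm h.2.2)
      rw [sgn_insert h.1, sgn_insert h.2.1]
      rcases hch with h' | h'
      · rw [if_pos h', if_neg h'.asymm]; ring
      · rw [if_neg h'.asymm, if_pos h']; ring
  have h3 : bd (bd c) y = - bd (bd c) y := by
    conv_lhs => rw [h1, Finset.sum_comm]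
    rw [h1, ← Finset.sum_neg_distrib]
    refine Finset.sum_congr rfl fun σ _ => ?_
    rw [← Finset.sum_neg_distrib]
    exact Finset.sum_congr rfl fun τ _ => h2 _ _
  simp only [Pi.zero_apply]
  linarith

/-- The function `c` is supported on the chains of `L` of cardinality `k` containing `x`. -/
def Supp (L : Set P) (x : Finset P) (k : ℕ) (c : Finset P → ℝ) : Prop :=
  ∀ y, c y ≠ 0 → IsChain (· < ·) (y : Set P) ∧ (y : Set P) ⊆ L ∧ x ⊆ y ∧ y.card = k

/-- The function `c` is a cycle relative to the chain `x`. -/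
def Closed (x : Finset P) (c : Finset P → ℝ) : Prop := ∀ y, x ⊆ y → bd c y = 0

/-- Exactness of the chain complex of `L` relative to `x` at the chains of cardinality `k`. -/
def HEx (L : Set P) (x : Finset P) (k : ℕ) : Prop :=
  ∀ c, Supp L x k c → Closed x c → ∃ e, Supp L x (k + 1) e ∧ ∀ y, x ⊆ y → bd e y = c y

/-- The cycles of cardinality `k` of `L` relative to `x` form a line. -/
def HTop (L : Set P) (x : Finset P) (k : ℕ) : Prop :=
  ∃ o, Supp L x k o ∧ Closed x o ∧ o ≠ 0 ∧ ∀ c, Supp L x k c → Closed x c → ∃ t : ℝ, c = t • o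

omit [Fintype P] in
theorem Supp.add {L : Set P} {x : Finset P} {k : ℕ} {c c' : Finset P → ℝ} (h : Supp L x k c)
    (h' : Supp L x k c') : Supp L x k (c + c') := by
  intro y hy
  by_cases h0 : c y = 0
  · exact h' y fun h1 => hy (by simp [h0, h1])
  · exact h y h0

omit [Fintype P] in
theorem Supp.smul {L : Set P} {x : Finset P} {k : ℕ} {c : Finset P → ℝ} (t : ℝ)
    (h : Supp L x k c) : Supp L x k (t • c) :=
  fun y hy => h y fun h1 => hy (by simp [h1])

theorem bd_ne_zero {c : Finset P → ℝ} {y : Finset P} (h : bd c y ≠ 0) :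
    ∃ σ, σ ∉ y ∧ c (insert σ y) ≠ 0 := by
  by_contra! h'
  refine h (Finset.sum_eq_zero fun σ _ => ?_)
  split_ifs with hσ
  · rfl
  · rw [h' σ hσ, mul_zero]

theorem Supp.bd {L : Set P} {x : Finset P} {k : ℕ} {c : Finset P → ℝ}
    (h : Supp L x (k + 1) c) {y : Finset P} (hx : x ⊆ y) (hy : OrderComplex.bd c y ≠ 0) :
    IsChain (· < ·) (y : Set P) ∧ (y : Set P) ⊆ L ∧ x ⊆ y ∧ y.card = k := by
  obtain ⟨σ, hσ, hc⟩ := bd_ne_zero hy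
  obtain ⟨h1, h2, -, h4⟩ := h _ hc
  have hsub : (y : Set P) ⊆ ((insert σ y : Finset P) : Set P) := by
    exact_mod_cast Finset.subset_insert σ y
  refine ⟨h1.mono hsub, hsub.trans h2, hx, ?_⟩
  rw [Finset.card_insert_of_notMem hσ] at h4
  omega

section Comparison

variable [OrderBot P] {L : Set P} {x : Finset P} {k : ℕ}

omit [Fintype P] in
theorem mem_cellSpace (hx : ⊥ ∈ x) (f : Finset P →₀ ℝ) :
    f ∈ cellSpace L ⊥ x k ↔ Supp L x k f := by
  constructor
  · intro hf
    induction hf using Submodule.span_induction with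
    | mem f hf =>
      obtain ⟨y, h1, h2, h3, rfl⟩ := hf
      intro z hz
      have : y = z := by
        by_contra h
        exact hz (Finsupp.single_eq_of_ne' h)
      subst this
      exact ⟨h1.2.2, h1.2.1, h2, h3⟩
    | zero => intro z hz; simp at hz
    | add f g _ _ hf hg => rw [Finsupp.coe_add]; exact hf.add hg
    | smul t f _ hf => rw [Finsupp.coe_smul]; exact hf.smul t
  · intro hf
    rw [← f.sum_single]
    refine Submodule.sum_mem _ fun y hy => ?_
    obtain ⟨h1, h2, h3, h4⟩ := hf y (Finsupp.mem_support_iff.1 hy)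
    have : Finsupp.single y (f y) = f y • Finsupp.single y (1 : ℝ) := by simp
    rw [this]
    exact Submodule.smul_mem _ _ (Submodule.subset_span ⟨y, ⟨h3 hx, h2, h1⟩, h3, h4, rfl⟩)

omit [OrderBot P] in
theorem bnd_single_apply (y z : Finset P) :
    bnd x (Finsupp.single y (1 : ℝ)) z
      = ∑ σ, if σ ∈ z ∨ σ ∈ x then 0 else sgn z σ * Finsupp.single y (1 : ℝ) (insert σ z) := by
  rw [bnd, Finsupp.lsum_single]
  simp only [LinearMap.smulRight_apply, LinearMap.id_apply, one_smul, Finsupp.finsetSum_apply,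
    Finsupp.smul_apply, smul_eq_mul]
  rw [← Finset.sum_filter_add_sum_filter_not Finset.univ (fun σ => σ ∈ y \ x)]
  rw [Finset.sum_eq_zero (s := Finset.univ.filter fun σ => ¬ σ ∈ y \ x), add_zero]
  · rw [Finset.filter_mem_eq_inter, Finset.univ_inter]
    refine Finset.sum_congr rfl fun σ hσ => ?_
    rw [Finset.mem_sdiff] at hσ
    by_cases hz : σ ∈ z
    · rw [if_pos (Or.inl hz), Finsupp.single_eq_of_ne, mul_zero]
      rintro rfl
      simp at hz
    · rw [if_neg (by tauto)]
      by_cases h : y.erase σ = z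
      · subst h
        rw [Finset.insert_erase hσ.1, Finsupp.single_eq_same, Finsupp.single_eq_same]
        rw [← sgn_insert_self, Finset.insert_erase hσ.1, sgn]
      · rw [Finsupp.single_eq_of_ne' h, Finsupp.single_eq_of_ne', mul_zero, mul_zero]
        rintro rfl
        exact h (Finset.erase_insert hz)
  · intro σ hσ
    simp only [Finset.mem_filter, Finset.mem_univ, true_and, Finset.mem_sdiff, not_and,
      not_not] at hσ
    split_ifs with h
    · rfl
    · push Not at h
      rw [Finsupp.single_eq_of_ne', mul_zero]
      rintro rfl
      exact h.2 (hσ (by simp))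

omit [OrderBot P] in
theorem bnd_apply_eq (f : Finset P →₀ ℝ) (z : Finset P) :
    bnd x f z = ∑ σ, if σ ∈ z ∨ σ ∈ x then 0 else sgn z σ * f (insert σ z) := by
  induction f using Finsupp.induction_linear with
  | zero => simp
  | add f g hf hg =>
    rw [map_add, Finsupp.add_apply, hf, hg, ← Finset.sum_add_distrib]
    refine Finset.sum_congr rfl fun σ _ => ?_
    split_ifs
    · simp
    · rw [Finsupp.add_apply, mul_add]
  | single y t =>
    have : Finsupp.single y t = t • Finsupp.single y (1 : ℝ) := by simp
    rw [this, map_smul, Finsupp.smul_apply, bnd_single_apply, smul_eq_mul, Finset.mul_sum]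
    refine Finset.sum_congr rfl fun σ _ => ?_
    split_ifs
    · simp
    · rw [Finsupp.smul_apply, smul_eq_mul]; ring

omit [OrderBot P] in
theorem bnd_apply_of_subset (f : Finset P →₀ ℝ) {z : Finset P} (h : x ⊆ z) :
    bnd x f z = bd f z := by
  rw [bnd_apply_eq, bd_apply]
  refine Finset.sum_congr rfl fun σ _ => ?_
  have : (σ ∈ z ∨ σ ∈ x) ↔ σ ∈ z := ⟨fun h' => h'.elim id (@h σ), Or.inl⟩
  simp only [this]

omit [OrderBot P] in
theorem bnd_apply_of_not_subset {f : Finset P →₀ ℝ} (hf : Supp L x k f) {z : Finset P}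
    (h : ¬ x ⊆ z) : bnd x f z = 0 := by
  rw [bnd_apply_eq]
  refine Finset.sum_eq_zero fun σ _ => ?_
  split_ifs with h'
  · rfl
  · push Not at h'
    by_cases h0 : f (insert σ z) = 0
    · rw [h0, mul_zero]
    · exfalso
      refine h fun τ hτ => ?_
      rcases Finset.mem_insert.1 ((hf _ h0).2.2.1 hτ) with rfl | h1
      · exact absurd hτ h'.2
      · exact h1

omit [OrderBot P] in
theorem mem_ker_bnd {f : Finset P →₀ ℝ} (hf : Supp L x k f) :
    f ∈ LinearMap.ker (bnd x) ↔ Closed x f := by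
  rw [LinearMap.mem_ker]
  constructor
  · intro h y hy
    rw [← bnd_apply_of_subset f hy, h]; rfl
  · intro h
    ext y
    by_cases hy : x ⊆ y
    · rw [bnd_apply_of_subset f hy, h y hy]; rfl
    · rw [bnd_apply_of_not_subset hf hy]; rfl

theorem map_bnd_le (hx : ⊥ ∈ x) :
    Submodule.map (bnd x) (cellSpace L ⊥ x (k + 1))
      ≤ LinearMap.ker (bnd x) ⊓ cellSpace L ⊥ x k := by
  rintro _ ⟨f, hf, rfl⟩
  have hf' := (mem_cellSpace hx f).1 hf
  have hs : Supp L x k (bnd x f) := by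
    intro y hy
    by_cases hxy : x ⊆ y
    · rw [bnd_apply_of_subset f hxy] at hy
      exact hf'.bd hxy hy
    · exact absurd (bnd_apply_of_not_subset hf' hxy) hy
  refine ⟨(mem_ker_bnd hs).2 fun y hy => ?_, (mem_cellSpace hx _).2 hs⟩
  have : bd (bnd x f) y = bd (bd f) y := by
    rw [bd_apply, bd_apply]
    refine Finset.sum_congr rfl fun σ _ => ?_
    rw [bnd_apply_of_subset f (hy.trans (Finset.subset_insert _ _))]
  rw [this, bd_bd fun y hy => (hf' y hy).1]
  rfl

theorem HEx_of_finrank (hx : ⊥ ∈ x)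
    (h : Module.finrank ℝ ↥(LinearMap.ker (bnd x) ⊓ cellSpace L ⊥ x k) =
      Module.finrank ℝ ↥(Submodule.map (bnd x) (cellSpace L ⊥ x (k + 1)))) : HEx L x k := by
  have heq := Submodule.eq_of_le_of_finrank_eq (map_bnd_le hx) h.symm
  intro c hc hcl
  let f := Finsupp.equivFunOnFinite.symm c
  have hf : (f : Finset P → ℝ) = c := rfl
  have hmem : f ∈ LinearMap.ker (bnd x) ⊓ cellSpace L ⊥ x k :=
    ⟨(mem_ker_bnd (L := L) (k := k) hc).2 hcl, (mem_cellSpace hx f).2 hc⟩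
  rw [← heq] at hmem
  obtain ⟨e, he, hef⟩ := hmem
  refine ⟨e, (mem_cellSpace hx e).1 he, fun y hy => ?_⟩
  rw [← bnd_apply_of_subset e hy, hef, hf]

theorem HTop_of_finrank (hx : ⊥ ∈ x)
    (h : Module.finrank ℝ ↥(LinearMap.ker (bnd x) ⊓ cellSpace L ⊥ x k) =
      Module.finrank ℝ ↥(Submodule.map (bnd x) (cellSpace L ⊥ x (k + 1))) + 1)
    (hL : ∀ y : Finset P, IsChain (· < ·) (y : Set P) → (y : Set P) ⊆ L → y.card ≤ k) :
    HTop L x k := by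
  have h0 : cellSpace L ⊥ x (k + 1) = ⊥ := by
    rw [eq_bot_iff]
    intro f hf
    rw [mem_cellSpace hx] at hf
    rw [Submodule.mem_bot]
    ext y
    by_contra hy
    obtain ⟨h1, h2, -, h4⟩ := hf y hy
    have := hL y h1 h2
    omega
  rw [h0, Submodule.map_bot, finrank_bot, zero_add] at h
  obtain ⟨o, ⟨ho1, ho2⟩, hne, hall⟩ := exists_of_finrank_eq_one h
  have ho3 := (mem_cellSpace hx o).1 ho2
  refine ⟨o, ho3, (mem_ker_bnd ho3).1 ho1, fun h => hne ?_, fun c hc hcl => ?_⟩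
  · ext y; simpa using congrFun h y
  · obtain ⟨t, ht⟩ := hall (Finsupp.equivFunOnFinite.symm c)
      ⟨(mem_ker_bnd (L := L) (k := k) hc).2 hcl, (mem_cellSpace hx _).2 hc⟩
    exact ⟨t, congrArg (fun v : Finset P →₀ ℝ => (v : Finset P → ℝ)) ht⟩

end Comparison

end OrderComplex

end

section

/-- A rank function on a poset with bottom, increasing by one along covers. -/
structure Ranking (P : Type u) [PartialOrder P] [OrderBot P] where
  ρ : P → ℕ
  bot : ρ ⊥ = 0
  mono : StrictMono ρ
  cov : ∀ x y, x < y → ∃ z, x < z ∧ z ≤ y ∧ ρ z = ρ x + 1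

namespace Ranking

open OrderComplex

variable {P : Type u} [PartialOrder P] [OrderBot P] (R : Ranking P)

/-- The chain `y` is saturated in the interval below its greatest element `p`. -/
def Sat (y : Finset P) (p : P) : Prop :=
  IsChain (· < ·) (y : Set P) ∧ p ∈ y ∧ (∀ t ∈ y, t ≤ p) ∧ y.card = R.ρ p + 1

variable {R}

theorem eq_of_rank {Y : Finset P} (hY : IsChain (· < ·) (Y : Set P)) {a b : P} (ha : a ∈ Y)
    (hb : b ∈ Y) (h : R.ρ a = R.ρ b) : a = b := by
  by_contra hne
  rcases hY ha hb hne with h' | h'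
  · exact h.not_lt (R.mono h')
  · exact h.not_gt (R.mono h')

theorem lt_of_rank {Y : Finset P} (hY : IsChain (· < ·) (Y : Set P)) {a b : P} (ha : a ∈ Y)
    (hb : b ∈ Y) (h : R.ρ a < R.ρ b) : a < b := by
  have hne : a ≠ b := by rintro rfl; exact lt_irrefl _ h
  rcases hY ha hb hne with h' | h'
  · exact h'
  · exact absurd (R.mono h') h.asymm

theorem card_add_le {Y : Finset P} (hY : IsChain (· < ·) (Y : Set P)) {m N : ℕ}
    (h : ∀ t ∈ Y, m ≤ R.ρ t ∧ R.ρ t < N) (hmN : m ≤ N) : Y.card + m ≤ N := by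
  have h1 : Y.card ≤ (Finset.Ico m N).card :=
    Finset.card_le_card_of_injOn R.ρ (fun t ht => by simpa using h t ht)
      fun a ha b hb hab => eq_of_rank hY ha hb hab
  rw [Nat.card_Ico] at h1
  omega

theorem exists_rank_of_card {Y : Finset P} (hY : IsChain (· < ·) (Y : Set P)) {m N : ℕ}
    (h : ∀ t ∈ Y, m ≤ R.ρ t ∧ R.ρ t < N) (hc : N ≤ Y.card + m) {r : ℕ} (hr : m ≤ r)
    (hrN : r < N) : ∃ t ∈ Y, R.ρ t = r := by
  have h1 : Y.image R.ρ = Finset.Ico m N := by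
    refine Finset.eq_of_subset_of_card_le (fun s hs => ?_) ?_
    · obtain ⟨t, ht, rfl⟩ := Finset.mem_image.1 hs
      simpa using h t ht
    · rw [Finset.card_image_of_injOn fun a ha b hb hab => eq_of_rank hY ha hb hab, Nat.card_Ico]
      omega
  have : r ∈ Y.image R.ρ := by rw [h1]; simp [hr, hrN]
  simpa using this

theorem card_le {Y : Finset P} (hY : IsChain (· < ·) (Y : Set P)) {N : ℕ}
    (h : ∀ t ∈ Y, R.ρ t < N) : Y.card ≤ N := by
  simpa using card_add_le (m := 0) hY (fun t ht => ⟨Nat.zero_le _, h t ht⟩) (Nat.zero_le _)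

theorem exists_sat_of_card {Y : Finset P} (hY : IsChain (· < ·) (Y : Set P)) {r : ℕ}
    (h : ∀ t ∈ Y, R.ρ t ≤ r) (hc : Y.card = r + 1) : ∃ x, R.Sat Y x ∧ R.ρ x = r := by
  obtain ⟨x, hx, hxr⟩ := exists_rank_of_card (m := 0) (N := r + 1) hY
    (fun t ht => ⟨Nat.zero_le _, Nat.lt_succ_of_le (h t ht)⟩) (by omega) (Nat.zero_le r)
    (Nat.lt_succ_self r)
  refine ⟨x, ⟨hY, hx, fun t ht => ?_, by rw [hc, hxr]⟩, hxr⟩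
  rcases (h t ht).eq_or_lt with h' | h'
  · exact (eq_of_rank hY ht hx (h'.trans hxr.symm)).le
  · exact (lt_of_rank hY ht hx (hxr ▸ h')).le

omit [OrderBot P] in
theorem isChain_insert {Y : Finset P} (hY : IsChain (· < ·) (Y : Set P)) {σ : P}
    (h : ∀ t ∈ Y, t < σ) : IsChain (· < ·) ((insert σ Y : Finset P) : Set P) := by
  rw [Finset.coe_insert]
  exact hY.insert fun t ht _ => Or.inr (h t ht)

omit [OrderBot P] in
theorem isChain_mono {Y Y' : Finset P} (hY : IsChain (· < ·) (Y : Set P)) (h : Y' ⊆ Y) :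
    IsChain (· < ·) (Y' : Set P) := hY.mono (by exact_mod_cast h)

namespace Sat

variable {y : Finset P} {p : P} (h : R.Sat y p)

include h

theorem exists_rank {r : ℕ} (hr : r ≤ R.ρ p) : ∃ t ∈ y, R.ρ t = r :=
  exists_rank_of_card (m := 0) (N := R.ρ p + 1) h.1
    (fun t ht => ⟨Nat.zero_le _, Nat.lt_succ_of_le (R.mono.monotone (h.2.2.1 t ht))⟩)
    h.2.2.2.ge (Nat.zero_le r) (by omega)

theorem bot_mem : ⊥ ∈ y := by
  obtain ⟨t, ht, h0⟩ := h.exists_rank (Nat.zero_le _)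
  have : t = ⊥ := by
    by_contra hne
    have := R.mono (bot_lt_iff_ne_bot.2 hne)
    omega
  rwa [← this]

theorem lt_of_notMem {Y : Finset P} (hY : IsChain (· < ·) (Y : Set P)) (hyY : y ⊆ Y) {σ : P}
    (hσ : σ ∈ Y) (hσy : σ ∉ y) : p < σ := by
  by_contra hlt
  have hle : R.ρ σ ≤ R.ρ p := by
    by_contra h'
    exact hlt (lt_of_rank (R := R) hY (hyY h.2.1) hσ (by omega))
  obtain ⟨t, ht, hr⟩ := h.exists_rank hle
  rw [eq_of_rank hY (hyY ht) hσ hr] at ht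
  exact hσy ht

theorem insert_sat {z : P} (hz : p < z) (hr : R.ρ z = R.ρ p + 1) : R.Sat (insert z y) z := by
  have hlt : ∀ t ∈ y, t < z := fun t ht => (h.2.2.1 t ht).trans_lt hz
  refine ⟨isChain_insert h.1 hlt, by simp, fun t ht => ?_, ?_⟩
  · rcases Finset.mem_insert.1 ht with rfl | ht
    exacts [le_rfl, (hlt t ht).le]
  · rw [Finset.card_insert_of_notMem fun hz => lt_irrefl _ (hlt z hz), h.2.2.2, hr]

theorem exists_extend {q : P} (hpq : p ≤ q) : ∃ y', R.Sat y' q ∧ y ⊆ y' := by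
  obtain ⟨d, hd⟩ : ∃ d, R.ρ q = R.ρ p + d :=
    Nat.exists_eq_add_of_le (R.mono.monotone hpq)
  induction d generalizing p y with
  | zero =>
    have : p = q := by
      by_contra hne
      have := R.mono (lt_of_le_of_ne hpq hne)
      omega
    subst this
    exact ⟨y, h, subset_rfl⟩
  | succ d ih =>
    have hlt : p < q := lt_of_le_of_ne hpq (by rintro rfl; omega)
    obtain ⟨z, h1, h2, h3⟩ := R.cov p q hlt
    obtain ⟨y', h4, h5⟩ := ih (h.insert_sat h1 h3) h2 (by omega)
    exact ⟨y', h4, (Finset.subset_insert _ _).trans h5⟩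

end Sat

theorem sat_bot : R.Sat {⊥} ⊥ := ⟨by simp, by simp, by simp, by simp [R.bot]⟩

theorem exists_sat (p : P) : ∃ y, R.Sat y p :=
  let ⟨y, h, _⟩ := (sat_bot (R := R)).exists_extend (bot_le (a := p))
  ⟨y, h⟩

theorem exists_upper {q m : P} (h : q ≤ m) : ∃ u : Finset P, IsChain (· < ·) (u : Set P) ∧
    q ∈ u ∧ m ∈ u ∧ (∀ t ∈ u, q ≤ t ∧ t ≤ m) ∧ u.card + R.ρ q = R.ρ m + 1 := by
  obtain ⟨y, hy⟩ := R.exists_sat q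
  obtain ⟨Y, hY, hyY⟩ := hy.exists_extend h
  have hsd : Y \ y ⊆ Y := Finset.sdiff_subset
  refine ⟨insert q (Y \ y), isChain_mono hY.1 (Finset.insert_subset (hyY hy.2.1) hsd), by simp,
    ?_, ?_, ?_⟩
  · by_cases hmy : m ∈ y
    · rw [le_antisymm h (hy.2.2.1 m hmy)]; simp
    · exact Finset.mem_insert_of_mem (Finset.mem_sdiff.2 ⟨hY.2.1, hmy⟩)
  · intro t ht
    rcases Finset.mem_insert.1 ht with rfl | ht
    · exact ⟨le_rfl, h⟩
    · rw [Finset.mem_sdiff] at ht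
      exact ⟨(hy.lt_of_notMem hY.1 hyY ht.1 ht.2).le, hY.2.2.1 t ht.1⟩
  · rw [Finset.card_insert_of_notMem (by simp [hy.2.1]), Finset.card_sdiff_of_subset hyY,
      hY.2.2.2, hy.2.2.2]
    have := R.mono.monotone h
    omega

end Ranking

namespace OrderComplex

variable {P : Type u} [PartialOrder P]

/-- The part of `c` in the link of `u`, restricted to the chains below `q`. -/
def link (q : P) (u : Finset P) (c : Finset P → ℝ) (y : Finset P) : ℝ :=
  if ∀ t ∈ y, t < q then c (y ∪ u) else 0

/-- The function on the star of `u` induced by a function on its link. -/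
def lift (u : Finset P) (c : Finset P → ℝ) (y : Finset P) : ℝ :=
  if u ⊆ y then c (y \ u) else 0

theorem link_eq {q : P} {u : Finset P} {c : Finset P → ℝ} {y : Finset P} (h : ∀ t ∈ y, t < q) :
    link q u c y = c (y ∪ u) := if_pos h

theorem sgn_union {q : P} {u y : Finset P} (hu : ∀ t ∈ u, q ≤ t) {σ : P} (hσ : σ < q) :
    sgn (y ∪ u) σ = sgn y σ := by
  rw [sgn, sgn, Finset.filter_union, Finset.filter_false_of_mem (s := u), Finset.union_empty]
  exact fun t ht htσ => lt_irrefl _ ((htσ.trans hσ).trans_le (hu t ht))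

variable [Fintype P]

theorem bd_link {q : P} {u : Finset P} {c : Finset P → ℝ} {y : Finset P} (hu : ∀ t ∈ u, q ≤ t)
    (hy : ∀ t ∈ y, t < q)
    (h : ∀ σ, σ ∉ y ∪ u → ¬ σ < q → c (insert σ (y ∪ u)) = 0) :
    bd (link q u c) y = bd c (y ∪ u) := by
  rw [bd_apply, bd_apply]
  refine Finset.sum_congr rfl fun σ _ => ?_
  by_cases hσy : σ ∈ y
  · rw [if_pos hσy, if_pos (Finset.mem_union_left _ hσy)]
  · rw [if_neg hσy]
    by_cases hσ : σ < q
    · have : σ ∉ u := fun hσu => lt_irrefl _ (hσ.trans_le (hu σ hσu))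
      rw [if_neg (by simp [hσy, this]), link_eq, sgn_union hu hσ, Finset.insert_union]
      intro t ht
      rcases Finset.mem_insert.1 ht with rfl | ht
      exacts [hσ, hy t ht]
    · rw [link, if_neg fun h' => hσ (h' σ (by simp)), mul_zero]
      split_ifs with hm
      · rfl
      · rw [h σ hm hσ, mul_zero]

theorem bd_link_of_not {q : P} {u : Finset P} {c : Finset P → ℝ} {y : Finset P}
    (hy : ¬ ∀ t ∈ y, t < q) : bd (link q u c) y = 0 := by
  by_contra h
  obtain ⟨σ, -, hσ⟩ := bd_ne_zero h
  refine hσ (if_neg fun h' => hy fun t ht => h' t (Finset.mem_insert_of_mem ht))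

section Transfer

variable {S : Set P} {q : P} {u x : Finset P} {k : ℕ}
  (hu : ∀ t ∈ u, q ≤ t) (hx : ∀ t ∈ x, t < q)

omit [Fintype P] in
include hu hx in
theorem Supp.link {c : Finset P → ℝ} (hc : Supp S (x ∪ u) (k + u.card) c) :
    Supp (Set.Iio q) x k (link q u c) := by
  intro y hy
  by_cases hyq : ∀ t ∈ y, t < q
  · rw [link_eq hyq] at hy
    obtain ⟨h1, h2, h3, h4⟩ := hc _ hy
    have hdis : Disjoint y u := Finset.disjoint_left.2 fun t ht ht' =>
      lt_irrefl _ ((hyq t ht).trans_le (hu t ht'))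
    refine ⟨Ranking.isChain_mono h1 Finset.subset_union_left, hyq, fun t ht => ?_, ?_⟩
    · rcases Finset.mem_union.1 (h3 (Finset.mem_union_left _ ht)) with h | h
      · exact h
      · exact absurd ((hx t ht).trans_le (hu t h)) (lt_irrefl _)
    · rw [Finset.card_union_of_disjoint hdis] at h4
      omega
  · exact absurd (if_neg hyq) hy

omit [Fintype P] in
include hu in
theorem link_lift {c : Finset P → ℝ} (hc : Supp (Set.Iio q) x k c) : link q u (lift u c) = c := by
  ext y
  by_cases hyq : ∀ t ∈ y, t < q
  · rw [link_eq hyq, lift, if_pos Finset.subset_union_right, Finset.union_sdiff_right]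
    rw [Finset.sdiff_eq_self_of_disjoint]
    exact Finset.disjoint_left.2 fun t ht ht' => lt_irrefl _ ((hyq t ht).trans_le (hu t ht'))
  · rw [link, if_neg hyq]
    by_contra h
    exact hyq fun t ht => (hc y (Ne.symm h)).2.1 ht

variable (huS : (u : Set P) ⊆ S) (hqS : Set.Iio q ⊆ S) (huc : IsChain (· < ·) (u : Set P))

omit [Fintype P] in
include hu huS hqS huc in
theorem Supp.lift {c : Finset P → ℝ} (hc : Supp (Set.Iio q) x k c) :
    Supp S (x ∪ u) (k + u.card) (lift u c) := by
  intro Y hY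
  by_cases hsub : u ⊆ Y
  swap
  · exact absurd (if_neg hsub) hY
  rw [OrderComplex.lift, if_pos hsub] at hY
  obtain ⟨h1, h2, h3, h4⟩ := hc _ hY
  have hYu : (Y \ u) ∪ u = Y := Finset.sdiff_union_of_subset hsub
  refine ⟨?_, ?_, ?_, ?_⟩
  · rw [← hYu, Finset.coe_union]
    intro a ha b hb hab
    rcases ha with ha | ha <;> rcases hb with hb | hb
    · exact h1 ha hb hab
    · exact Or.inl ((h2 ha).trans_le (hu b hb))
    · exact Or.inr ((h2 hb).trans_le (hu a ha))
    · exact huc ha hb hab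
  · rw [← hYu, Finset.coe_union]
    exact Set.union_subset (h2.trans hqS) huS
  · rw [← hYu]
    exact Finset.union_subset_union h3 subset_rfl
  · rw [← hYu, Finset.card_union_of_disjoint Finset.sdiff_disjoint, h4]

variable (hsat : ∀ Y : Finset P, IsChain (· < ·) (Y : Set P) → (Y : Set P) ⊆ S → u ⊆ Y →
  ∀ σ ∈ Y, σ ∉ u → σ < q)

include hu hsat in
theorem bd_link_of_supp {c : Finset P → ℝ} (hc : Supp S (x ∪ u) k c) {y : Finset P}
    (hy : ∀ t ∈ y, t < q) : bd (link q u c) y = bd c (y ∪ u) := by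
  refine bd_link hu hy fun σ hσ hσq => ?_
  by_contra h0
  obtain ⟨h1, h2, h3, -⟩ := hc _ h0
  refine hσq (hsat _ h1 h2 ?_ σ (by simp) fun h => hσ (Finset.mem_union_right _ h))
  exact Finset.subset_union_right.trans h3

include hu hsat in
theorem Closed.link {c : Finset P → ℝ} (hc : Supp S (x ∪ u) k c) (hcl : Closed (x ∪ u) c) :
    Closed x (link q u c) := by
  intro y hxy
  by_cases hyq : ∀ t ∈ y, t < q
  · rw [bd_link_of_supp hu hsat hc hyq]
    exact hcl _ (Finset.union_subset_union hxy subset_rfl)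
  · exact bd_link_of_not hyq

include hu hx huS hqS huc hsat in
theorem Closed.lift {c : Finset P → ℝ} (hc : Supp (Set.Iio q) x k c) (hcl : Closed x c) :
    Closed (x ∪ u) (lift u c) := by
  intro Y hY
  by_contra h0
  have hs := hc.lift hu huS hqS huc
  obtain ⟨σ, hσ, h1⟩ := bd_ne_zero h0
  obtain ⟨h2, h3, -, -⟩ := hs _ h1
  have huY : u ⊆ Y := Finset.subset_union_right.trans hY
  have hlt : ∀ t ∈ Y \ u, t < q := fun t ht => hsat _ h2 h3
    (huY.trans (Finset.subset_insert _ _)) t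
    (Finset.mem_insert_of_mem (Finset.mem_sdiff.1 ht).1) (Finset.mem_sdiff.1 ht).2
  have h4 := bd_link_of_supp hu hsat hs hlt
  rw [link_lift hu hc, Finset.sdiff_union_of_subset huY] at h4
  rw [← h4] at h0
  refine h0 (hcl _ fun t ht => Finset.mem_sdiff.2 ⟨hY (Finset.mem_union_left _ ht), fun h => ?_⟩)
  exact lt_irrefl _ ((hx t ht).trans_le (hu t h))

include hu hx huS hqS huc hsat in
theorem HEx.transfer (h : HEx S (x ∪ u) (k + u.card)) : HEx (Set.Iio q) x k := by
  intro c hc hcl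
  obtain ⟨e, he, hec⟩ := h _ (hc.lift hu huS hqS huc)
    (hcl.lift hu hx huS hqS huc hsat hc)
  rw [add_right_comm] at he
  refine ⟨OrderComplex.link q u e, he.link hu hx, fun y hxy => ?_⟩
  by_cases hyq : ∀ t ∈ y, t < q
  · rw [bd_link_of_supp hu hsat he hyq, hec _ (Finset.union_subset_union hxy subset_rfl),
      ← link_eq (c := OrderComplex.lift u c) hyq, link_lift hu hc]
  · rw [bd_link_of_not hyq]
    by_contra h0
    exact hyq fun t ht => (hc y (Ne.symm h0)).2.1 ht

include hu hx huS hqS huc hsat in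
theorem HTop.transfer (h : HTop S (x ∪ u) (k + u.card)) : HTop (Set.Iio q) x k := by
  obtain ⟨o, ho, hocl, hne, hall⟩ := h
  refine ⟨OrderComplex.link q u o, ho.link hu hx, hocl.link hu hsat ho, fun h0 => hne ?_,
    fun c hc hcl => ?_⟩
  · ext Y
    by_contra hY
    obtain ⟨h1, h2, h3, h4⟩ := ho Y hY
    have huY : u ⊆ Y := Finset.subset_union_right.trans h3
    have := congrFun h0 (Y \ u)
    rw [link_eq fun t ht => hsat Y h1 h2 huY t (Finset.mem_sdiff.1 ht).1 (Finset.mem_sdiff.1 ht).2,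
      Finset.sdiff_union_of_subset huY] at this
    exact hY this
  · obtain ⟨t, ht⟩ := hall _ (hc.lift hu huS hqS huc) (hcl.lift hu hx huS hqS huc hsat hc)
    refine ⟨t, ?_⟩
    rw [← link_lift hu hc, ht]
    ext y
    simp [OrderComplex.link]

end Transfer

omit [Fintype P] in
theorem Supp.mono {L : Set P} {x : Finset P} {k : ℕ} {c : Finset P → ℝ} (h : Supp L x k c)
    {L' : Set P} (hL : L ⊆ L') : Supp L' x k c :=
  fun y hy => let ⟨h1, h2, h3, h4⟩ := h y hy; ⟨h1, h2.trans hL, h3, h4⟩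

/-- Restriction of a function to the sets containing `x`. -/
def star (x : Finset P) (c : Finset P → ℝ) (y : Finset P) : ℝ := if x ⊆ y then c y else 0

theorem bd_star {x y : Finset P} (c : Finset P → ℝ) (h : x ⊆ y) : bd (star x c) y = bd c y := by
  rw [bd_apply, bd_apply]
  refine Finset.sum_congr rfl fun σ _ => ?_
  rw [star, if_pos (h.trans (Finset.subset_insert _ _))]

omit [PartialOrder P] [Fintype P] in
theorem star_eq {x y : Finset P} (c : Finset P → ℝ) (h : x ⊆ y) : star x c y = c y := if_pos h

omit [Fintype P] in
theorem Supp.star {L : Set P} {x x' : Finset P} {k : ℕ} {c : Finset P → ℝ} (h : Supp L x' k c) :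
    Supp L x k (star x c) := by
  intro y hy
  by_cases hxy : x ⊆ y
  · rw [star_eq c hxy] at hy
    obtain ⟨h1, h2, -, h4⟩ := h y hy
    exact ⟨h1, h2, hxy, h4⟩
  · exact absurd (if_neg hxy) hy

/-- The chain complex of a cone is exact. -/
theorem HEx_Iic {z : P} {x : Finset P} (hx : ∀ t ∈ x, t < z) (k : ℕ) : HEx (Set.Iic z) x k := by
  intro c hc hcl
  have hxz : z ∉ x := fun h => lt_irrefl _ (hx z h)
  refine ⟨fun Y => if z ∈ Y then (-1) ^ k * c (Y.erase z) else 0, fun Y hY => ?_, fun y hy => ?_⟩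
  · by_cases hz : z ∈ Y
    · simp only [hz, if_true] at hY
      obtain ⟨h1, h2, h3, h4⟩ := hc _ (right_ne_zero_of_mul hY)
      have hlt : ∀ t ∈ Y.erase z, t < z := fun t ht =>
        lt_of_le_of_ne (h2 ht) (Finset.mem_erase.1 ht).1
      have hYz : insert z (Y.erase z) = Y := Finset.insert_erase hz
      refine ⟨?_, ?_, h3.trans (Finset.erase_subset _ _), ?_⟩
      · rw [← hYz]; exact Ranking.isChain_insert h1 hlt
      · intro t ht
        by_cases htz : t = z
        · exact htz.le
        · exact (hlt t (Finset.mem_erase.2 ⟨htz, ht⟩)).le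
      · rw [← hYz, Finset.card_insert_of_notMem (by simp), h4]
    · simp [hz] at hY
  · rw [bd_apply]
    by_cases hz : z ∈ y
    · have hcz := hcl (y.erase z) fun t ht =>
        Finset.mem_erase.2 ⟨fun h => hxz (h ▸ ht), hy ht⟩
      rw [bd_apply, ← Finset.sum_add_sum_compl {z}, Finset.sum_singleton, if_neg (by simp),
        Finset.insert_erase hz] at hcz
      rw [← Finset.sum_add_sum_compl {z}, Finset.sum_singleton, if_pos hz, zero_add]
      have h1 : ∑ σ ∈ {z}ᶜ, (if σ ∈ y then 0 else sgn y σ *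
          (if z ∈ insert σ y then (-1) ^ k * c ((insert σ y).erase z) else 0))
          = (-1) ^ k * ∑ σ ∈ {z}ᶜ, if σ ∈ y.erase z then 0 else
            sgn (y.erase z) σ * c (insert σ (y.erase z)) := by
        rw [Finset.mul_sum]
        refine Finset.sum_congr rfl fun σ hσ => ?_
        have hσz : σ ≠ z := by simpa using hσ
        by_cases hσy : σ ∈ y
        · simp [hσy, hσz]
        · rw [if_neg hσy, if_pos (by simp [hz]), if_neg (by simp [hσy]),
            Finset.erase_insert_of_ne hσz]
          by_cases h0 : c (insert σ (y.erase z)) = 0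
          · simp [h0]
          · have hlt : σ < z := lt_of_le_of_ne ((hc _ h0).2.1 (by simp)) hσz
            have : sgn y σ = sgn (y.erase z) σ := by
              conv_lhs => rw [← Finset.insert_erase hz]
              rw [sgn_insert (by simp), if_neg hlt.asymm, one_mul]
            rw [this]; ring
      rw [h1]
      have h2 : ∑ σ ∈ {z}ᶜ, (if σ ∈ y.erase z then 0 else
            sgn (y.erase z) σ * c (insert σ (y.erase z))) = - (sgn (y.erase z) z * c y) := by
        linarith
      rw [h2]
      by_cases h0 : c y = 0
      · simp [h0]
      · obtain ⟨-, h5, -, h6⟩ := hc y h0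
        rw [sgn_of_forall_lt fun t ht => lt_of_le_of_ne
          (h5 (Finset.mem_erase.1 ht).2) (Finset.mem_erase.1 ht).1, Finset.card_erase_of_mem hz,
          h6]
        obtain ⟨j, rfl⟩ : ∃ j, k = j + 1 := ⟨k - 1, by have := Finset.card_pos.2 ⟨z, hz⟩; omega⟩
        have h7 : ((-1 : ℝ) ^ j) * (-1) ^ j = 1 := by rw [← mul_pow]; simp
        rw [Nat.add_sub_cancel, pow_succ]
        linear_combination c y * h7
    · rw [Finset.sum_eq_single z]
      · rw [if_neg hz, if_pos (by simp), Finset.erase_insert hz]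
        by_cases h0 : c y = 0
        · simp [h0]
        · obtain ⟨-, h5, -, h6⟩ := hc y h0
          rw [sgn_of_forall_lt fun t ht => lt_of_le_of_ne (h5 ht) (fun h => hz (h ▸ ht)), h6]
          have h7 : ((-1 : ℝ) ^ k) * (-1) ^ k = 1 := by rw [← mul_pow]; simp
          linear_combination c y * h7
      · intro σ _ hσ
        split_ifs with h1 h2
        · rfl
        · exact absurd (Finset.mem_insert.1 h2) (by simp [hz, hσ.symm])
        · simp
      · simp

end OrderComplex

end

section

namespace Ranking

open OrderComplex

variable {P : Type u} [PartialOrder P] [OrderBot P] [Fintype P] (R : Ranking P)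

/-- The order complexes of all open intervals are homology spheres. -/
structure IsSpherical : Prop where
  exact : ∀ p q x, p < q → R.Sat x p → ∀ k, k ≠ R.ρ q → HEx (Set.Iio q) x k
  top : ∀ p q x, p < q → R.Sat x p → HTop (Set.Iio q) x (R.ρ q)

variable {R}

omit [OrderBot P] in
theorem bd_single_insert {x : Finset P} {v : P} (hv : v ∉ x) :
    bd (Pi.single (insert v x) (1 : ℝ)) x = sgn x v := by
  rw [bd_apply, Finset.sum_eq_single v]
  · rw [if_neg hv, Pi.single_eq_same, mul_one]
  · intro σ _ hσ
    split_ifs with h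
    · rfl
    · rw [Pi.single_eq_of_ne, mul_zero]
      intro h'
      have : σ ∈ insert v x := h' ▸ Finset.mem_insert_self σ x
      simp [hσ, h] at this
  · simp

omit [Fintype P] in
theorem Sat.sgn_eq {x : Finset P} {p v : P} (hx : R.Sat x p) (hv : p < v) :
    sgn x v = (-1) ^ x.card :=
  sgn_of_forall_lt fun t ht => (hx.2.2.1 t ht).trans_lt hv

omit [Fintype P] in
theorem Sat.supp_edge {x : Finset P} {p q v : P} (hx : R.Sat x p) (hv : p < v) (hvq : v < q) :
    Supp (Set.Iio q) x (x.card + 1) (Pi.single (insert v x) (1 : ℝ)) := by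
  have hlt : ∀ t ∈ x, t < v := fun t ht => (hx.2.2.1 t ht).trans_lt hv
  intro y hy
  have : y = insert v x := by
    by_contra h
    exact hy (Pi.single_eq_of_ne h _)
  subst this
  refine ⟨isChain_insert hx.1 hlt, fun t ht => ?_, Finset.subset_insert _ _,
    Finset.card_insert_of_notMem fun h => lt_irrefl _ (hlt v h)⟩
  rcases Finset.mem_insert.1 (Finset.mem_coe.1 ht) with rfl | ht
  exacts [hvq, (hlt t ht).trans hvq]

omit [Fintype P] in
theorem Sat.supp_edge_sub {x : Finset P} {p q v w : P} (hx : R.Sat x p) (hv : p < v) (hvq : v < q)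
    (hw : p < w) (hwq : w < q) : Supp (Set.Iio q) x (x.card + 1)
      (Pi.single (insert v x) (1 : ℝ) - Pi.single (insert w x) (1 : ℝ)) := by
  rw [sub_eq_add_neg, ← neg_one_smul ℝ (Pi.single (insert w x) (1 : ℝ) : Finset P → ℝ)]
  exact (hx.supp_edge hv hvq).add ((hx.supp_edge hw hwq).smul _)

omit [Fintype P] in
theorem Sat.notMem_of_lt {x : Finset P} {p v : P} (hx : R.Sat x p) (hv : p < v) : v ∉ x :=
  fun h => lt_irrefl _ (hv.trans_le (hx.2.2.1 v h))

theorem Sat.closed_edge_sub {x : Finset P} {p q v w : P} (hx : R.Sat x p) (hv : p < v)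
    (hvq : v < q) (hw : p < w) (hwq : w < q) :
    Closed x (Pi.single (insert v x) (1 : ℝ) - Pi.single (insert w x) (1 : ℝ)) := by
  intro y hxy
  by_contra h0
  have := (hx.supp_edge_sub hv hvq hw hwq).bd hxy h0
  have hyx := Finset.eq_of_subset_of_card_le hxy this.2.2.2.le
  subst hyx
  rw [map_sub, Pi.sub_apply, bd_single_insert (hx.notMem_of_lt hv),
    bd_single_insert (hx.notMem_of_lt hw), hx.sgn_eq hv, hx.sgn_eq hw, sub_self] at h0
  exact h0 rfl

theorem IsSpherical.connected (hS : R.IsSpherical) {x : Finset P} {p q : P} (hpq : p < q)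
    (hx : R.Sat x p) (hd : R.ρ p + 2 < R.ρ q) {T : P → Prop}
    (hT : ∀ v w, p < v → v < w → w < q → (T v ↔ T w)) {v w : P} (hv : p < v) (hvq : v < q)
    (hw : p < w) (hwq : w < q) (h : T v) : T w := by
  obtain ⟨e, he, hec⟩ := hS.exact p q x hpq hx (x.card + 1) (by rw [hx.2.2.2]; omega) _
    (hx.supp_edge_sub hv hvq hw hwq) (hx.closed_edge_sub hv hvq hw hwq)
  let τ : P → ℝ := fun z => if T z then 1 else 0
  let f : P → P → ℝ := fun a b => if a ∈ x ∨ b ∈ x ∨ b = a then 0 else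
    τ a * (sgn (insert a x) b * e (insert b (insert a x)))
  have h1 : ∀ a, a ∉ x → τ a * bd e (insert a x) = ∑ b, f a b := by
    intro a ha
    rw [bd_apply, Finset.mul_sum]
    refine Finset.sum_congr rfl fun b _ => ?_
    by_cases hb : b = a ∨ b ∈ x
    · rw [if_pos (by simpa using hb), mul_zero]
      exact (if_pos (by tauto)).symm
    · rw [if_neg (by simpa using hb)]
      exact (if_neg (by tauto)).symm
  have h2 : ∀ a b, f b a = - f a b := by
    intro a b
    simp only [f]
    by_cases hc : a ∈ x ∨ b ∈ x ∨ b = a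
    · rw [if_pos hc, if_pos (by tauto), neg_zero]
    · rw [if_neg hc, if_neg (by tauto), Finset.insert_comm]
      push Not at hc
      by_cases h0 : e (insert b (insert a x)) = 0
      · simp [h0]
      obtain ⟨hch, hq, hsub, -⟩ := he _ h0
      have hpa := hx.lt_of_notMem hch hsub (σ := a) (by simp) hc.1
      have hpb := hx.lt_of_notMem hch hsub (σ := b) (by simp) hc.2.1
      have haq : a < q := hq (by simp)
      have hbq : b < q := hq (by simp)
      rw [sgn_insert hc.1, sgn_insert hc.2.1, hx.sgn_eq hpa, hx.sgn_eq hpb]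
      rcases hch (show a ∈ _ by simp) (show b ∈ _ by simp) (Ne.symm hc.2.2) with h' | h'
      · rw [if_pos h', if_neg h'.asymm]
        simp only [τ, hT a b hpa h' hbq]; ring
      · rw [if_pos h', if_neg h'.asymm]
        simp only [τ, hT b a hpb h' haq]; ring
  have h3 : ∑ a, ∑ b, f a b = 0 := by
    have h4 : ∑ a, ∑ b, f a b = - ∑ a, ∑ b, f a b := by
      conv_lhs => rw [Finset.sum_comm]
      rw [← Finset.sum_neg_distrib]
      refine Finset.sum_congr rfl fun a _ => ?_
      rw [← Finset.sum_neg_distrib]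
      exact Finset.sum_congr rfl fun b _ => h2 _ _
    linarith
  have h4 : ∀ a, ∑ b, f a b = τ a * ((if a = v then 1 else 0) - if a = w then 1 else 0) := by
    intro a
    by_cases ha : a ∈ x
    · have hav : a ≠ v := by rintro rfl; exact hx.notMem_of_lt hv ha
      have haw : a ≠ w := by rintro rfl; exact hx.notMem_of_lt hw ha
      simp [f, ha, hav, haw]
    · rw [← h1 a ha, hec _ (Finset.subset_insert _ _), Pi.sub_apply]
      have key : ∀ u, p < u → (Pi.single (insert u x) (1 : ℝ) : Finset P → ℝ) (insert a x)
          = if a = u then 1 else 0 := by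
        intro u hu
        by_cases hau : a = u
        · subst hau; simp
        · rw [if_neg hau, Pi.single_eq_of_ne]
          intro h'
          have : a ∈ insert u x := h' ▸ Finset.mem_insert_self a x
          simp [hau, ha] at this
      rw [key v hv, key w hw]
  have h5 : τ v - τ w = 0 := by
    rw [← h3, Finset.sum_congr rfl fun a _ => h4 a]
    simp [mul_sub, Finset.sum_sub_distrib]
  by_contra hw'
  simp [τ, h, hw'] at h5

omit [Fintype P] in
theorem card_filter_eq {q x : P} {y : Finset P} (hy : IsChain (· < ·) (y : Set P))
    (hyq : ∀ t ∈ y, t < q) (hc : y.card = R.ρ q) (hxq : x < q) (hxy : x ∈ y) :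
    (y.filter (· < x)).card = R.ρ x ∧ (y.filter (¬ · < x)).card + R.ρ x = R.ρ q := by
  have h1 : (y.filter (· < x)).card ≤ R.ρ x :=
    card_le (isChain_mono hy (Finset.filter_subset _ _))
      fun t ht => R.mono (Finset.mem_filter.1 ht).2
  have h2 : (y.filter (¬ · < x)).card + R.ρ x ≤ R.ρ q := by
    refine card_add_le (R := R) (isChain_mono hy (Finset.filter_subset _ _)) (fun t ht => ?_)
      (R.mono hxq).le
    obtain ⟨h3, h4⟩ := Finset.mem_filter.1 ht
    refine ⟨?_, R.mono (hyq t h3)⟩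
    by_contra h
    exact h4 (lt_of_rank (R := R) hy h3 hxy (not_le.1 h))
  have h3 := Finset.card_filter_add_card_filter_not (s := y) (· < x)
  omega

/-- A cycle of top dimension of an open interval which is not zero vanishes at no saturated
chain. -/
theorem IsSpherical.apply_ne_zero (hS : R.IsSpherical) (d : ℕ) : ∀ {p q : P} {x : Finset P}
    {o : Finset P → ℝ}, p < q → R.ρ q ≤ R.ρ p + d → R.Sat x p → Supp (Set.Iio q) x (R.ρ q) o →
    Closed x o → o ≠ 0 → ∀ y : Finset P, IsChain (· < ·) (y : Set P) → (∀ t ∈ y, t < q) → x ⊆ y →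
      y.card = R.ρ q → o y ≠ 0 := by
  induction d using Nat.strong_induction_on with
  | _ d ih =>
    intro p q x o hpq hd hx ho hocl hne y hy hyq hxy hyc
    obtain ⟨y', hy'⟩ : ∃ y', o y' ≠ 0 := by
      by_contra! h
      exact hne (funext h)
    obtain ⟨hc', hq', hxy', hcard'⟩ := ho _ hy'
    have hρ := R.mono hpq
    by_cases hd1 : R.ρ q = R.ρ p + 1
    · have e1 := Finset.eq_of_subset_of_card_le hxy (by rw [hyc, hd1, hx.2.2.2])
      have e2 := Finset.eq_of_subset_of_card_le hxy' (by rw [hcard', hd1, hx.2.2.2])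
      rwa [← e1, e2]
    have new : ∀ z : Finset P, IsChain (· < ·) (z : Set P) → (∀ t ∈ z, t < q) → x ⊆ z →
        z.card = R.ρ q → ∃ v ∈ z, p < v ∧ v < q := by
      intro z hz hzq hxz hzc
      obtain ⟨v, hv, hvx⟩ := Finset.exists_mem_notMem_of_card_lt_card (s := x) (t := z)
        (by rw [hzc, hx.2.2.2]; omega)
      exact ⟨v, hv, hx.lt_of_notMem hz hxz hv hvx, hzq v hv⟩
    obtain ⟨v, hvy, hpv, hvq⟩ := new y hy hyq hxy hyc
    obtain ⟨w, hwy, hpw, hwq⟩ := new y' hc' hq' hxy' hcard'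
    by_cases hd2 : R.ρ q = R.ρ p + 2
    · intro h0
      have hins : ∀ (z : Finset P) u, x ⊆ z → z.card = R.ρ q → u ∈ z → p < u → insert u x = z := by
        intro z u hxz hzc hu hpu
        refine Finset.eq_of_subset_of_card_le (Finset.insert_subset hu hxz) ?_
        rw [Finset.card_insert_of_notMem (hx.notMem_of_lt hpu), hx.2.2.2, hzc, hd2]
      have hs := hx.supp_edge_sub hpv hvq hpw hwq
      have hcl := hx.closed_edge_sub hpv hvq hpw hwq
      rw [hins y v hxy hyc hvy hpv, hins y' w hxy' hcard' hwy hpw] at hs hcl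
      rw [show x.card + 1 = R.ρ q by rw [hx.2.2.2, hd2]] at hs
      obtain ⟨o', -, -, -, hall⟩ := hS.top p q x hpq hx
      obtain ⟨t, ht⟩ := hall o ho hocl
      obtain ⟨s, hs'⟩ := hall _ hs hcl
      have ht0 : t ≠ 0 := by
        rintro rfl
        rw [zero_smul] at ht
        exact hne ht
      have e1 : t * o' y = 0 := by rw [← h0, ht]; rfl
      have e2 := congrFun hs' y
      have hyy : y ≠ y' := by rintro rfl; exact hy' h0
      rw [Pi.smul_apply, (mul_eq_zero.1 e1).resolve_left ht0, Pi.sub_apply, Pi.single_eq_same,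
        Pi.single_eq_of_ne hyy] at e2
      simp at e2
    -- chains through a common intermediate element
    have through : ∀ v, p < v → v < q → ∀ y y' : Finset P, (IsChain (· < ·) (y : Set P) ∧
        (∀ t ∈ y, t < q) ∧ x ⊆ y ∧ y.card = R.ρ q) → (IsChain (· < ·) (y' : Set P) ∧
        (∀ t ∈ y', t < q) ∧ x ⊆ y' ∧ y'.card = R.ρ q) → v ∈ y → v ∈ y' → o y ≠ 0 → o y' ≠ 0 := by
      rintro v hpv hvq y y' ⟨hy, hyq, hxy, hyc⟩ ⟨hy', hyq', hxy', hyc'⟩ hvy hvy' h0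
      have hρ1 := R.mono hpv
      have hρ2 := R.mono hvq
      have hxv : ∀ t ∈ x, t < v := fun t ht => (hx.2.2.1 t ht).trans_lt hpv
      set a := y.filter (· < v) with ha
      set b := y.filter (¬ · < v) with hb
      set a' := y'.filter (· < v) with ha'
      obtain ⟨ca, cb⟩ : a.card = R.ρ v ∧ b.card + R.ρ v = R.ρ q :=
        card_filter_eq hy hyq hyc hvq hvy
      obtain ⟨ca', -⟩ : a'.card = R.ρ v ∧ _ := card_filter_eq hy' hyq' hyc' hvq hvy'
      have hab : a ∪ b = y := Finset.filter_union_filter_not_eq _ _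
      have hvb : ∀ t ∈ b, v ≤ t := by
        intro t ht
        obtain ⟨h1, h2⟩ := Finset.mem_filter.1 ht
        by_cases htv : t = v
        · exact htv.ge
        · exact ((hy h1 hvy htv).resolve_left h2).le
      have hva : ∀ t ∈ a, t < v := fun t ht => (Finset.mem_filter.1 ht).2
      have hva' : ∀ t ∈ a', t < v := fun t ht => (Finset.mem_filter.1 ht).2
      have hvmb : v ∈ b := Finset.mem_filter.2 ⟨hvy, lt_irrefl v⟩
      have hxa : x ⊆ a := fun t ht => Finset.mem_filter.2 ⟨hxy ht, hxv t ht⟩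
      have hxa' : x ⊆ a' := fun t ht => Finset.mem_filter.2 ⟨hxy' ht, hxv t ht⟩
      have step : o (a' ∪ b) ≠ 0 := by
        have hbl : ∀ z : Finset P, (∀ t ∈ z, t < v) → bd (link v b o) z = bd o (z ∪ b) := by
          intro z hz
          refine bd_link hvb hz fun σ hσ hσv => ?_
          by_contra hne0
          obtain ⟨h1, h2, -, -⟩ := ho _ hne0
          have hsub : insert σ b ⊆ insert σ (z ∪ b) :=
            Finset.insert_subset_insert _ Finset.subset_union_right
          have h3 : (insert σ b).card + R.ρ v ≤ R.ρ q := by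
            refine card_add_le (isChain_mono h1 hsub) (fun t ht => ⟨?_, R.mono (h2 (hsub ht))⟩)
              hρ2.le
            rcases Finset.mem_insert.1 ht with rfl | ht
            · by_contra hlt
              exact hσv (lt_of_rank h1 (by simp) (hsub (Finset.mem_insert_of_mem hvmb))
                (not_le.1 hlt))
            · exact R.mono.monotone (hvb t ht)
          rw [Finset.card_insert_of_notMem fun h => hσ (Finset.mem_union_right _ h)] at h3
          omega
        have hl := ih (R.ρ v - R.ρ p) (by omega) (o := link v b o) hpv (by omega) hx ?_ ?_ ?_ a'
          (isChain_mono hy' (Finset.filter_subset _ _)) hva' hxa' ca'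
        · rwa [link_eq hva'] at hl
        · intro z hz
          by_cases hzv : ∀ t ∈ z, t < v
          · rw [link_eq hzv] at hz
            obtain ⟨h1, h2, h3, h4⟩ := ho _ hz
            refine ⟨isChain_mono h1 Finset.subset_union_left, hzv, fun t ht => ?_, ?_⟩
            · rcases Finset.mem_union.1 (h3 ht) with h | h
              · exact h
              · exact absurd ((hxv t ht).trans_le (hvb t h)) (lt_irrefl _)
            · rw [Finset.card_union_of_disjoint (Finset.disjoint_left.2 fun t h h' =>
                lt_irrefl _ ((hzv t h).trans_le (hvb t h')))] at h4
              omega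
          · exact absurd (if_neg hzv) hz
        · intro z hxz
          by_cases hzv : ∀ t ∈ z, t < v
          · rw [hbl z hzv]
            exact hocl _ (hxz.trans Finset.subset_union_left)
          · exact bd_link_of_not hzv
        · intro h
          have := congrFun h a
          rw [link_eq hva, hab] at this
          exact h0 this
      have hsat : R.Sat (insert v a') v := by
        refine ⟨isChain_insert (isChain_mono hy' (Finset.filter_subset _ _)) hva', by simp,
          fun t ht => ?_, ?_⟩
        · rcases Finset.mem_insert.1 ht with rfl | ht
          exacts [le_rfl, (hva' t ht).le]
        · rw [Finset.card_insert_of_notMem fun h => lt_irrefl _ (hva' v h), ca']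
      have hsub' : insert v a' ⊆ y' := Finset.insert_subset hvy' (Finset.filter_subset _ _)
      have hl := ih (R.ρ q - R.ρ v) (by omega) (o := star (insert v a') o) hvq (by omega) hsat
        ho.star (fun z hz => by
          rw [bd_star o hz]
          exact hocl _ ((hxa'.trans (Finset.subset_insert _ _)).trans hz))
        (fun h => step (by
          have := congrFun h (a' ∪ b)
          rwa [star_eq o (Finset.insert_subset (Finset.mem_union_right _ hvmb)
            Finset.subset_union_left)] at this))
        y' hy' hyq' hsub' hyc'
      rwa [star_eq o hsub'] at hl
    let T : P → Prop := fun u => ∃ z : Finset P, (IsChain (· < ·) (z : Set P) ∧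
      (∀ t ∈ z, t < q) ∧ x ⊆ z ∧ z.card = R.ρ q) ∧ u ∈ z ∧ o z ≠ 0
    have hT : ∀ v w, p < v → v < w → w < q → (T v ↔ T w) := by
      intro v w hpv hvw hwq
      obtain ⟨y₁, hy₁, hxy₁⟩ := hx.exists_extend hpv.le
      obtain ⟨y₂, hy₂, hy₁₂⟩ := hy₁.exists_extend hvw.le
      obtain ⟨y₃, hy₃, hy₂₃⟩ := hy₂.exists_extend hwq.le
      have mem : ∀ u ∈ y₃, u < q → u ∈ y₃.erase q := fun u hu huq =>
        Finset.mem_erase.2 ⟨huq.ne, hu⟩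
      have hgood : IsChain (· < ·) ((y₃.erase q : Finset P) : Set P) ∧
          (∀ t ∈ y₃.erase q, t < q) ∧ x ⊆ y₃.erase q ∧ (y₃.erase q).card = R.ρ q := by
        refine ⟨isChain_mono hy₃.1 (Finset.erase_subset _ _), fun t ht => ?_, fun t ht =>
          mem t (hy₂₃ (hy₁₂ (hxy₁ ht))) ((hx.2.2.1 t ht).trans_lt hpq), ?_⟩
        · obtain ⟨h1, h2⟩ := Finset.mem_erase.1 ht
          exact (hy₃.2.2.1 t h2).lt_of_ne h1
        · rw [Finset.card_erase_of_mem hy₃.2.1, hy₃.2.2.2]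
          omega
      have hv3 := mem v (hy₂₃ (hy₁₂ hy₁.2.1)) (hvw.trans hwq)
      have hw3 := mem w (hy₂₃ hy₂.2.1) hwq
      constructor
      · rintro ⟨z, hz, hvz, h0⟩
        exact ⟨_, hgood, hw3, through v hpv (hvw.trans hwq) _ _ hz hgood hvz hv3 h0⟩
      · rintro ⟨z, hz, hwz, h0⟩
        exact ⟨_, hgood, hv3, through w (hpv.trans hvw) hwq _ _ hz hgood hwz hw3 h0⟩
    obtain ⟨z, hz, hvz, h0⟩ : T v := hS.connected hpq hx (by omega) hT hpw hwq hpv hvq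
      ⟨y', ⟨hc', fun t ht => hq' ht, hxy', hcard'⟩, hwy, hy'⟩
    exact through v hpv hvq _ _ hz ⟨hy, hyq, hxy, hyc⟩ hvz hvy h0

end Ranking

end

section

namespace Ranking

open OrderComplex

variable {P : Type u} [PartialOrder P] [OrderBot P] [Fintype P] (R : Ranking P)

/-- The chain `y` is a maximal chain of the elements below `z`. -/
def Full (y : Finset P) (z : P) : Prop :=
  IsChain (· < ·) (y : Set P) ∧ (∀ t ∈ y, t < z) ∧ y.card = R.ρ z

/-- A choice of fundamental cycles of all lower intervals. -/
structure Orientation where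
  o : P → Finset P → ℝ
  supp : ∀ z y, o z y ≠ 0 → R.Full y z
  closed : ∀ z, ∀ y, ⊥ ∈ y → bd (o z) y = 0
  ne_zero : ∀ z y, R.Full y z → o z y ≠ 0
  uniq : ∀ p z x, p < z → R.Sat x p → ∀ c, Supp (Set.Iio z) x (R.ρ z) c → Closed x c →
    ∃ t : ℝ, ∀ y, x ⊆ y → c y = t * o z y

variable {R}

omit [Fintype P] in
theorem Full.sat {y : Finset P} {z : P} (h : R.Full y z) : R.Sat (insert z y) z := by
  refine ⟨isChain_insert h.1 h.2.1, by simp, fun t ht => ?_, ?_⟩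
  · rcases Finset.mem_insert.1 ht with rfl | ht
    exacts [le_rfl, (h.2.1 t ht).le]
  · rw [Finset.card_insert_of_notMem fun hz => lt_irrefl _ (h.2.1 z hz), h.2.2]

omit [Fintype P] in
theorem Sat.full {y : Finset P} {z : P} (h : R.Sat y z) : R.Full (y.erase z) z := by
  refine ⟨isChain_mono h.1 (Finset.erase_subset _ _), fun t ht => ?_, ?_⟩
  · obtain ⟨h1, h2⟩ := Finset.mem_erase.1 ht
    exact (h.2.2.1 t h2).lt_of_ne h1
  · rw [Finset.card_erase_of_mem h.2.1, h.2.2.2, Nat.add_sub_cancel]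

omit [Fintype P] in
theorem Sat.unique {y : Finset P} {z z' : P} (h : R.Sat y z) (h' : R.Sat y z') : z = z' :=
  le_antisymm (h'.2.2.1 _ h.2.1) (h.2.2.1 _ h'.2.1)

omit [Fintype P] in
theorem Full.bot_mem {y : Finset P} {z : P} (h : R.Full y z) (hz : z ≠ ⊥) : ⊥ ∈ y := by
  have := h.sat.bot_mem
  exact (Finset.mem_insert.1 this).resolve_left hz.symm

omit [Fintype P] in
theorem rho_pos {z : P} (hz : z ≠ ⊥) : 0 < R.ρ z := by
  rw [← R.bot]; exact R.mono (bot_lt_iff_ne_bot.2 hz)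

theorem IsSpherical.exists_orientation (hS : R.IsSpherical) : Nonempty R.Orientation := by
  have h0 : ∀ z : P, ∃ o : Finset P → ℝ, (∀ y, o y ≠ 0 → R.Full y z) ∧
      (∀ y, ⊥ ∈ y → bd o y = 0) ∧ (∀ y, R.Full y z → o y ≠ 0) := by
    intro z
    by_cases hz : z = ⊥
    · subst hz
      refine ⟨fun y => if y = ∅ then 1 else 0, fun y hy => ?_, fun y hy => ?_, fun y hy => ?_⟩
      · have : y = ∅ := by by_contra h; simp [h] at hy
        subst this
        exact ⟨by simp, by simp, by simp [R.bot]⟩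
      · rw [bd_apply]
        exact Finset.sum_eq_zero fun σ _ => by simp
      · have : y = ∅ := by rw [← Finset.card_eq_zero, hy.2.2, R.bot]
        simp [this]
    · have hlt := bot_lt_iff_ne_bot.2 hz
      obtain ⟨o, ho, hcl, hne, -⟩ := hS.top ⊥ z {⊥} hlt sat_bot
      refine ⟨o, fun y hy => ?_, fun y hy => hcl y (by simpa using hy), fun y hy => ?_⟩
      · obtain ⟨h1, h2, -, h4⟩ := ho y hy
        exact ⟨h1, fun t ht => h2 ht, h4⟩
      · exact hS.apply_ne_zero (R.ρ z) hlt (by omega) sat_bot ho hcl hne y hy.1 hy.2.1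
          (by simpa using hy.bot_mem hz) hy.2.2
  choose o ho hcl hne using h0
  refine ⟨⟨o, ho, hcl, hne, fun p z x hpz hx c hc hccl => ?_⟩⟩
  obtain ⟨o', -, -, -, hall⟩ := hS.top p z x hpz hx
  have hxz : ∀ t ∈ x, t < z := fun t ht => (hx.2.2.1 t ht).trans_lt hpz
  obtain ⟨s, hs⟩ := hall (star x (o z)) (fun y hy => by
      by_cases hxy : x ⊆ y
      · rw [star_eq _ hxy] at hy
        obtain ⟨h1, h2, h3⟩ := ho z y hy
        exact ⟨h1, h2, hxy, h3⟩
      · exact absurd (if_neg hxy) hy)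
    (fun y hy => by rw [bd_star _ hy]; exact hcl z y (hy hx.bot_mem))
  obtain ⟨t, ht⟩ := hall c hc hccl
  have hs0 : s ≠ 0 := by
    rintro rfl
    obtain ⟨Y, hY, hxY⟩ := hx.exists_extend hpz.le
    have hxY' : x ⊆ Y.erase z := fun t ht => Finset.mem_erase.2 ⟨(hxz t ht).ne, hxY ht⟩
    have := congrFun hs (Y.erase z)
    rw [star_eq _ hxY', zero_smul] at this
    exact hne z _ hY.full this
  refine ⟨t / s, fun y hy => ?_⟩
  have h1 := congrFun hs y
  rw [star_eq _ hy, Pi.smul_apply, smul_eq_mul] at h1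
  rw [h1, ht, Pi.smul_apply, smul_eq_mul]
  field_simp

omit [OrderBot P] in
/-- The boundary of a function of the form `y ↦ f (y.erase t)` at a set which contains the
greatest element `t`. -/
theorem bd_of_cone {t : P} {Y : Finset P} (ht : t ∈ Y) {f g : Finset P → ℝ}
    (hf : ∀ y, f y ≠ 0 → ∀ τ ∈ y, τ < t)
    (hg : ∀ σ, σ ∉ Y → g (insert σ Y) = f ((insert σ Y).erase t)) :
    bd g Y = bd f (Y.erase t) := by
  rw [bd_apply, bd_apply]
  refine Finset.sum_congr rfl fun σ _ => ?_
  by_cases hσ : σ ∈ Y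
  · rw [if_pos hσ]
    by_cases hσt : σ = t
    · subst hσt
      rw [if_neg (by simp), Finset.insert_erase ht]
      have : f Y = 0 := by
        by_contra h
        exact lt_irrefl _ (hf Y h _ ht)
      rw [this, mul_zero]
    · rw [if_pos (Finset.mem_erase.2 ⟨hσt, hσ⟩)]
  · have hσt : σ ≠ t := by rintro rfl; exact hσ ht
    rw [if_neg hσ, if_neg (by simp [hσ]), hg σ hσ, Finset.erase_insert_of_ne hσt]
    by_cases h0 : f (insert σ (Y.erase t)) = 0
    · rw [h0, mul_zero, mul_zero]
    · have hlt := hf _ h0 σ (by simp)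
      conv_lhs => rw [← Finset.insert_erase ht]
      rw [sgn_insert (by simp), if_neg hlt.asymm, one_mul, Finset.insert_erase ht]

namespace Orientation

variable (D : R.Orientation)

/-- The incidence coefficients of an orientation. -/
def eps (x z : P) : ℝ :=
  if x < z ∧ R.ρ z = R.ρ x + 1 then
    D.o z (Classical.choose (R.exists_sat x)) /
      D.o x ((Classical.choose (R.exists_sat x)).erase x) else 0

theorem eps_spec {x z : P} (hxz : x < z) (hr : R.ρ z = R.ρ x + 1) {Y : Finset P}
    (hY : R.Sat Y x) : D.o z Y = D.eps x z * D.o x (Y.erase x) := by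
  have key : ∃ t : ℝ, ∀ Y, R.Sat Y x → D.o z Y = t * D.o x (Y.erase x) := by
    by_cases hx : x = ⊥
    · subst hx
      have huni : ∀ Y, R.Sat Y ⊥ → Y = {⊥} := fun Y hY => by
        have h1 := hY.2.2.2
        rw [R.bot, zero_add, Finset.card_eq_one] at h1
        obtain ⟨a, rfl⟩ := h1
        have := hY.2.1
        simp only [Finset.mem_singleton] at this
        rw [this]
      refine ⟨D.o z {⊥} / D.o ⊥ (({⊥} : Finset P).erase ⊥), fun Y hY => ?_⟩
      rw [huni Y hY]
      have := D.ne_zero ⊥ _ (sat_bot (R := R)).full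
      field_simp
    · have hbx : ⊥ < x := bot_lt_iff_ne_bot.2 hx
      have hmem : ∀ y, (∀ t ∈ y, t < x) → link x {x} (D.o z) y = D.o z (insert x y) := by
        intro y hy
        rw [link_eq hy, Finset.union_comm, Finset.insert_eq]
      have hsup : Supp (Set.Iio x) {⊥} (R.ρ x) (link x {x} (D.o z)) := by
        intro y hy
        by_cases hyx : ∀ t ∈ y, t < x
        · rw [hmem y hyx] at hy
          have h1 := D.supp z _ hy
          have hxy : x ∉ y := fun h => lt_irrefl _ (hyx x h)
          refine ⟨isChain_mono h1.1 (Finset.subset_insert _ _), hyx, ?_, ?_⟩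
          · have := h1.bot_mem (hbx.trans hxz).ne'
            simpa [hx, Ne.symm hx] using this
          · have := h1.2.2
            rw [Finset.card_insert_of_notMem hxy] at this
            omega
        · exact absurd (if_neg hyx) hy
      have hcl : Closed {⊥} (link x {x} (D.o z)) := by
        intro y hy
        by_cases hyx : ∀ t ∈ y, t < x
        · rw [bd_link (by simp) hyx, D.closed z]
          · exact Finset.mem_union_left _ (by simpa using hy)
          · intro σ hσ hσx
            by_contra h0
            obtain ⟨h1, h2, -⟩ := D.supp z _ h0
            have hne : σ ≠ x := by rintro rfl; simp at hσ
            rcases h1 (show σ ∈ _ by simp) (show x ∈ _ by simp) hne with h | h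
            · exact hσx h
            · have h3 := R.mono h
              have h4 := R.mono (h2 σ (by simp))
              omega
        · exact bd_link_of_not hyx
      obtain ⟨t, ht⟩ := D.uniq ⊥ x {⊥} hbx sat_bot (link x {x} (D.o z)) hsup hcl
      refine ⟨t, fun Y hY => ?_⟩
      rw [← ht _ (by simpa using hY.full.bot_mem hx), hmem _ hY.full.2.1,
        Finset.insert_erase hY.2.1]
  obtain ⟨t, ht⟩ := key
  have hc := Classical.choose_spec (R.exists_sat x)
  rw [eps, if_pos ⟨hxz, hr⟩, ht _ hc, ht _ hY,
    mul_div_cancel_right₀ _ (D.ne_zero x _ hc.full)]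

theorem lt_of_eps {x z : P} (h : D.eps x z ≠ 0) : x < z := by
  by_contra h'
  exact h (if_neg fun h1 => h' h1.1)

theorem rank_of_eps {x z : P} (h : D.eps x z ≠ 0) : R.ρ z = R.ρ x + 1 := by
  by_contra h'
  exact h (if_neg fun h1 => h' h1.2)

/-- The cellular boundary. -/
def del (s : P → ℝ) (x : P) : ℝ := ∑ z, D.eps x z * s z

/-- The simplicial chain of a cellular chain. -/
def asm (s : P → ℝ) (Y : Finset P) : ℝ :=
  ∑ z, if R.Sat Y z then D.o z (Y.erase z) * s z else 0

theorem asm_of_sat {s : P → ℝ} {Y : Finset P} {z : P} (h : R.Sat Y z) :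
    D.asm s Y = D.o z (Y.erase z) * s z := by
  rw [asm, Finset.sum_eq_single z, if_pos h]
  · intro z' _ hz'
    rw [if_neg fun h' => hz' (h'.unique h)]
  · simp

theorem asm_of_not {s : P → ℝ} {Y : Finset P} (h : ∀ z, ¬ R.Sat Y z) : D.asm s Y = 0 :=
  Finset.sum_eq_zero fun z _ => if_neg (h z)

theorem asm_ne_zero {s : P → ℝ} {Y : Finset P} (h : D.asm s Y ≠ 0) :
    ∃ z, R.Sat Y z ∧ s z ≠ 0 := by
  by_contra! h'
  refine h (Finset.sum_eq_zero fun z _ => ?_)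
  split_ifs with hz
  · rw [h' z hz, mul_zero]
  · rfl

/-- `asm` is a chain map up to sign. -/
theorem bd_asm {s : P → ℝ} {r : ℕ} (hs : ∀ z, s z ≠ 0 → R.ρ z = r) {Y : Finset P}
    (hY : ⊥ ∈ Y) : bd (D.asm s) Y = (-1) ^ r * D.asm (D.del s) Y := by
  by_cases hsat : ∃ x, R.Sat Y x
  · obtain ⟨x, hx⟩ := hsat
    rw [D.asm_of_sat hx, bd_apply, del, Finset.mul_sum, Finset.mul_sum]
    refine Finset.sum_congr rfl fun z _ => ?_
    by_cases hxz : x < z ∧ R.ρ z = R.ρ x + 1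
    · have hzY : z ∉ Y := hx.notMem_of_lt hxz.1
      have hz := hx.insert_sat hxz.1 hxz.2
      rw [if_neg hzY, D.asm_of_sat hz, Finset.erase_insert hzY, D.eps_spec hxz.1 hxz.2 hx,
        hx.sgn_eq hxz.1, hx.2.2.2]
      by_cases h0 : s z = 0
      · simp [h0]
      · rw [← hs z h0, hxz.2]; ring
    · rw [eps, if_neg hxz, zero_mul, mul_zero, mul_zero]
      split_ifs with hzY
      · rfl
      · by_contra h0
        obtain ⟨w, hw, hsw⟩ := D.asm_ne_zero (right_ne_zero_of_mul h0)
        have hxz' := hx.lt_of_notMem hw.1 (Finset.subset_insert _ _) (by simp) hzY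
        have h1 := hw.2.2.2
        rw [Finset.card_insert_of_notMem hzY, hx.2.2.2] at h1
        have h2 := R.mono hxz'
        have h3 := R.mono.monotone (hw.2.2.1 z (by simp))
        exact hxz ⟨hxz', by omega⟩
  · push Not at hsat
    rw [D.asm_of_not hsat, mul_zero]
    by_contra h0
    obtain ⟨σ, hσ, h1⟩ := bd_ne_zero h0
    obtain ⟨z, hz, hsz⟩ := D.asm_ne_zero h1
    have hrz := hs z hsz
    have hcard : Y.card = r := by
      have := hz.2.2.2
      rw [Finset.card_insert_of_notMem hσ] at this
      omega
    obtain ⟨t, htY, htr⟩ : ∃ t ∈ Y, r ≤ R.ρ t := by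
      by_contra! h
      obtain ⟨j, hj⟩ : ∃ j, r = j + 1 :=
        ⟨r - 1, by have := Finset.card_pos.2 ⟨_, hY⟩; omega⟩
      obtain ⟨x, hx, -⟩ := exists_sat_of_card (R := R) (r := j)
        (isChain_mono hz.1 (Finset.subset_insert _ _))
        (fun t ht => by have := h t ht; omega) (by omega)
      exact hsat x hx
    have huniq : ∀ σ w, R.Sat (insert σ Y) w → R.ρ w = r → w = t := by
      intro σ w hw hwr
      rcases (hw.2.2.1 t (Finset.mem_insert_of_mem htY)).eq_or_lt with h | h
      · exact h.symm
      · have := R.mono h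
        omega
    have hzt := huniq σ z hz hrz
    subst hzt
    have hzbot : z ≠ ⊥ := by
      rintro rfl
      rw [R.bot] at hrz
      rw [← hrz, Finset.card_eq_zero] at hcard
      simp [hcard] at hY
    refine h0 ?_
    rw [bd_of_cone htY (f := fun y => D.o z y * s z)]
    · have h2 := D.closed z (Y.erase z) (Finset.mem_erase.2 ⟨hzbot.symm, hY⟩)
      have h3 : (fun y => D.o z y * s z) = s z • D.o z := by
        ext y; simp [mul_comm]
      rw [h3, map_smul, Pi.smul_apply, h2, smul_zero]
    · exact fun y hy => (D.supp z y (left_ne_zero_of_mul hy)).2.1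
    · intro σ' hσ'
      by_cases hz' : R.Sat (insert σ' Y) z
      · exact D.asm_of_sat hz'
      · have h2 : D.asm s (insert σ' Y) = 0 := by
          by_contra h
          obtain ⟨w, hw, hsw⟩ := D.asm_ne_zero h
          exact hz' (huniq σ' w hw (hs w hsw) ▸ hw)
        rw [h2]
        by_contra h
        have h4 := (D.supp z _ (left_ne_zero_of_mul (Ne.symm h))).sat
        rw [Finset.insert_erase (Finset.mem_insert_of_mem htY)] at h4
        exact hz' h4

/-- A cellular chain is determined by its simplicial chain. -/
theorem eq_of_asm {p : P} {y₀ : Finset P} (hp : R.Sat y₀ p) {s t : P → ℝ}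
    (h : ∀ Y, y₀ ⊆ Y → D.asm s Y = D.asm t Y) {x : P} (hx : p ≤ x) : s x = t x := by
  obtain ⟨Y, hY, hy⟩ := hp.exists_extend hx
  have := h Y hy
  rw [D.asm_of_sat hY, D.asm_of_sat hY] at this
  exact mul_left_cancel₀ (D.ne_zero x _ hY.full) this

theorem asm_smul (a : ℝ) (s : P → ℝ) (Y : Finset P) : D.asm (fun z => a * s z) Y = a * D.asm s Y := by
  rw [asm, asm, Finset.mul_sum]
  refine Finset.sum_congr rfl fun z _ => ?_
  split_ifs
  · ring
  · rw [mul_zero]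

theorem isChain_of_asm {s : P → ℝ} {Y : Finset P} (h : D.asm s Y ≠ 0) :
    IsChain (· < ·) (Y : Set P) := by
  obtain ⟨z, hz, -⟩ := D.asm_ne_zero h
  exact hz.1

theorem del_ne_zero {s : P → ℝ} {x : P} (h : D.del s x ≠ 0) :
    ∃ z, x < z ∧ R.ρ z = R.ρ x + 1 ∧ s z ≠ 0 := by
  obtain ⟨z, -, hz⟩ := Finset.exists_ne_zero_of_sum_ne_zero h
  exact ⟨z, D.lt_of_eps (left_ne_zero_of_mul hz), D.rank_of_eps (left_ne_zero_of_mul hz),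
    right_ne_zero_of_mul hz⟩

theorem del_del {s : P → ℝ} {r : ℕ} (hs : ∀ z, s z ≠ 0 → R.ρ z = r + 1) :
    D.del (D.del s) = 0 := by
  have h1 : ∀ x, D.del s x ≠ 0 → R.ρ x = r := fun x hx => by
    obtain ⟨z, -, h2, h3⟩ := D.del_ne_zero hx
    have := hs z h3
    omega
  ext x
  refine D.eq_of_asm (sat_bot (R := R)) (t := 0) (fun Y hY => ?_) bot_le
  have hbot : ⊥ ∈ Y := by simpa using hY
  have h2 := congrFun (bd_bd (c := D.asm s) fun y hy => D.isChain_of_asm hy) Y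
  have h3 : bd (bd (D.asm s)) Y = (-1) ^ (r + 1) * bd (D.asm (D.del s)) Y := by
    rw [bd_apply, bd_apply, Finset.mul_sum]
    refine Finset.sum_congr rfl fun σ _ => ?_
    split_ifs
    · rw [mul_zero]
    · rw [D.bd_asm hs (Finset.mem_insert_of_mem hbot)]; ring
  rw [h3, D.bd_asm h1 hbot, Pi.zero_apply, ← mul_assoc, mul_eq_zero] at h2
  rw [h2.resolve_left (mul_ne_zero (by simp) (by simp))]
  exact (Finset.sum_eq_zero fun z _ => by simp).symm

theorem eps_sq (x w : P) : ∑ z, D.eps x z * D.eps z w = 0 := by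
  by_cases hw : w = ⊥
  · subst hw
    refine Finset.sum_eq_zero fun z _ => ?_
    rw [show D.eps z ⊥ = 0 by
      by_contra h
      exact not_lt_bot (D.lt_of_eps h), mul_zero]
  · have h0 := rho_pos (R := R) hw
    have h1 := congrFun (D.del_del (s := Pi.single w 1) (r := R.ρ w - 1) fun z hz => by
      have : z = w := by
        by_contra h
        exact hz (Pi.single_eq_of_ne h _)
      subst this
      omega) x
    rw [del] at h1
    rw [← Pi.zero_apply (M := fun _ : P => ℝ) x, ← h1]
    refine Finset.sum_congr rfl fun z _ => ?_
    rw [del, Finset.sum_eq_single w]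
    · simp
    · intro b _ hb
      simp [hb]
    · simp

end Orientation

end Ranking

end

section

namespace Ranking.Orientation

open OrderComplex

variable {P : Type u} [PartialOrder P] [OrderBot P] [Fintype P] {R : Ranking P} (D : R.Orientation)

omit [Fintype P] [OrderBot P] in
theorem _root_.OrderComplex.link_singleton {q : P} {c : Finset P → ℝ} {y : Finset P}
    (h : ∀ t ∈ y, t < q) : link q {q} c y = c (insert q y) := by
  rw [link_eq h, Finset.union_comm, Finset.insert_eq]

omit [Fintype P] [OrderBot P] in
theorem _root_.OrderComplex.Supp.link_top {L : Set P} {x : Finset P} {k : ℕ} {c : Finset P → ℝ}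
    (hc : Supp L x (k + 1) c) {q : P} (hq : q ∉ x) : Supp (Set.Iio q) x k (link q {q} c) := by
  intro y hy
  by_cases hyq : ∀ t ∈ y, t < q
  · rw [link_singleton hyq] at hy
    obtain ⟨h1, h2, h3, h4⟩ := hc _ hy
    have hqy : q ∉ y := fun h => lt_irrefl _ (hyq q h)
    refine ⟨isChain_mono h1 (Finset.subset_insert _ _), hyq, fun t ht => ?_, ?_⟩
    · refine (Finset.mem_insert.1 (h3 ht)).resolve_left ?_
      rintro rfl
      exact hq ht
    · rw [Finset.card_insert_of_notMem hqy] at h4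
      omega
  · exact absurd (if_neg hyq) hy

omit [OrderBot P] in
theorem closed_link_top {x : Finset P} {c : Finset P → ℝ} {q : P}
    (hmax : ∀ Y, c Y ≠ 0 → q ∈ Y → ∀ t ∈ Y, t ≤ q)
    (hcl : ∀ Y, x ⊆ Y → q ∈ Y → bd c Y = 0) : Closed x (link q {q} c) := by
  intro y hxy
  by_cases hyq : ∀ t ∈ y, t < q
  · rw [bd_link (by simp) hyq, Finset.union_comm, ← Finset.insert_eq]
    · exact hcl _ (hxy.trans (Finset.subset_insert _ _)) (by simp)
    · intro σ hσ hσq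
      by_contra h0
      have hne : σ ≠ q := by rintro rfl; simp at hσ
      exact hσq ((hmax _ h0 (by simp) σ (by simp)).lt_of_ne hne)
  · exact bd_link_of_not hyq

/-- A simplicial chain whose boundary avoids the top rank comes from a cellular chain. -/
theorem exists_asm {L : Set P} {p : P} {y₀ : Finset P} (hp : R.Sat y₀ p) {r : ℕ}
    {c : Finset P → ℝ} (hc : Supp L y₀ (r + 1) c) (hr : ∀ Y, c Y ≠ 0 → ∀ t ∈ Y, R.ρ t ≤ r)
    (hcl : ∀ Y, y₀ ⊆ Y → ∀ q ∈ Y, R.ρ q = r → bd c Y = 0) :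
    ∃ t : P → ℝ, (∀ x, ¬(p ≤ x ∧ x ∈ L ∧ R.ρ x = r) → t x = 0) ∧
      ∀ Y, y₀ ⊆ Y → c Y = D.asm t Y := by
  have hex : ∀ q, ∃ τ : ℝ, (¬(p ≤ q ∧ q ∈ L ∧ R.ρ q = r) → τ = 0) ∧
      ∀ Y, y₀ ⊆ Y → R.Sat Y q → c Y = D.o q (Y.erase q) * τ := by
    intro q
    by_cases h0 : ∀ Y, y₀ ⊆ Y → R.Sat Y q → c Y = 0
    · exact ⟨0, fun _ => rfl, fun Y h1 h2 => by rw [h0 Y h1 h2, mul_zero]⟩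
    push Not at h0
    obtain ⟨Y, hyY, hY, hcY⟩ := h0
    obtain ⟨-, hYL, -, hcard⟩ := hc Y hcY
    have hqr : R.ρ q = r := by rw [hY.2.2.2] at hcard; omega
    have hqL : q ∈ L := hYL hY.2.1
    rcases (hY.2.2.1 p (hyY hp.2.1)).eq_or_lt with rfl | hpq
    · refine ⟨c y₀ / D.o p (y₀.erase p), fun h => absurd ⟨le_rfl, hqL, hqr⟩ h,
        fun Z hZ hZs => ?_⟩
      rw [← Finset.eq_of_subset_of_card_le hZ (by rw [hZs.2.2.2, hp.2.2.2]),
        mul_div_cancel₀]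
      exact D.ne_zero _ _ hp.full
    · have hqy := hp.notMem_of_lt hpq
      obtain ⟨τ, hτ⟩ := D.uniq p q y₀ hpq hp (link q {q} c) (hqr ▸ hc.link_top hqy)
        (closed_link_top (fun Z hZ hqZ t ht => by
          by_contra hlt
          have hne : t ≠ q := by rintro rfl; exact hlt le_rfl
          have := R.mono (((hc Z hZ).1 ht hqZ hne).resolve_left fun h => hlt h.le)
          have := hr Z hZ t ht
          omega) (fun Z hyZ hqZ => hcl Z hyZ q hqZ hqr))
      refine ⟨τ, fun h => absurd ⟨hpq.le, hqL, hqr⟩ h, fun Z hZ hZs => ?_⟩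
      have h1 : y₀ ⊆ Z.erase q := fun t ht =>
        Finset.mem_erase.2 ⟨by rintro rfl; exact hqy ht, hZ ht⟩
      have h2 := hτ _ h1
      rwa [link_singleton hZs.full.2.1, Finset.insert_erase hZs.2.1, mul_comm] at h2
  choose t ht0 ht using hex
  refine ⟨t, ht0, fun Y hY => ?_⟩
  by_cases hs : ∃ q, R.Sat Y q
  · obtain ⟨q, hq⟩ := hs
    rw [ht q Y hY hq, D.asm_of_sat hq]
  · push Not at hs
    rw [D.asm_of_not hs]
    by_contra h0
    obtain ⟨h1, -, -, h4⟩ := hc Y h0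
    obtain ⟨x, hx, -⟩ := exists_sat_of_card (R := R) h1 (hr Y h0) h4
    exact hs x hx

theorem supp_star_asm {L : Set P} (hL : IsLowerSet L) {y₀ : Finset P} {r : ℕ} {s : P → ℝ}
    (hs : ∀ x, s x ≠ 0 → x ∈ L ∧ R.ρ x = r) : Supp L y₀ (r + 1) (star y₀ (D.asm s)) := by
  intro Y hY
  by_cases hyY : y₀ ⊆ Y
  · rw [star_eq _ hyY] at hY
    obtain ⟨z, hz, hsz⟩ := D.asm_ne_zero hY
    obtain ⟨hzL, hzr⟩ := hs z hsz
    exact ⟨hz.1, fun t ht => hL (hz.2.2.1 t ht) hzL, hyY, by rw [hz.2.2.2, hzr]⟩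
  · exact absurd (if_neg hyY) hY

theorem closed_star_asm {p : P} {y₀ : Finset P} (hp : R.Sat y₀ p) {r : ℕ} {s : P → ℝ}
    (hs : ∀ x, s x ≠ 0 → R.ρ x = r) (hd : ∀ x, p ≤ x → D.del s x = 0) :
    Closed y₀ (star y₀ (D.asm s)) := by
  intro Y hY
  rw [bd_star _ hY, D.bd_asm hs (hY hp.bot_mem)]
  by_contra h0
  obtain ⟨z, hz, hsz⟩ := D.asm_ne_zero (right_ne_zero_of_mul h0)
  exact hsz (hd z (hz.2.2.1 p (hY hp.2.1)))

/-- A simplicial chain can be replaced by one whose elements have small rank, if its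
boundary has this property. -/
theorem exists_reduced (hS : R.IsSpherical) {L : Set P} (hL : IsLowerSet L) {p : P}
    {y₀ : Finset P} (hp : R.Sat y₀ p) {r : ℕ} (hpr : R.ρ p ≤ r) {b : Finset P → ℝ}
    (hb : ∀ Y, y₀ ⊆ Y → b Y ≠ 0 → ∀ t ∈ Y, R.ρ t ≤ r) (N : ℕ) {c : Finset P → ℝ}
    (hc : Supp L y₀ (r + 2) c) (hcb : ∀ Y, y₀ ⊆ Y → bd c Y = b Y)
    (hN : ∀ Y, c Y ≠ 0 → ∀ t ∈ Y, R.ρ t ≤ r + 1 + N) :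
    ∃ c, Supp L y₀ (r + 2) c ∧ (∀ Y, y₀ ⊆ Y → bd c Y = b Y) ∧
      ∀ Y, c Y ≠ 0 → ∀ t ∈ Y, R.ρ t ≤ r + 1 := by
  induction N generalizing c with
  | zero => exact ⟨c, hc, hcb, hN⟩
  | succ N ih =>
    have hex : ∀ q, ∃ e, R.ρ q = r + 1 + (N + 1) → Supp (Set.Iio q) y₀ (r + 2) e ∧
        (e ≠ 0 → q ∈ L) ∧ ∀ y, y₀ ⊆ y → bd e y = link q {q} c y := by
      intro q
      by_cases hqr : R.ρ q = r + 1 + (N + 1)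
      swap
      · exact ⟨0, fun h => absurd h hqr⟩
      by_cases h0 : link q {q} c = 0
      · refine ⟨0, fun _ => ⟨fun y hy => absurd rfl hy, fun h => absurd rfl h, fun y _ => ?_⟩⟩
        rw [h0, map_zero]
      · obtain ⟨y, hy⟩ : ∃ y, link q {q} c y ≠ 0 := by
          by_contra! h
          exact h0 (funext h)
        have hqy : q ∉ y₀ := fun h => by
          have := R.mono.monotone (hp.2.2.1 q h)
          omega
        obtain ⟨h1, h2, h3, h4⟩ := hc.link_top hqy y hy
        have hpq : p < q := h2 (h3 hp.2.1)
        have hqL : q ∈ L := by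
          rw [link_singleton fun t ht => h2 ht] at hy
          exact (hc _ hy).2.1 (by simp)
        obtain ⟨e, he, hec⟩ := hS.exact p q y₀ hpq hp (r + 1) (by omega) _ (hc.link_top hqy)
          (closed_link_top (fun Z hZ hqZ t ht => by
            by_contra hlt
            have hne : t ≠ q := by rintro rfl; exact hlt le_rfl
            have := R.mono (((hc Z hZ).1 ht hqZ hne).resolve_left fun h => hlt h.le)
            have := hN Z hZ t ht
            omega) (fun Z hyZ hqZ => by
              rw [hcb Z hyZ]
              by_contra h
              have := hb Z hyZ h q hqZ
              omega))
        exact ⟨e, fun _ => ⟨he, fun _ => hqL, hec⟩⟩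
    choose e he using hex
    let E : Finset P → ℝ := fun Y =>
      ∑ q, if R.ρ q = r + 1 + (N + 1) ∧ q ∈ Y then e q (Y.erase q) else 0
    have hE : ∀ Y, E Y ≠ 0 → ∃ q ∈ Y, R.ρ q = r + 1 + (N + 1) ∧ e q (Y.erase q) ≠ 0 := by
      intro Y hY
      obtain ⟨q, -, hq⟩ := Finset.exists_ne_zero_of_sum_ne_zero hY
      by_cases h : R.ρ q = r + 1 + (N + 1) ∧ q ∈ Y
      · rw [if_pos h] at hq
        exact ⟨q, h.2, h.1, hq⟩
      · exact absurd (if_neg h) hq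
    have htop : ∀ (Y : Finset P) (q : P), q ∈ Y → R.ρ q = r + 1 + (N + 1) → e q (Y.erase q) ≠ 0 →
        ∀ t ∈ Y, t ≤ q := by
      intro Y q _ hq h0 t ht
      by_cases htq : t = q
      · exact htq.le
      · exact le_of_lt (((he q hq).1 _ h0).2.1 (Finset.mem_erase.2 ⟨htq, ht⟩))
    have hEs : Supp L y₀ (r + 2 + 1) E := by
      intro Y hY
      obtain ⟨q, hqY, hqr, h0⟩ := hE Y hY
      obtain ⟨h1, h2, h3, h4⟩ := (he q hqr).1 _ h0
      have hqL : q ∈ L := (he q hqr).2.1 fun h => h0 (by rw [h]; rfl)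
      have hins := Finset.insert_erase hqY
      refine ⟨?_, fun t ht => hL (htop Y q hqY hqr h0 t ht) hqL,
        h3.trans (Finset.erase_subset _ _), ?_⟩
      · rw [← hins]
        exact isChain_insert h1 fun t ht => h2 ht
      · rw [← hins, Finset.card_insert_of_notMem (by simp), h4]
    have hc's : Supp L y₀ (r + 2) (star y₀ (c + (-1 : ℝ) • bd E)) := by
      intro Y hY
      by_cases hyY : y₀ ⊆ Y
      · rw [star_eq _ hyY, Pi.add_apply, Pi.smul_apply] at hY
        by_cases h : c Y = 0
        · exact hEs.bd hyY fun h' => hY (by simp [h, h'])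
        · exact hc Y h
      · exact absurd (if_neg hyY) hY
    refine ih hc's (fun Y hY => ?_) fun Y hY t ht => ?_
    · rw [bd_star _ hY, map_add, map_smul, bd_bd fun Y hY => (hEs Y hY).1, smul_zero, add_zero,
        hcb Y hY]
    · obtain ⟨h1, h2, h3, h4⟩ := hc's Y hY
      have hle : ∀ τ ∈ Y, R.ρ τ ≤ r + 1 + (N + 1) := by
        intro τ hτ
        rw [star_eq _ h3, Pi.add_apply, Pi.smul_apply] at hY
        by_cases h : c Y = 0
        · obtain ⟨σ, -, hσ⟩ := bd_ne_zero (c := E) (y := Y) fun h' => hY (by simp [h, h'])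
          obtain ⟨q, hqY, hqr, h0⟩ := hE _ hσ
          rw [← hqr]
          exact R.mono.monotone (htop _ q hqY hqr h0 τ (Finset.mem_insert_of_mem hτ))
        · exact hN Y h τ hτ
      by_contra hlt
      have htr : R.ρ t = r + 1 + (N + 1) := by
        have := hle t ht
        omega
      have hYt : ∀ τ ∈ Y.erase t, τ < t := by
        intro τ hτ
        obtain ⟨h5, h6⟩ := Finset.mem_erase.1 hτ
        refine (h1 h6 ht h5).resolve_right fun h => ?_
        have := R.mono h
        have := hle τ h6
        omega
      have hbE : bd E Y = bd (e t) (Y.erase t) := by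
        refine bd_of_cone ht (fun y hy τ hτ => ((he t htr).1 y hy).2.1 hτ) fun σ _ => ?_
        have htσ : t ∈ insert σ Y := Finset.mem_insert_of_mem ht
        simp only [E]
        rw [Finset.sum_eq_single t, if_pos ⟨htr, htσ⟩]
        · intro q _ hqt
          split_ifs with hq
          · by_contra h0
            have h5 := ((he q hq.1).1 _ h0).2.1 (Finset.mem_erase.2 ⟨hqt.symm, htσ⟩)
            have := R.mono (Set.mem_Iio.1 h5)
            omega
          · rfl
        · simp
      have hy₀ : y₀ ⊆ Y.erase t := fun τ hτ => by
        refine Finset.mem_erase.2 ⟨?_, h3 hτ⟩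
        rintro rfl
        have := R.mono.monotone (hp.2.2.1 _ hτ)
        omega
      rw [star_eq _ h3, Pi.add_apply, Pi.smul_apply, hbE, (he t htr).2.2 _ hy₀,
        link_singleton hYt, Finset.insert_erase ht, smul_eq_mul] at hY
      exact hY (by ring)

/-- Exactness of the cellular chain complex of a lower set. -/
theorem exists_del_eq (hS : R.IsSpherical) {L : Set P} (hL : IsLowerSet L) {p : P}
    {y₀ : Finset P} (hp : R.Sat y₀ p) {r : ℕ} (hex : HEx L y₀ (r + 1)) {s : P → ℝ}
    (hs : ∀ x, ¬(p ≤ x ∧ x ∈ L ∧ R.ρ x = r) → s x = 0) (hd : ∀ x, p ≤ x → D.del s x = 0) :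
    ∃ t : P → ℝ, (∀ x, ¬(p ≤ x ∧ x ∈ L ∧ R.ρ x = r + 1) → t x = 0) ∧
      ∀ x, p ≤ x → D.del t x = s x := by
  have hs' : ∀ x, s x ≠ 0 → p ≤ x ∧ x ∈ L ∧ R.ρ x = r := fun x hx => by
    by_contra h
    exact hx (hs x h)
  by_cases hpr : R.ρ p ≤ r
  swap
  · refine ⟨0, fun _ _ => rfl, fun x hx => ?_⟩
    have : s x = 0 := by
      by_contra h
      obtain ⟨h1, -, h2⟩ := hs' x h
      have := R.mono.monotone h1
      omega
    rw [this, del]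
    exact Finset.sum_eq_zero fun z _ => mul_zero _
  obtain ⟨c, hc, hcb⟩ := hex _ (D.supp_star_asm hL fun x hx => (hs' x hx).2)
    (D.closed_star_asm hp (fun x hx => (hs' x hx).2.2) hd)
  have hb : ∀ Y, star y₀ (D.asm s) Y ≠ 0 → ∀ t ∈ Y, R.ρ t ≤ r := by
    intro Y hY t ht
    by_cases hyY : y₀ ⊆ Y
    · rw [star_eq _ hyY] at hY
      obtain ⟨z, hz, hsz⟩ := D.asm_ne_zero hY
      rw [← (hs' z hsz).2.2]
      exact R.mono.monotone (hz.2.2.1 t ht)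
    · exact absurd (if_neg hyY) hY
  obtain ⟨c, hc, hcb, hcr⟩ := exists_reduced hS hL hp hpr (fun Y _ => hb Y)
    (Finset.univ.sup R.ρ) hc hcb fun Y _ t _ =>
      (Finset.le_sup (f := R.ρ) (Finset.mem_univ t)).trans (by omega)
  obtain ⟨t, ht0, ht⟩ := D.exists_asm hp hc hcr fun Y hY q hq hqr => by
    rw [hcb Y hY]
    by_contra h
    have := hb Y h q hq
    omega
  refine ⟨fun x => (-1) ^ (r + 1) * t x, fun x hx => mul_eq_zero_of_right _ (ht0 x hx), fun x hx => ?_⟩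
  have h1 : ∀ Y, y₀ ⊆ Y → D.asm (fun z => (-1) ^ (r + 1) * D.del t z) Y = D.asm s Y := by
    intro Y hY
    rw [D.asm_smul, ← D.bd_asm (fun z hz => ?_) (hY hp.bot_mem), ← star_eq (D.asm s) hY,
      ← hcb Y hY, bd_apply, bd_apply]
    · refine Finset.sum_congr rfl fun σ _ => ?_
      rw [ht _ (hY.trans (Finset.subset_insert _ _))]
    · by_contra h
      exact hz (ht0 z fun h' => h h'.2.2)
  rw [← D.eq_of_asm hp h1 hx, del, del, Finset.mul_sum]
  exact Finset.sum_congr rfl fun z _ => by ring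

/-- The top cellular cycles of a lower set form a line. -/
theorem exists_top_cycle {L : Set P} (hL : IsLowerSet L) {p : P}
    {y₀ : Finset P} (hp : R.Sat y₀ p) {r : ℕ} (hLr : ∀ x ∈ L, R.ρ x ≤ r)
    (htop : HTop L y₀ (r + 1)) :
    ∃ s : P → ℝ, (∀ x, ¬(p ≤ x ∧ x ∈ L ∧ R.ρ x = r) → s x = 0) ∧ (∀ x, p ≤ x → D.del s x = 0) ∧
      s ≠ 0 ∧ ∀ t : P → ℝ, (∀ x, ¬(p ≤ x ∧ x ∈ L ∧ R.ρ x = r) → t x = 0) →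
        (∀ x, p ≤ x → D.del t x = 0) → ∃ a : ℝ, t = a • s := by
  obtain ⟨c, hc, hcl, hne, hall⟩ := htop
  obtain ⟨s, hs0, hs⟩ := D.exists_asm hp hc (fun Y hY t ht => hLr t ((hc Y hY).2.1 ht))
    fun Y hY _ _ _ => hcl Y hY
  have hs' : ∀ x, s x ≠ 0 → R.ρ x = r := fun x hx => by
    by_contra h
    exact hx (hs0 x fun h' => h h'.2.2)
  refine ⟨s, hs0, fun x hx => ?_, ?_, fun t ht0 ht => ?_⟩
  · refine D.eq_of_asm hp (t := 0) (fun Y hY => ?_) hx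
    have h1 := hcl Y hY
    have h2 : bd c Y = bd (D.asm s) Y := by
      rw [bd_apply, bd_apply]
      refine Finset.sum_congr rfl fun σ _ => ?_
      rw [hs _ (hY.trans (Finset.subset_insert _ _))]
    rw [h2, D.bd_asm hs' (hY hp.bot_mem), mul_eq_zero] at h1
    rw [h1.resolve_left (by simp)]
    exact (Finset.sum_eq_zero fun z _ => by simp).symm
  · rintro rfl
    refine hne (funext fun Y => ?_)
    by_contra h
    rw [hs Y (hc Y h).2.2.1] at h
    obtain ⟨z, -, hz⟩ := D.asm_ne_zero h
    exact hz rfl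
  · have ht' : ∀ x, t x ≠ 0 → p ≤ x ∧ x ∈ L ∧ R.ρ x = r := fun x hx => by
      by_contra h
      exact hx (ht0 x h)
    obtain ⟨a, ha⟩ := hall _ (D.supp_star_asm hL fun x hx => (ht' x hx).2)
      (D.closed_star_asm hp (fun x hx => (ht' x hx).2.2) ht)
    refine ⟨a, funext fun x => ?_⟩
    by_cases hx : p ≤ x
    · refine D.eq_of_asm hp (fun Y hY => ?_) hx
      have h1 : (a • s) = fun z => a * s z := rfl
      rw [h1, D.asm_smul, ← hs Y hY, ← star_eq (D.asm t) hY, ha]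
      rfl
    · rw [ht0 x fun h => hx h.1, Pi.smul_apply, hs0 x fun h => hx h.1, smul_zero]

end Ranking.Orientation

end

section

theorem Submodule.finrank_eq_one_of_forall_mem {E : Type*} [AddCommGroup E] [Module ℝ E]
    {S : Submodule ℝ E} {c : E} (hc : c ∈ S) (hne : c ≠ 0) (h : ∀ b ∈ S, ∃ a : ℝ, b = a • c) :
    Module.finrank ℝ S = 1 := by
  refine finrank_eq_one ⟨c, hc⟩ (fun h0 => hne (congrArg Subtype.val h0)) fun b => ?_
  obtain ⟨a, ha⟩ := h b b.2
  exact ⟨a, Subtype.ext ha.symm⟩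

namespace CellIncidence

variable {P : Type u} [Fintype P] [PartialOrder P] (I : CellIncidence P)

/-- Exactness in degree `r` of the cochain complex of the elements of `L` above `p`. -/
def UpExactOn (L : Set P) (p : P) (r : ℕ) : Prop :=
  ∀ s : P → ℝ, (∀ x, ¬ (p ≤ x ∧ x ∈ L ∧ I.ρ x = r) → s x = 0) →
    (∀ y ∈ L, ∑ x, I.ε x y * s x = 0) →
    ∃ t : P → ℝ, (∀ x, ¬ (p ≤ x ∧ x ∈ L ∧ I.ρ x + 1 = r) → t x = 0) ∧
      ∀ y ∈ L, ∑ x, I.ε x y * t x = s y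

theorem upExactOn_of_notMem {L : Set P} (hL : IsLowerSet L) {p : P} (hp : p ∉ L) (r : ℕ) :
    I.UpExactOn L p r := by
  intro s hs _
  have h0 : ∀ x, s x = 0 := fun x => hs x fun h => hp (hL h.1 h.2.1)
  exact ⟨0, fun _ _ => rfl, fun y _ => by simp [h0]⟩

theorem upExactOn_Iic {p z : P} (h : p < z) (r : ℕ) : I.UpExactOn (Set.Iic z) p r :=
  fun s hs hd => I.interval_exact p z h r s hs hd

theorem upExactOn_compl {B : Set P} (hB : IsLowerSet B) {p : P} {r : ℕ}
    (hU : I.UpExactOn Set.univ p r) (hBr : p ∈ B → ∀ j, r = j + 1 → I.UpExactOn B p j) :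
    I.UpExactOn Bᶜ p r := by
  intro s hs hd
  have hd' : ∀ y ∈ (Set.univ : Set P), ∑ x, I.ε x y * s x = 0 := by
    intro y _
    by_cases hy : y ∈ B
    · refine Finset.sum_eq_zero fun x _ => ?_
      by_cases hε : I.ε x y = 0
      · rw [hε, zero_mul]
      · rw [hs x fun h => h.2.1 (hB (I.ε_lt x y hε).le hy), mul_zero]
    · exact hd y hy
  obtain ⟨t, ht0, ht⟩ := hU s (fun x hx => hs x fun h => hx ⟨h.1, trivial, h.2.2⟩) hd'
  by_cases hp : p ∈ B
  swap
  · exact ⟨t, fun x hx => ht0 x fun h => hx ⟨h.1, fun hx => hp (hB h.1 hx), h.2.2⟩,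
      fun y _ => ht y trivial⟩
  by_cases hr : r = 0
  · exact ⟨t, fun x hx => ht0 x fun h => by omega, fun y _ => ht y trivial⟩
  obtain ⟨j, hj⟩ : ∃ j, r = j + 1 := ⟨r - 1, by omega⟩
  obtain ⟨t', ht'0, ht'⟩ := hBr hp j hj (fun x => if x ∈ B then t x else 0)
    (fun x hx => by
      by_cases hxB : x ∈ B
      · rw [if_pos hxB]
        exact ht0 x fun h => hx ⟨h.1, hxB, by omega⟩
      · exact if_neg hxB)
    (fun y hy => by
      have h1 : ∑ x, I.ε x y * (if x ∈ B then t x else 0) = ∑ x, I.ε x y * t x := by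
        refine Finset.sum_congr rfl fun x _ => ?_
        by_cases hε : I.ε x y = 0
        · rw [hε, zero_mul, zero_mul]
        · rw [if_pos (hB (I.ε_lt x y hε).le hy)]
      rw [h1, ht y trivial]
      exact hs y fun h => h.2.1 hy)
  refine ⟨fun y => t y - ∑ x, I.ε x y * t' x, fun y hy => ?_, fun y _ => ?_⟩
  · by_cases hyB : y ∈ B
    · have := ht' y hyB
      rw [if_pos hyB] at this
      simp only [this, sub_self]
    · have h1 : t y = 0 := ht0 y fun h => hy ⟨h.1, hyB, h.2.2⟩
      simp only [h1, zero_sub, neg_eq_zero]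
      refine Finset.sum_eq_zero fun x _ => ?_
      by_cases hε : I.ε x y = 0
      · rw [hε, zero_mul]
      · rw [ht'0 x fun h => hy ⟨h.1.trans (I.ε_lt x y hε).le, hyB, ?_⟩, mul_zero]
        have := I.ε_rank x y hε
        omega
  · simp only [mul_sub, Finset.sum_sub_distrib, ht y trivial, Finset.mul_sum]
    rw [Finset.sum_comm]
    have h1 : ∀ x, ∑ z, I.ε z y * (I.ε x z * t' x) = 0 := by
      intro x
      rw [← zero_mul (t' x), ← I.ε_sq x y, Finset.sum_mul]
      exact Finset.sum_congr rfl fun z _ => by ring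
    simp [h1]

/-- The sheaf which is constant on a convex set and zero elsewhere. -/
@[reducible] def indicator (L : Set P) (hL : L.OrdConnected) : CellSheaf P where
  W x := {_u : PUnit.{u + 1} // x ∈ L} → ℝ
  φ x y :=
    { toFun := fun w _ => if h : x ∈ L then w ⟨⟨⟩, h⟩ else 0
      map_add' := fun w w' => by ext; by_cases h : x ∈ L <;> simp [h]
      map_smul' := fun a w => by ext; by_cases h : x ∈ L <;> simp [h] }
  φ_id x w := by
    ext ⟨_, h⟩
    simp [h]
  φ_comp x y z hxy hyz w := by
    ext ⟨_, hz⟩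
    by_cases hx : x ∈ L
    · simp [hx, hL.out hx hz ⟨hxy, hyz⟩]
    · simp [hx]

variable {L : Set P} (hL : L.OrdConnected)

omit [Fintype P] in
theorem finrank_indicator (x : P) :
    (Module.finrank ℝ ((indicator L hL).W x) : ℤ) = if x ∈ L then 1 else 0 := by
  have h1 : Module.finrank ℝ ((indicator L hL).W x)
      = Fintype.card {_u : PUnit.{u + 1} // x ∈ L} :=
    Module.finrank_fintype_fun_eq_card ℝ
  rw [h1]
  split_ifs with h <;> simp [h]

theorem UpExactOn.indicator {p : P} {r : ℕ} (h : I.UpExactOn L p r) :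
    (indicator L hL).UpExact I p r := by
  intro s hs hd
  let a : P → ℝ := fun x => if h : x ∈ L then s x ⟨⟨⟩, h⟩ else 0
  have hcob : ∀ (t : ∀ x, (CellIncidence.indicator L hL).W x) (y : P) (hy : y ∈ L),
      (CellIncidence.indicator L hL).cob I t y ⟨⟨⟩, hy⟩
        = ∑ x, I.ε x y * if h : x ∈ L then t x ⟨⟨⟩, h⟩ else 0 := by
    intro t y hy
    rw [CellSheaf.cob_apply, Finset.sum_apply]
    rfl
  obtain ⟨b, hb0, hb⟩ := h a (fun x hx => by
      by_cases hxL : x ∈ L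
      · have := hs x fun h => hx ⟨h.1, hxL, h.2⟩
        simp only [a, dif_pos hxL, this]
        rfl
      · exact dif_neg hxL) (fun y hy => by
      rw [← hcob s y hy, hd]; rfl)
  refine ⟨fun x _ => b x, fun x hx => ?_, ?_⟩
  · ext ⟨_, _⟩
    exact hb0 x fun h => hx ⟨h.1, h.2.2⟩
  · ext y ⟨_, hy⟩
    rw [hcob _ y hy]
    have h1 := hb y hy
    simp only [a, dif_pos hy] at h1
    rw [← h1]
    refine Finset.sum_congr rfl fun x _ => ?_
    by_cases hx : x ∈ L
    · rw [dif_pos hx]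
    · rw [dif_neg hx, hb0 x fun h => hx h.2.1]

/-- The coefficients of a dual chain of an indicator sheaf. -/
def coeff : (∀ z, ((indicator L hL).W z →ₗ[ℝ] ℝ)) →ₗ[ℝ] (P → ℝ) where
  toFun c z := c z fun _ => 1
  map_add' _ _ := rfl
  map_smul' _ _ := rfl

omit [Fintype P] in
theorem coeff_apply (c : ∀ z, ((indicator L hL).W z →ₗ[ℝ] ℝ)) (z : P) :
    coeff hL c z = c z fun _ => 1 := rfl

omit [Fintype P] in
theorem coeff_eq_zero_iff {c : ∀ z, ((indicator L hL).W z →ₗ[ℝ] ℝ)} {z : P} :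
    coeff hL c z = 0 ↔ c z = 0 := by
  constructor
  · intro h
    refine LinearMap.ext fun w => ?_
    by_cases hz : z ∈ L
    · have : w = (w ⟨⟨⟩, hz⟩) • (fun _ => 1 : (indicator L hL).W z) := by
        ext ⟨_, _⟩
        exact (mul_one _).symm
      rw [this, map_smul]
      rw [coeff_apply] at h
      rw [h]; simp
    · have : w = 0 := by
        ext ⟨_, h⟩
        exact absurd h hz
      rw [this, map_zero, map_zero]
  · intro h
    rw [coeff_apply, h]; rfl

omit [Fintype P] in
theorem coeff_of_notMem (c : ∀ z, ((indicator L hL).W z →ₗ[ℝ] ℝ)) {z : P} (hz : z ∉ L) :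
    coeff hL c z = 0 := by
  have : (fun _ => 1 : (indicator L hL).W z) = 0 := by
    ext ⟨_, h⟩
    exact absurd h hz
  rw [coeff_apply, this, map_zero]

omit [Fintype P] in
theorem exists_coeff {s : P → ℝ} (hs : ∀ z, z ∉ L → s z = 0) : ∃ c, coeff hL c = s := by
  refine ⟨fun z => s z •
    { toFun := fun w => if h : z ∈ L then w ⟨⟨⟩, h⟩ else 0
      map_add' := fun w w' => by by_cases h : z ∈ L <;> simp [h]
      map_smul' := fun a w => by by_cases h : z ∈ L <;> simp [h] }, ?_⟩
  ext z
  by_cases hz : z ∈ L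
  · simp [coeff_apply, hz]
  · rw [coeff_of_notMem hL _ hz, hs z hz]

theorem coeff_bdy (c : ∀ z, ((indicator L hL).W z →ₗ[ℝ] ℝ)) {x : P} (hx : x ∈ L) :
    coeff hL ((indicator L hL).bdy I c) x = ∑ z, I.ε x z * coeff hL c z := by
  rw [coeff_apply, CellSheaf.bdy_apply]
  refine Finset.sum_congr rfl fun z _ => ?_
  rw [coeff_apply]
  congr 2
  ext ⟨_, hz⟩
  exact dif_pos hx

theorem mem_cyc_indicator (hLl : IsLowerSet L) {r : ℕ} {p : P}
    {c : ∀ z, ((indicator L hL).W z →ₗ[ℝ] ℝ)} :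
    c ∈ (indicator L hL).cyc I r p ↔
      (∀ z, ¬ (p ≤ z ∧ z ∈ L ∧ I.ρ z = r) → coeff hL c z = 0) ∧
        ∀ x, p ≤ x → ∑ z, I.ε x z * coeff hL c z = 0 := by
  rw [CellSheaf.mem_cyc]
  refine and_congr ⟨fun h z hz => ?_, fun h z hz => ?_⟩ (forall₂_congr fun x _ => ?_)
  · by_cases hzL : z ∈ L
    · rw [coeff_eq_zero_iff]
      exact h z fun h' => hz ⟨h'.1, hzL, h'.2⟩
    · exact coeff_of_notMem hL c hzL
  · rw [← coeff_eq_zero_iff]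
    exact h z fun h' => hz ⟨h'.1, h'.2.2⟩
  · by_cases hx : x ∈ L
    · rw [← coeff_bdy I hL c hx, coeff_eq_zero_iff]
    · rw [← coeff_eq_zero_iff, coeff_of_notMem hL _ hx]
      refine iff_of_true rfl (Finset.sum_eq_zero fun z _ => ?_)
      by_cases hε : I.ε x z = 0
      · rw [hε, zero_mul]
      · rw [coeff_of_notMem hL c fun hz => hx (hLl (I.ε_lt x z hε).le hz), mul_zero]

omit [Fintype P] in
theorem coeff_injective : Function.Injective (coeff hL) := by
  rw [← LinearMap.ker_eq_bot, LinearMap.ker_eq_bot']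
  intro c hc
  ext1 z
  exact (coeff_eq_zero_iff hL).1 (congrFun hc z)

/-- The sum of alternating signs of the elements of `L` above `p` vanishes, if the complex of
these elements is acyclic. -/
theorem dualWeight_indicator_eq_zero (hLl : IsLowerSet L) {m : ℕ} {p : P}
    (hex : ∀ r < m, I.UpExactOn L p r) (hm : ∀ z ∈ L, I.ρ z ≠ m) :
    I.dualWeight (fun z => if z ∈ L then 1 else 0) m p = 0 := by
  have hL := hLl.ordConnected
  have h1 := CellSheaf.finrank_cyc (F := indicator L hL) (I := I) (x := p) (m := m)
    fun r hr => ((hex r hr).indicator I hL).downExact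
  have h2 : (indicator L hL).cyc I m p = ⊥ := by
    rw [eq_bot_iff]
    intro c hc
    rw [mem_cyc_indicator I hL hLl] at hc
    rw [Submodule.mem_bot]
    refine coeff_injective hL ?_
    rw [map_zero]
    ext z
    exact hc.1 z fun h => hm z h.2.1 h.2.2
  rw [h2, finrank_bot] at h1
  exact (h1.trans (congrArg (I.dualWeight · m p) (funext (finrank_indicator hL)))).symm

theorem dualWeight_indicator_eq_one (hLl : IsLowerSet L) {m : ℕ} {p : P}
    (hex : ∀ r < m, I.UpExactOn L p r)
    (htop : ∃ s : P → ℝ, (∀ x, ¬(p ≤ x ∧ x ∈ L ∧ I.ρ x = m) → s x = 0) ∧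
      (∀ x, p ≤ x → ∑ z, I.ε x z * s z = 0) ∧ s ≠ 0 ∧
      ∀ t : P → ℝ, (∀ x, ¬(p ≤ x ∧ x ∈ L ∧ I.ρ x = m) → t x = 0) →
        (∀ x, p ≤ x → ∑ z, I.ε x z * t z = 0) → ∃ a : ℝ, t = a • s) :
    I.dualWeight (fun z => if z ∈ L then 1 else 0) m p = 1 := by
  have hL := hLl.ordConnected
  have h1 := CellSheaf.finrank_cyc (F := indicator L hL) (I := I) (x := p) (m := m)
    fun r hr => ((hex r hr).indicator I hL).downExact
  have h2 : Module.finrank ℝ ((indicator L hL).cyc I m p) = 1 := by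
    obtain ⟨s, hs, hd, hne, hall⟩ := htop
    obtain ⟨c, rfl⟩ := exists_coeff hL (s := s) fun z hz => hs z fun h => hz h.2.1
    refine Submodule.finrank_eq_one_of_forall_mem ((mem_cyc_indicator I hL hLl).2 ⟨hs, hd⟩)
      (fun h => hne ?_) fun b hb => ?_
    · rw [h, map_zero]
    · rw [mem_cyc_indicator I hL hLl] at hb
      obtain ⟨a, ha⟩ := hall _ hb.1 hb.2
      exact ⟨a, coeff_injective hL (by rw [ha]; exact (map_smul _ _ _).symm)⟩
  rw [h2] at h1
  exact (h1.trans (congrArg (I.dualWeight · m p) (funext (finrank_indicator hL)))).symm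

theorem isEulerian : I.IsEulerian := by
  intro x z hxz
  have h := I.dualWeight_indicator_eq_zero (isLowerSet_Iic z) (m := I.ρ z + 1)
    (fun r _ => I.upExactOn_Iic hxz r) fun y hy => by
      have := I.ρ_mono.monotone (Set.mem_Iic.1 hy)
      omega
  rw [dualWeight] at h
  have h1 : (-1 : ℤ) ^ (I.ρ z + 1) * ∑ y, (if x ≤ y ∧ y ≤ z then (-1 : ℤ) ^ I.ρ y else 0) = 0 := by
    refine Eq.trans ?_ h
    rw [Finset.mul_sum]
    refine Finset.sum_congr rfl fun y _ => ?_
    by_cases hy : y ≤ z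
    · have := I.ρ_mono.monotone hy
      by_cases hxy : x ≤ y
      · rw [if_pos ⟨hxy, hy⟩, if_pos ⟨hxy, by omega⟩, if_pos (show y ∈ Set.Iic z from hy),
          pow_add _ (I.ρ z + 1), mul_one]
      · rw [if_neg fun h => hxy h.1, if_neg fun h => hxy h.1, mul_zero]
    · rw [if_neg fun h => hy h.2, if_neg (show y ∉ Set.Iic z from hy), mul_zero, mul_zero, ite_self]
  exact (mul_eq_zero.1 h1).resolve_left (pow_ne_zero _ (by norm_num))

end CellIncidence

end

section

namespace Ranking.Orientation

open OrderComplex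

variable {P : Type u} [PartialOrder P] [OrderBot P] [Fintype P] {R : Ranking P} (D : R.Orientation)

/-- Exactness of the cellular cochain complex of a lower set. -/
theorem exists_sum_eq (hS : R.IsSpherical) {L : Set P} (hL : IsLowerSet L) {p : P}
    {y₀ : Finset P} (hp : R.Sat y₀ p) {r : ℕ} (hex : HEx L y₀ (r + 1)) {s : P → ℝ}
    (hs : ∀ x, ¬(p ≤ x ∧ x ∈ L ∧ R.ρ x = r) → s x = 0)
    (hd : ∀ y ∈ L, ∑ x, D.eps x y * s x = 0) :
    ∃ t : P → ℝ, (∀ x, ¬(p ≤ x ∧ x ∈ L ∧ R.ρ x + 1 = r) → t x = 0) ∧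
      ∀ y ∈ L, ∑ x, D.eps x y * t x = s y := by
  obtain ⟨A, hA⟩ : ∃ A : P → Prop, ∀ x, A x ↔ p ≤ x ∧ x ∈ L ∧ R.ρ x = r := ⟨_, fun _ => Iff.rfl⟩
  obtain ⟨A', hA'⟩ : ∃ A' : P → Prop, ∀ x, A' x ↔ p ≤ x ∧ x ∈ L ∧ R.ρ x + 1 = r :=
    ⟨_, fun _ => Iff.rfl⟩
  simp only [← hA] at hs
  simp only [← hA']
  let cb : (P → ℝ) →ₗ[ℝ] (P → ℝ) :=
    LinearMap.pi fun y => ∑ x, D.eps x y • LinearMap.proj x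
  have hcb : ∀ t y, cb t y = ∑ x, D.eps x y * t x := fun t y => by simp [cb]
  let g : (P → ℝ) →ₗ[ℝ] (P → ℝ) := mask A ∘ₗ cb ∘ₗ mask A'
  have hg : ∀ t y, g t y = if A y then ∑ x, D.eps x y * (if A' x then t x else 0) else 0 := by
    intro t y
    simp only [g, LinearMap.comp_apply, mask_apply, hcb]
  have hsg : s ∈ LinearMap.range g := by
    by_contra hns
    obtain ⟨f, hfs, hf⟩ := Submodule.exists_le_ker_of_notMem hns
    have hexp : ∀ v : P → ℝ, f v = ∑ y, v y * f (Pi.single y 1) := fun v => by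
      conv_lhs => rw [pi_eq_sum_univ' v, map_sum]
      simp
    let c : P → ℝ := fun y => if A y then f (Pi.single y 1) else 0
    have hcd : ∀ x, p ≤ x → D.del c x = 0 := by
      intro x hpx
      by_cases hx : A' x
      · have h1 : f (g (Pi.single x 1)) = 0 := hf ⟨_, rfl⟩
        rw [hexp] at h1
        rw [← h1]
        refine Finset.sum_congr rfl fun y _ => ?_
        rw [hg]
        by_cases hy : A y
        · simp only [c, if_pos hy]
          rw [Finset.sum_eq_single x]
          · simp [hx]
          · intro z _ hz
            simp [Pi.single_eq_of_ne hz]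
          · simp
        · simp [c, hy]
      · refine Finset.sum_eq_zero fun y _ => ?_
        by_cases hε : D.eps x y = 0
        · rw [hε, zero_mul]
        · have : ¬ A y := fun hy => hx <| (hA' x).2 ⟨hpx,
            hL (D.lt_of_eps hε).le ((hA y).1 hy).2.1, (D.rank_of_eps hε).symm.trans ((hA y).1 hy).2.2⟩
          simp [c, this]
    obtain ⟨t, ht0, ht⟩ := D.exists_del_eq hS hL hp hex (s := c)
      (fun x hx => if_neg ((hA x).not.2 hx)) hcd
    refine hfs ?_
    have h2 : f s = ∑ y, s y * D.del t y := by
      rw [hexp]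
      refine Finset.sum_congr rfl fun y _ => ?_
      by_cases hy : A y
      · rw [ht y ((hA y).1 hy).1]
        simp only [c, if_pos hy]
      · rw [hs y hy, zero_mul, zero_mul]
    rw [h2]
    simp only [del, Finset.mul_sum]
    rw [Finset.sum_comm]
    refine Finset.sum_eq_zero fun z _ => ?_
    by_cases hz : z ∈ L
    · rw [← mul_zero (t z), ← hd z hz, Finset.mul_sum]
      exact Finset.sum_congr rfl fun y _ => by ring
    · simp [ht0 z fun h => hz h.2.1]
  obtain ⟨t, ht⟩ := hsg
  refine ⟨mask A' t, fun x hx => if_neg hx, fun y hy => ?_⟩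
  have h1 := congrFun ht y
  rw [hg] at h1
  by_cases hyA : A y
  · rw [if_pos hyA] at h1
    exact h1
  · rw [hs y hyA]
    refine Finset.sum_eq_zero fun x _ => ?_
    by_cases hε : D.eps x y = 0
    · rw [hε, zero_mul]
    · have : ¬ A' x := fun hx => hyA <| (hA y).2
        ⟨((hA' x).1 hx).1.trans (D.lt_of_eps hε).le, hy, (D.rank_of_eps hε).trans ((hA' x).1 hx).2.2⟩
      rw [mask_apply, if_neg this, mul_zero]

/-- The incidence numbers of an orientation. -/
def toIncidence (hS : R.IsSpherical) : CellIncidence P where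
  ρ := R.ρ
  ρ_mono := R.mono
  ε := D.eps
  ε_lt _ _ := D.lt_of_eps
  ε_rank _ _ := D.rank_of_eps
  ε_sq := D.eps_sq
  interval_exact p z hpz j s hs hd := by
    obtain ⟨y₀, hy₀⟩ := R.exists_sat p
    exact D.exists_sum_eq hS (isLowerSet_Iic z) hy₀
      (HEx_Iic (fun t ht => (hy₀.2.2.1 t ht).trans_lt hpz) _) hs hd

theorem upExactOn (hS : R.IsSpherical) {L : Set P} (hL : IsLowerSet L) {p : P}
    {y₀ : Finset P} (hp : R.Sat y₀ p) {r : ℕ} (hex : HEx L y₀ (r + 1)) :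
    (D.toIncidence hS).UpExactOn L p r :=
  fun _ hs hd => D.exists_sum_eq hS hL hp hex hs hd

end Ranking.Orientation

end

section

namespace Ranking

open OrderComplex

variable {P : Type u} [PartialOrder P] [OrderBot P] [Fintype P] (R : Ranking P)

/-- The order complex of a graded poset of rank `n + 1` is a homology ball whose boundary is the
order complex of `B`. -/
structure IsBall (B : Set P) (n : ℕ) : Prop where
  isLowerSet : IsLowerSet B
  bot_mem : ⊥ ∈ B
  rank_le : ∀ x, R.ρ x ≤ n + 1
  exists_top : ∀ x, ∃ m, x ≤ m ∧ R.ρ m = n + 1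
  rank_bdry_le : ∀ x ∈ B, R.ρ x ≤ n
  exact : ∀ y : Finset P, ⊥ ∈ y → IsChain (· < ·) (y : Set P) → ∀ k, (k ≠ n + 2 ∨ ↑y ⊆ B) →
    HEx Set.univ y k
  top : ∀ y : Finset P, ⊥ ∈ y → IsChain (· < ·) (y : Set P) → ¬ ↑y ⊆ B → HTop Set.univ y (n + 2)
  exact_bdry : ∀ y : Finset P, ⊥ ∈ y → IsChain (· < ·) (y : Set P) → ↑y ⊆ B → ∀ k, k ≠ n + 1 →
    HEx B y k
  top_bdry : ∀ y : Finset P, ⊥ ∈ y → IsChain (· < ·) (y : Set P) → ↑y ⊆ B → HTop B y (n + 1)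

variable {R}

omit [OrderBot P] [Fintype P] in
theorem isChain_union {x u : Finset P} (hx : IsChain (· < ·) (x : Set P))
    (hu : IsChain (· < ·) (u : Set P)) (h : ∀ s ∈ x, ∀ t ∈ u, s < t) :
    IsChain (· < ·) ((x ∪ u : Finset P) : Set P) := by
  rintro s hs t ht hne
  simp only [Finset.coe_union, Set.mem_union, Finset.mem_coe] at hs ht
  rcases hs with hs | hs <;> rcases ht with ht | ht
  · exact hx hs ht hne
  · exact Or.inl (h s hs t ht)
  · exact Or.inr (h t ht s hs)
  · exact hu hs ht hne

namespace IsBall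

variable {B : Set P} {n : ℕ} (hB : R.IsBall B n)

include hB

theorem isSpherical : R.IsSpherical := by
  have key : ∀ p q x, p < q → R.Sat x p → ∃ u : Finset P, IsChain (· < ·) (u : Set P) ∧ q ∈ u ∧
      (∀ t ∈ u, q ≤ t) ∧ (∀ t ∈ x, t < q) ∧ u.card + R.ρ q = n + 2 ∧
      IsChain (· < ·) ((x ∪ u : Finset P) : Set P) ∧ ⊥ ∈ x ∪ u ∧ ¬ ((x ∪ u : Finset P) : Set P) ⊆ B ∧
      ∀ Y : Finset P, IsChain (· < ·) (Y : Set P) → (Y : Set P) ⊆ Set.univ → u ⊆ Y →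
        ∀ σ ∈ Y, σ ∉ u → σ < q := by
    intro p q x hpq hx
    obtain ⟨m, hqm, hm⟩ := hB.exists_top q
    obtain ⟨u, hu, hqu, hmu, hut, hcard⟩ := R.exists_upper hqm
    have hxq : ∀ t ∈ x, t < q := fun t ht => (hx.2.2.1 t ht).trans_lt hpq
    refine ⟨u, hu, hqu, fun t ht => (hut t ht).1, hxq, by omega,
      isChain_union hx.1 hu fun s hs t ht => (hxq s hs).trans_le (hut t ht).1,
      Finset.mem_union_left _ hx.bot_mem, fun h => ?_, fun Y hY _ huY σ hσ hσu => ?_⟩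
    · have := hB.rank_bdry_le m (h (Finset.mem_coe.2 (Finset.mem_union_right _ hmu)))
      omega
    · by_contra hσq
      have hqσ : q < σ := by
        rcases eq_or_ne σ q with rfl | hne
        · exact absurd hqu hσu
        · exact (hY (Finset.mem_coe.2 hσ) (Finset.mem_coe.2 (huY hqu)) hne).resolve_left hσq
      have h1 := card_add_le (R := R) (Y := insert σ u) (m := R.ρ q) (N := n + 2)
        (isChain_mono hY (Finset.insert_subset hσ huY)) (fun t ht => ?_) (by omega)
      · rw [Finset.card_insert_of_notMem hσu] at h1
        omega
      · have := hB.rank_le t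
        refine ⟨?_, by omega⟩
        rcases Finset.mem_insert.1 ht with rfl | ht
        · exact (R.mono hqσ).le
        · exact R.mono.monotone (hut t ht).1
  refine ⟨fun p q x hpq hx k hk => ?_, fun p q x hpq hx => ?_⟩
  · obtain ⟨u, hu, hqu, hut, hxq, hcard, hch, hbot, _, hsat⟩ := key p q x hpq hx
    exact HEx.transfer hut hxq (Set.subset_univ _) (Set.subset_univ _) hu hsat
      (hB.exact _ hbot hch _ (Or.inl (by omega)))
  · obtain ⟨u, hu, hqu, hut, hxq, hcard, hch, hbot, hnB, hsat⟩ := key p q x hpq hx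
    refine HTop.transfer hut hxq (Set.subset_univ _) (Set.subset_univ _) hu hsat ?_
    rw [show R.ρ q + u.card = n + 2 by omega]
    exact hB.top _ hbot hch hnB

theorem sat_subset {y : Finset P} {p : P} (h : R.Sat y p) (hp : p ∈ B) : (y : Set P) ⊆ B :=
  fun t ht => hB.isLowerSet (h.2.2.1 t ht) hp

variable (D : R.Orientation)

theorem upExactOn_univ {p : P} {r : ℕ} (h : r < n + 1 ∨ p ∈ B) :
    (D.toIncidence hB.isSpherical).UpExactOn Set.univ p r := by
  obtain ⟨y, hy⟩ := R.exists_sat p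
  exact D.upExactOn _ isLowerSet_univ hy (hB.exact y hy.bot_mem hy.1 _
    (h.imp (fun h => by omega) (hB.sat_subset hy)))

theorem upExactOn_bdry {p : P} {r : ℕ} (h : r ≠ n) :
    (D.toIncidence hB.isSpherical).UpExactOn B p r := by
  by_cases hp : p ∈ B
  · obtain ⟨y, hy⟩ := R.exists_sat p
    exact D.upExactOn _ hB.isLowerSet hy (hB.exact_bdry y hy.bot_mem hy.1 (hB.sat_subset hy hp) _
      (by omega))
  · exact CellIncidence.upExactOn_of_notMem _ hB.isLowerSet hp r

theorem upExactOn_interior {p : P} {r : ℕ} (h : r < n + 1) :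
    (D.toIncidence hB.isSpherical).UpExactOn Bᶜ p r :=
  CellIncidence.upExactOn_compl _ hB.isLowerSet (hB.upExactOn_univ D (Or.inl h))
    fun _ j hj => hB.upExactOn_bdry D (by omega)

theorem dualWeight_bdry (x : P) :
    (D.toIncidence hB.isSpherical).dualWeight (fun z => if z ∈ B then 1 else 0) n x
      = if x ∈ B then 1 else 0 := by
  split_ifs with hx
  · obtain ⟨y, hy⟩ := R.exists_sat x
    exact CellIncidence.dualWeight_indicator_eq_one _ hB.isLowerSet
      (fun r hr => hB.upExactOn_bdry D hr.ne)
      (D.exists_top_cycle hB.isLowerSet hy hB.rank_bdry_le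
        (hB.top_bdry y hy.bot_mem hy.1 (hB.sat_subset hy hx)))
  · refine Finset.sum_eq_zero fun z _ => ?_
    by_cases h1 : x ≤ z
    · beta_reduce
      rw [if_neg fun h2 => hx (hB.isLowerSet h1 h2), mul_zero, ite_self]
    · exact if_neg fun h => h1 h.1

theorem dualWeight_univ (x : P) :
    (D.toIncidence hB.isSpherical).dualWeight (fun _ => 1) (n + 1) x
      = if x ∈ B then 0 else 1 := by
  split_ifs with hx
  · have h1 := CellIncidence.dualWeight_indicator_eq_zero (D.toIncidence hB.isSpherical)
      isLowerSet_univ (p := x) (m := n + 2) (fun r _ => hB.upExactOn_univ D (Or.inr hx))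
      fun z _ hz => by
        have := hB.rank_le z
        have : R.ρ z = n + 2 := hz
        omega
    rw [CellIncidence.dualWeight_succ, Finset.sum_eq_zero, zero_sub, neg_eq_zero] at h1
    · simpa only [Set.mem_univ, if_true] using h1
    · intro z _
      refine if_neg fun h => ?_
      have := hB.rank_le z
      have : R.ρ z = n + 2 := h.2
      omega
  · obtain ⟨y, hy⟩ := R.exists_sat x
    have h1 := CellIncidence.dualWeight_indicator_eq_one (D.toIncidence hB.isSpherical)
      isLowerSet_univ
      (fun r hr => hB.upExactOn_univ D (Or.inl hr))
      (D.exists_top_cycle isLowerSet_univ hy (fun z _ => hB.rank_le z)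
        (hB.top y hy.bot_mem hy.1 fun h => hx (h hy.2.1)))
    simpa only [Set.mem_univ, if_true] using h1

theorem dualWeight_interior (x : P) :
    (D.toIncidence hB.isSpherical).dualWeight (fun z => if z ∈ B then 0 else 1) (n + 1) x = 1 := by
  have h1 : (D.toIncidence hB.isSpherical).dualWeight (fun z => if z ∈ B then 0 else 1) (n + 1) x
      = (D.toIncidence hB.isSpherical).dualWeight (fun _ => 1) (n + 1) x
        - (D.toIncidence hB.isSpherical).dualWeight (fun z => if z ∈ B then 1 else 0) (n + 1) x := by
    simp only [CellIncidence.dualWeight]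
    rw [← Finset.sum_sub_distrib]
    refine Finset.sum_congr rfl fun z _ => ?_
    by_cases hz : z ∈ B <;> simp [hz]
  have h2 : (D.toIncidence hB.isSpherical).dualWeight (fun z => if z ∈ B then 1 else 0) (n + 1) x
      = - if x ∈ B then 1 else 0 := by
    rw [CellIncidence.dualWeight_succ, Finset.sum_eq_zero, zero_sub, hB.dualWeight_bdry]
    intro z _
    split_ifs with h1 h2
    · have := hB.rank_bdry_le z h2
      have : R.ρ z = n + 1 := h1.2
      omega
    · rfl
    · rfl
  rw [h1, h2, hB.dualWeight_univ]
  split_ifs <;> simp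

end IsBall

end Ranking

end

section Assembly

open OrderComplex

variable {P : Type u} [Fintype P] [PartialOrder P] [OrderBot P] {rk : P → ℕ} {n : ℕ} {B : Set P}

omit [OrderBot P] in
theorem IsGradedOn.strictMono {m : P} (h : IsGradedOn (Set.univ : Set P) m rk n) :
    StrictMono rk := by
  intro a b hab
  induction a using WellFoundedGT.induction with
  | _ a ih =>
    obtain ⟨c, hac, hcb⟩ := exists_covBy_le_of_lt hab
    have h1 := h.2.2.1 a trivial c trivial hac.lt fun ⟨d, _, h1, h2⟩ => hac.2 h1 h2
    rcases hcb.eq_or_lt with rfl | hcb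
    · omega
    · have := ih c hac.lt hcb
      omega

omit [OrderBot P] in
theorem IsGradedOn.exists_top {S : Set P} {m : P} (h : IsGradedOn S m rk n) {x : P} (hx : x ∈ S) :
    ∃ t ∈ S, x ≤ t ∧ rk t = rk m + n := by
  obtain ⟨t, hxt, ht⟩ := (Set.toFinite S).exists_le_maximal hx
  exact ⟨t, ht.1, hxt, h.2.2.2 t ht.1 fun b hb => ht.not_gt hb⟩

omit [Fintype P] in
theorem IsNearGorensteinStarOn.isLowerSet
    (h : IsNearGorensteinStarOn (Set.univ : Set P) B ⊥ rk n) : IsLowerSet B :=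
  fun a b hba ha => h.2.2.1 a ha b trivial hba

theorem IsNearGorensteinStarOn.rank_pos
    (h : IsNearGorensteinStarOn (Set.univ : Set P) B ⊥ rk n) : n ≠ 0 := by
  rintro rfl
  have h1 : HEx (Set.univ : Set P) {⊥} 1 := by
    refine HEx_of_finrank (by simp) ?_
    rw [h.2.2.2.2.2 {⊥} ⟨by simp, Set.subset_univ _, by simp⟩ 1, if_neg, add_zero]
    simpa using h.2.2.2.1.1
  obtain ⟨e, he, hec⟩ := h1 (Pi.single {⊥} 1)
    (fun y hy => by
      have : y = {⊥} := by
        by_contra h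
        exact hy (Pi.single_eq_of_ne h _)
      subst this
      simp)
    (fun y hy => by
      by_contra h0
      obtain ⟨σ, hσ, h1⟩ := bd_ne_zero h0
      have : insert σ y = {⊥} := by
        by_contra h
        exact h1 (Pi.single_eq_of_ne h _)
      have h2 : σ = ⊥ := by
        simpa [this] using Finset.mem_insert_self σ y
      exact hσ (hy (by simp [h2])))
  have h2 : bd e {⊥} ≠ 0 := by
    rw [hec {⊥} subset_rfl]
    simp
  obtain ⟨σ, hσ, -⟩ := bd_ne_zero h2
  have hσ' : ⊥ < σ := bot_lt_iff_ne_bot.2 (by simpa using hσ)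
  obtain ⟨t, -, hσt, ht⟩ := h.1.exists_top (Set.mem_univ σ)
  have := h.1.strictMono (hσ'.trans_le hσt)
  omega

/-- The rank function of a graded poset, normalized to vanish at the least element. -/
def IsGradedOn.ranking (h : IsGradedOn (Set.univ : Set P) ⊥ rk n) : Ranking P where
  ρ x := rk x - rk ⊥
  bot := Nat.sub_self _
  mono x y hxy := by
    have h1 := h.strictMono hxy
    have h2 := h.strictMono.monotone (bot_le (a := x))
    change rk x - rk ⊥ < rk y - rk ⊥
    omega
  cov x y hxy := by
    obtain ⟨c, hxc, hcy⟩ := exists_covBy_le_of_lt hxy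
    refine ⟨c, hxc.lt, hcy, ?_⟩
    have h1 := h.2.2.1 x trivial c trivial hxc.lt fun ⟨d, _, h1, h2⟩ => hxc.2 h1 h2
    have h2 := h.strictMono.monotone (bot_le (a := x))
    omega

theorem IsGradedOn.ranking_add (h : IsGradedOn (Set.univ : Set P) ⊥ rk n) (x : P) :
    h.ranking.ρ x + rk ⊥ = rk x :=
  Nat.sub_add_cancel (h.strictMono.monotone bot_le)

theorem IsNearGorensteinStarOn.isBall
    (h : IsNearGorensteinStarOn (Set.univ : Set P) B ⊥ rk (n + 1)) : h.1.ranking.IsBall B n := by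
  have hrank_le : ∀ x, h.1.ranking.ρ x ≤ n + 1 := fun x => by
    obtain ⟨t, -, hxt, ht⟩ := h.1.exists_top (Set.mem_univ x)
    have := h.1.strictMono.monotone hxt
    have := h.1.ranking_add x
    omega
  have hrank_bdry : ∀ x ∈ B, h.1.ranking.ρ x ≤ n := fun x hx => by
    obtain ⟨t, -, hxt, ht⟩ := h.2.2.2.1.exists_top hx
    have := h.1.strictMono.monotone hxt
    have := h.1.ranking_add x
    omega
  refine ⟨h.isLowerSet, h.2.2.2.1.1, hrank_le, fun x => ?_, hrank_bdry, fun y hy hc k hk => ?_,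
    fun y hy hc hyB => ?_, fun y hy hc hyB k hk => ?_, fun y hy hc hyB => ?_⟩
  · obtain ⟨t, -, hxt, ht⟩ := h.1.exists_top (Set.mem_univ x)
    have := h.1.ranking_add t
    exact ⟨t, hxt, by omega⟩
  · refine HEx_of_finrank hy ?_
    rw [h.2.2.2.2.2 y ⟨hy, Set.subset_univ _, hc⟩ k, if_neg, add_zero]
    rintro ⟨h1, h2⟩
    exact hk.elim (fun h3 => h3 h1) h2
  · refine HTop_of_finrank hy ?_ fun Y hY _ => Ranking.card_le (R := h.1.ranking) hY fun t _ => ?_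
    · rw [h.2.2.2.2.2 y ⟨hy, Set.subset_univ _, hc⟩ (n + 2), if_pos ⟨rfl, hyB⟩]
    · have := hrank_le t
      omega
  · refine HEx_of_finrank hy ?_
    rw [h.2.2.2.2.1 y ⟨hy, hyB, hc⟩ k, if_neg, add_zero]
    simpa using hk
  · refine HTop_of_finrank hy ?_ fun Y hY hYB =>
      Ranking.card_le (R := h.1.ranking) hY fun t ht => ?_
    · rw [h.2.2.2.2.1 y ⟨hy, hyB, hc⟩ (n + 1), if_pos (by simp)]
    · have := hrank_bdry t (hYB ht)
      omega

end Assembly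

end

/-- **Theorem.** The `cd`-index of a near-Gorenstein* poset has non-negative integer
coefficients: if `(Π, ∂Π)` is near-Gorenstein* of rank `n`, writing the `ab`-index as
`Ψ_Π(a,b) = Φ_Π(a,b) + Ψ_{∂Π}(a,b)·a` with `Φ_Π` a homogeneous `cd`-polynomial of
degree `n`, all coefficients of the `cd`-index `Ψ_Π(c,d) = Φ_Π(c,d) + Ψ_{∂Π}(c,d)` are
non-negative integers. -/
theorem cd_index_nonneg_of_nearGorensteinStar
    {P : Type*} [Fintype P] [PartialOrder P] [OrderBot P]
    (rk : P → ℕ) (n : ℕ) (B : Set P)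
    (hng : IsNearGorensteinStarOn (Set.univ : Set P) B (⊥ : P) rk n) :
    ∃ f g : List Bool →₀ ℤ,
      absIndexOn (Set.univ : Set P) (⊥ : P) rk n = cdEval f + cdEval g * va ∧
      (∀ w ∈ f.support, cdDeg w = n) ∧
      absIndexOn B (⊥ : P) rk (n - 1) = cdEval g ∧
      ∀ w, 0 ≤ f w + g w := by
  obtain ⟨n, rfl⟩ := Nat.exists_eq_succ_of_ne_zero hng.rank_pos
  have hB := hng.isBall
  have hrk := hng.1.strictMono
  obtain ⟨D⟩ := hB.isSpherical.exists_orientation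
  let I : CellIncidence P := D.toIncidence hB.isSpherical
  have hI : ∀ x, I.ρ x + rk ⊥ = rk x := hng.1.ranking_add
  have hle : ∀ x, I.ρ x ≤ n + 1 := hB.rank_le
  have hleB : ∀ x ∈ B, I.ρ x ≤ n := hB.rank_bdry_le
  have hcone := CellSheaf.rankSum_sub_defectSum_mem_cdCone (I := I) hng.1.ranking.bot I.isEulerian
    (ψ := chainTo rk) (θ := fun z => chainGen rk (Set.Iio z) (rk z)) (fun _ => rfl)
    fun z hz => by
      rw [chainGen_eq hrk (isLowerSet_Iio z) (bot_lt_iff_ne_bot.2 hz)]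
      refine Finset.sum_congr rfl fun x _ => ?_
      have h1 : rk z - 1 - rk x = I.ρ z - 1 - I.ρ x := by
        have := hI x
        have := hI z
        omega
      simp only [Set.mem_Iio, h1]
  have hF := hcone (n + 1) (CellIncidence.indicator Bᶜ hB.isLowerSet.compl.ordConnected)
    fun p r hr => (hB.upExactOn_interior D hr).indicator I _
  have hG := hcone n (CellIncidence.indicator B hB.isLowerSet.ordConnected)
    fun p r hr => (hB.upExactOn_bdry D hr.ne).indicator I _
  have hw : (fun x => (Module.finrank ℝ
      ((CellIncidence.indicator Bᶜ hB.isLowerSet.compl.ordConnected).W x) : ℤ))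
      = fun z => if z ∈ B then 0 else 1 := funext fun x => by
    rw [CellIncidence.finrank_indicator]
    by_cases hx : x ∈ B <;> simp [hx]
  rw [hw, CellIncidence.defectSum_succ_eq_rankSum] at hF
  rw [funext (CellIncidence.finrank_indicator hB.isLowerSet.ordConnected)] at hG
  have hdefG : I.defectSum (chainTo rk) (va - vb) (fun x => if x ∈ B then 1 else 0) n = 0 := by
    refine Finset.sum_eq_zero fun x _ => ?_
    rw [hB.dualWeight_bdry D x, sub_self, zero_smul, ite_self]
  have hdefF : (fun x => I.dualWeight (fun z => if z ∈ B then 0 else 1) (n + 1) x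
      - if x ∈ B then 0 else 1) = fun x => if x ∈ B then 1 else 0 := funext fun x => by
    rw [hB.dualWeight_interior D x]
    split_ifs <;> simp
  rw [hdefG, zero_mul, sub_zero] at hG
  rw [hdefF] at hF
  have hΨB : absIndexOn B ⊥ rk n
      = I.rankSum (chainTo rk) (va - vb) (fun x => if x ∈ B then 1 else 0) n := by
    refine (chainGen_eq hrk hB.isLowerSet hB.bot_mem (rk ⊥ + n + 1)).trans
      (Finset.sum_congr rfl fun x _ => ?_)
    beta_reduce
    by_cases hx : x ∈ B
    · have h1 : rk ⊥ + n + 1 - 1 - rk x = n - I.ρ x := by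
        have := hI x
        omega
      rw [if_pos hx, if_pos (hleB x hx), if_pos hx, one_smul, h1]
    · rw [if_neg hx, if_neg hx, zero_smul, ite_self]
  have hΨ : absIndexOn (Set.univ : Set P) ⊥ rk (n + 1)
      = I.rankSum (chainTo rk) (va - vb) (fun x => if x ∈ B then 0 else 1) (n + 1)
        + I.rankSum (chainTo rk) (va - vb) (fun x => if x ∈ B then 1 else 0) n * (va - vb) := by
    refine (chainGen_eq hrk isLowerSet_univ trivial (rk ⊥ + (n + 1) + 1)).trans ?_
    rw [CellIncidence.rankSum, CellIncidence.rankSum, Finset.sum_mul, ← Finset.sum_add_distrib]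
    refine Finset.sum_congr rfl fun x _ => ?_
    have h1 : rk ⊥ + (n + 1) + 1 - 1 - rk x = n + 1 - I.ρ x := by
      have := hI x
      omega
    rw [if_pos (Set.mem_univ x), if_pos (hle x), h1]
    by_cases hx : x ∈ B
    · have h2 : n + 1 - I.ρ x = n - I.ρ x + 1 := by
        have := hleB x hx
        omega
      rw [if_pos hx, if_pos (hleB x hx), if_pos hx, one_smul, zero_smul, zero_add, h2, pow_succ,
        mul_assoc]
    · rw [if_neg hx, if_neg hx, one_smul, zero_smul, ite_self, zero_mul, add_zero]
  obtain ⟨f, hf0, hfd, hf⟩ := exists_cdEval_of_mem_cdCone hF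
  obtain ⟨g, hg0, -, hg⟩ := exists_cdEval_of_mem_cdCone hG
  refine ⟨f, g, ?_, hfd, hΨB.trans hg.symm, fun w => add_nonneg (hf0 w) (hg0 w)⟩
  refine hΨ.trans ?_
  rw [hf, hg]
  noncomm_ring
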